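/- For every ε > 0 there exist δ > 0 and C > 0 such that the following holds. Let p be a prime, let χ be a nontrivial Dirichlet character mod p, and let A = {a₀ + a₁x₁ + a₂x₂ : x₁, x₂ ∈ ℤ, 1 ≤ x₁ ≤ H₁, 1 ≤ x₂ ≤ H₂} ⊆ F_p be a proper generalized arithmetic progression of rank 2 (so a₁, a₂ ≠ 0 and |A| = H₁H₂). If |A| ≥ p^{1/4+ε}, then |Σ_{n∈A} χ(n)| ≤ C · p^{−δ} · |A|. -/

import Mathlib

open Finset

section Stepanov

open Polynomial

variable {F : Type*} [Field F]

/-- The linear map on polynomials sending `X ^ n` to `X ^ (n - l)` if `n ≡ l` modulo `M`, and to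
zero otherwise. -/
noncomputable def residuePart (M l : ℕ) : F[X] →ₗ[F] F[X] :=
  Polynomial.lsum fun n => if n % M = l then Polynomial.monomial (n - l) else 0

lemma residuePart_monomial (M l n : ℕ) (a : F) :
    residuePart M l (monomial n a) = if n % M = l then monomial (n - l) a else 0 := by
  rw [residuePart, Polynomial.lsum_apply, Polynomial.sum_monomial_index _ _ (by simp)]
  split_ifs <;> simp

lemma residuePart_mem_degreeLT {M l n : ℕ} {k : F[X]} (hk : k ∈ degreeLT F n) :
    residuePart M l k ∈ degreeLT F n := by
  rw [residuePart, Polynomial.lsum_apply, Polynomial.sum_def]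
  refine Submodule.sum_mem _ fun i hi => ?_
  have hi' : i < n := by
    by_contra h
    rw [mem_degreeLT] at hk
    exact (mem_support_iff.1 hi) (coeff_eq_zero_of_degree_lt (hk.trans_le (by
      exact_mod_cast not_lt.1 h)))
  split_ifs
  · rw [mem_degreeLT]
    exact (degree_monomial_le _ _).trans_lt (by exact_mod_cast (by omega))
  · simp

lemma X_pow_sub_C_dvd_sub_residuePart {M : ℕ} (hM : 0 < M) (k : F[X]) (x : F) :
    (X ^ M - C (x ^ M)) ∣ k - ∑ l ∈ range M, X ^ l * C ((residuePart M l k).eval x) := by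
  induction k using Polynomial.induction_on' with
  | add p q hp hq =>
    convert dvd_add hp hq using 1
    simp only [map_add, eval_add, mul_add, Finset.sum_add_distrib]
    ring
  | monomial n a =>
    have h1 : ∑ l ∈ range M, X ^ l * C ((residuePart M l (monomial n a)).eval x)
        = X ^ (n % M) * C (a * x ^ (n - n % M)) := by
      rw [Finset.sum_eq_single (n % M)]
      · simp [residuePart_monomial]
      · intro b _ hb
        simp [residuePart_monomial, hb.symm]
      · intro h
        exact absurd (mem_range.2 (Nat.mod_lt _ hM)) h
    have h2 : n - n % M = M * (n / M) := by
      have := Nat.div_add_mod n M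
      omega
    have h3 : (monomial n a : F[X]) = C a * (X ^ (n % M) * (X ^ M) ^ (n / M)) := by
      rw [← C_mul_X_pow_eq_monomial, ← pow_mul, ← pow_add, Nat.mod_add_div]
    rw [h1, h2, h3, pow_mul x, C_mul, C_pow (n := n / M)]
    have := (sub_dvd_pow_sub_pow (X ^ M : F[X]) (C (x ^ M)) (n / M)).mul_left (C a * X ^ (n % M))
    convert this using 1
    ring

/-- A combination of powers of a polynomial vanishing to order exactly `c` at `0`, with exponents
far apart, is nonzero. -/
lemma sum_mul_pow_ne_zero {N c d : ℕ} {g₁ : F[X]} (hg₁ : g₁.eval 0 ≠ 0) {k : Fin N → F[X]}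
    (hk : ∀ n, k n ∈ degreeLT F c) (hne : k ≠ 0) :
    ∑ n : Fin N, k n * (X ^ c * g₁) ^ ((n : ℕ) % d) * X ^ ((c * d + 1) * ((n : ℕ) / d)) ≠ 0 := by
  classical
  intro h0
  obtain ⟨n₁, hn₁⟩ : ∃ n, k n ≠ 0 := by
    by_contra! h
    exact hne (funext h)
  have hex : ∃ m : ℕ, ∃ hm : m < N, k ⟨m, hm⟩ ≠ 0 := ⟨n₁, n₁.2, hn₁⟩
  set m := Nat.find hex with hmdef
  obtain ⟨hmN, hkm⟩ := Nat.find_spec hex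
  have hmin : ∀ j < m, ∀ hj : j < N, k ⟨j, hj⟩ = 0 := by
    intro j hj hjN
    by_contra h
    exact Nat.find_min hex hj ⟨hjN, h⟩
  have hterm : ∀ n : Fin N,
      k n * (X ^ c * g₁) ^ ((n : ℕ) % d) * X ^ ((c * d + 1) * ((n : ℕ) / d))
        = X ^ (c * (n : ℕ) + (n : ℕ) / d) * (k n * g₁ ^ ((n : ℕ) % d)) := by
    intro n
    have : c * (n : ℕ) + (n : ℕ) / d = c * ((n : ℕ) % d) + (c * d + 1) * ((n : ℕ) / d) := by
      conv_lhs => rw [← Nat.mod_add_div (n : ℕ) d]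
      rw [Nat.mod_add_div]
      have := Nat.mod_add_div (n : ℕ) d
      calc c * (n : ℕ) + (n : ℕ) / d = c * ((n : ℕ) % d + d * ((n : ℕ) / d)) + (n : ℕ) / d := by
            rw [this]
        _ = _ := by ring
    rw [this, pow_add, pow_mul X c]
    ring
  simp only [hterm] at h0
  have hdvd : X ^ (c * m + m / d + c) ∣
      X ^ (c * m + m / d) * (k ⟨m, hmN⟩ * g₁ ^ (m % d)) := by
    rw [← Finset.add_sum_erase _ _ (mem_univ (⟨m, hmN⟩ : Fin N))] at h0
    rw [eq_neg_of_add_eq_zero_left h0]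
    refine (dvd_neg).2 (Finset.dvd_sum fun n hn => ?_)
    rcases lt_trichotomy (n : ℕ) m with h | h | h
    · have := hmin n h n.2
      simp only [Fin.eta] at this
      simp [this]
    · exact absurd (Fin.ext h) (ne_of_mem_erase hn)
    · refine (pow_dvd_pow X ?_).mul_right _
      have h1 : c * (m + 1) ≤ c * (n : ℕ) := Nat.mul_le_mul_left _ h
      have h2 : m / d ≤ (n : ℕ) / d := Nat.div_le_div_right h.le
      rw [mul_add] at h1
      omega
  rw [pow_add X _ c] at hdvd
  have hdvd2 := (mul_dvd_mul_iff_left (pow_ne_zero _ X_ne_zero)).1 hdvd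
  have hcop : IsCoprime (X ^ c) (g₁ ^ (m % d)) := by
    refine IsCoprime.pow ?_
    have : (X : F[X]) = X - C 0 := by simp
    rw [this]
    exact ((irreducible_X_sub_C (0 : F)).coprime_iff_not_dvd).2 (by rwa [dvd_iff_isRoot])
  have hdvd3 := hcop.dvd_of_dvd_mul_right hdvd2
  refine hkm (eq_zero_of_dvd_of_degree_lt hdvd3 ?_)
  rw [degree_X_pow]
  exact mem_degreeLT.1 (hk _)

lemma mul_mem_degreeLT {a b : F[X]} {m n : ℕ} (ha : a ∈ degreeLT F m) (hb : b.natDegree ≤ n) :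
    a * b ∈ degreeLT F (m + n) := by
  rcases eq_or_ne a 0 with rfl | ha0
  · simp
  rcases eq_or_ne b 0 with rfl | hb0
  · simp
  rw [mem_degreeLT] at ha ⊢
  rw [degree_eq_natDegree ha0] at ha
  rw [degree_eq_natDegree (mul_ne_zero ha0 hb0), natDegree_mul ha0 hb0]
  norm_cast at *
  omega

lemma degreeLT_mem_mono {a : F[X]} {m n : ℕ} (hmn : m ≤ n) (ha : a ∈ degreeLT F m) :
    a ∈ degreeLT F n := degreeLT_mono hmn ha

lemma natDegree_pow_mul_X_pow_le (G : F[X]) {e i b : ℕ} (hb : G.natDegree ≤ b) :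
    (G ^ e * X ^ i).natDegree ≤ e * b + i := by
  refine natDegree_mul_le.trans ?_
  rw [natDegree_X_pow]
  gcongr
  exact natDegree_pow_le.trans (by gcongr)

/-- The linear conditions in Stepanov's method have a nontrivial solution. -/
lemma exists_stepanov_coefficients {N c d M s m L : ℕ} (hd : 0 < d) (G : F[X])
    (hG : G.natDegree ≤ s * m) (ζ : F)
    (hL : ∀ n < N, c + (d - 1) * (s * m) + n / d ≤ L) (hlt : M * L < N * c) :
    ∃ k : Fin N → F[X], k ≠ 0 ∧ (∀ n, k n ∈ degreeLT F c) ∧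
      ∀ l, l < M → ∑ n : Fin N, C (ζ ^ ((n : ℕ) % d)) *
        (residuePart M l (k n * G ^ ((n : ℕ) % d)) *
          (G ^ (d - 1 - (n : ℕ) % d) * X ^ ((n : ℕ) / d))) = 0 := by
  classical
  let Ψ (l : ℕ) : (Fin N → degreeLT F c) →ₗ[F] F[X] :=
    ∑ n : Fin N, (LinearMap.mulLeft F (C (ζ ^ ((n : ℕ) % d)))) ∘ₗ
      (LinearMap.mulRight F (G ^ (d - 1 - (n : ℕ) % d) * X ^ ((n : ℕ) / d))) ∘ₗ
      (residuePart M l) ∘ₗ (LinearMap.mulRight F (G ^ ((n : ℕ) % d))) ∘ₗ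
      (degreeLT F c).subtype ∘ₗ (LinearMap.proj n)
  have hΨ : ∀ l k, Ψ l k = ∑ n : Fin N, C (ζ ^ ((n : ℕ) % d)) *
        (residuePart M l ((k n : F[X]) * G ^ ((n : ℕ) % d)) *
          (G ^ (d - 1 - (n : ℕ) % d) * X ^ ((n : ℕ) / d))) := by
    intro l k
    simp [Ψ, mul_assoc]
  have hmem : ∀ l k, Ψ l k ∈ degreeLT F L := by
    intro l k
    rw [hΨ]
    refine Submodule.sum_mem _ fun n _ => ?_
    rw [← smul_eq_C_mul]
    refine Submodule.smul_mem _ _ ?_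
    have h1 := residuePart_mem_degreeLT (M := M) (l := l)
      (mul_mem_degreeLT (k n).2 (natDegree_pow_le.trans
        (Nat.mul_le_mul_left ((n : ℕ) % d) hG)))
    have h2 := mul_mem_degreeLT h1 (natDegree_pow_mul_X_pow_le G
      (e := d - 1 - (n : ℕ) % d) (i := (n : ℕ) / d) hG)
    refine degreeLT_mem_mono ?_ h2
    refine le_trans (le_of_eq ?_) (hL n n.2)
    have h3 : (n : ℕ) % d + (d - 1 - (n : ℕ) % d) = d - 1 := by
      have := Nat.mod_lt (n : ℕ) hd
      omega
    generalize d - 1 - (n : ℕ) % d = e at h3 ⊢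
    rw [← h3]
    ring
  let Φ : (Fin N → degreeLT F c) →ₗ[F] (Fin M → degreeLT F L) :=
    LinearMap.pi fun l => LinearMap.codRestrict _ (Ψ l) (hmem l)
  have hker : LinearMap.ker Φ ≠ ⊥ := by
    apply LinearMap.ker_ne_bot_of_finrank_lt
    rw [Module.finrank_pi_fintype, Module.finrank_pi_fintype]
    simp only [(degreeLTEquiv F _).finrank_eq, Module.finrank_fin_fun]
    simpa using hlt
  obtain ⟨k, hk, hk0⟩ := (Submodule.ne_bot_iff _).1 hker
  refine ⟨fun n => k n, ?_, fun n => (k n).2, fun l hl => ?_⟩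
  · intro h
    apply hk0
    funext n
    exact Subtype.ext (congrFun h n)
  · have h1 : Φ k ⟨l, hl⟩ = 0 := by
      rw [LinearMap.mem_ker.1 hk]; rfl
    have h2 := congrArg Subtype.val h1
    rw [← hΨ]
    exact h2

/-- Stepanov's auxiliary polynomial vanishes to high order. -/
lemma X_sub_C_pow_dvd_stepanov {p h N c d M s : ℕ} [CharP F p] [hp : Fact p.Prime]
    (hM : M = p ^ h) (hd : 0 < d) (hc : c = s * (M + 1)) (f : F[X]) {ζ x : F} (hζ : ζ ≠ 0)
    (hxQ : x ^ (M * M) = x) (hx : f.eval x ^ c = ζ) (hQ : c * d + 1 = M * M) (k : Fin N → F[X])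
    (hk : ∀ l, l < M → ∑ n : Fin N, C (ζ ^ ((n : ℕ) % d)) *
        (residuePart M l (k n * (f ^ s) ^ ((n : ℕ) % d)) *
          ((f ^ s) ^ (d - 1 - (n : ℕ) % d) * X ^ ((n : ℕ) / d))) = 0) :
    (X - C x) ^ M ∣
      ∑ n : Fin N, k n * (f ^ c) ^ ((n : ℕ) % d) * X ^ ((c * d + 1) * ((n : ℕ) / d)) := by
  have hM0 : 0 < M := by rw [hM]; exact pow_pos hp.out.pos _
  have hfrob : ∀ a : F[X], ∀ b : F, (a - C b) ^ M = a ^ M - C (b ^ M) := by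
    intro a b
    rw [hM, sub_pow_char_pow, C_pow]
  set γ : F := f.eval x ^ s with hγ
  have hγM : γ ^ M * γ = ζ := by
    rw [← hx, hc, hγ]
    ring
  have hγ0 : γ ≠ 0 := by
    rintro h0
    rw [h0, mul_zero] at hγM
    exact hζ hγM.symm
  -- Congruences modulo `(X - C x) ^ M`.
  have hX : (X - C x) ^ M ∣ X ^ (c * d + 1) - C x := by
    have h1 := sub_dvd_pow_sub_pow (X ^ M : F[X]) (C (x ^ M)) M
    rw [← hfrob, ← pow_mul, ← C_pow, ← pow_mul, hxQ, ← hQ] at h1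
    exact h1
  have hG : (X - C x) ^ M ∣ (f ^ s) ^ M - C (γ ^ M) := by
    rw [← hfrob]
    refine pow_dvd_pow_of_dvd ?_ M
    rw [dvd_iff_isRoot]
    simp [hγ]
  have hterm : ∀ n : Fin N, (X - C x) ^ M ∣
      C (γ ^ (d - 1)) * (k n * (f ^ c) ^ ((n : ℕ) % d) * X ^ ((c * d + 1) * ((n : ℕ) / d)))
      - ∑ l ∈ range M, X ^ l * C ((C (ζ ^ ((n : ℕ) % d)) *
        (residuePart M l (k n * (f ^ s) ^ ((n : ℕ) % d)) *
          ((f ^ s) ^ (d - 1 - (n : ℕ) % d) * X ^ ((n : ℕ) / d)))).eval x) := by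
    intro n
    set j := (n : ℕ) % d with hj
    set i := (n : ℕ) / d with hi
    have hjd : j ≤ d - 1 := by
      have := Nat.mod_lt (n : ℕ) hd
      omega
    have e1 : (X - C x) ^ M ∣ X ^ ((c * d + 1) * i) - C (x ^ i) := by
      rw [pow_mul, C_pow]
      exact hX.trans (sub_dvd_pow_sub_pow _ _ i)
    have e2 : (X - C x) ^ M ∣ (f ^ c) ^ j - C (γ ^ M) ^ j * (f ^ s) ^ j := by
      rw [← mul_pow]
      refine dvd_trans ?_ (sub_dvd_pow_sub_pow _ _ j)
      have : f ^ c - C (γ ^ M) * f ^ s = ((f ^ s) ^ M - C (γ ^ M)) * f ^ s := by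
        rw [hc]; ring
      rw [this]
      exact hG.mul_right _
    have e3 : (X - C x) ^ M ∣ k n * (f ^ s) ^ j -
        ∑ l ∈ range M, X ^ l * C ((residuePart M l (k n * (f ^ s) ^ j)).eval x) := by
      rw [hfrob]
      exact X_pow_sub_C_dvd_sub_residuePart hM0 _ _
    have h4 : γ ^ (d - 1) * (γ ^ M) ^ j = ζ ^ j * γ ^ (d - 1 - j) := by
      rw [← hγM, mul_pow]
      conv_lhs => rw [← Nat.sub_add_cancel hjd, pow_add]
      ring
    have e4 : ∑ l ∈ range M, X ^ l * C ((C (ζ ^ j) *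
        (residuePart M l (k n * (f ^ s) ^ j) * ((f ^ s) ^ (d - 1 - j) * X ^ i))).eval x)
        = C (ζ ^ j * γ ^ (d - 1 - j) * x ^ i) *
          ∑ l ∈ range M, X ^ l * C ((residuePart M l (k n * (f ^ s) ^ j)).eval x) := by
      rw [Finset.mul_sum]
      refine Finset.sum_congr rfl fun l _ => ?_
      simp only [eval_mul, eval_C, eval_pow, eval_X, ← hγ, C_mul]
      ring
    rw [e4]
    have key := dvd_add (dvd_add (e1.mul_left (C (γ ^ (d - 1)) * (k n * (f ^ c) ^ j)))
      (e2.mul_left (C (γ ^ (d - 1)) * k n * C (x ^ i))))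
      (e3.mul_left (C (ζ ^ j * γ ^ (d - 1 - j) * x ^ i)))
    convert key using 1
    rw [← h4]
    simp only [C_mul, C_pow]
    ring
  have hsum := Finset.dvd_sum (s := univ) fun n _ => hterm n
  rw [Finset.sum_sub_distrib, ← Finset.mul_sum, Finset.sum_comm] at hsum
  have hz : ∑ l ∈ range M, ∑ n : Fin N, (X : F[X]) ^ l * C ((C (ζ ^ ((n : ℕ) % d)) *
        (residuePart M l (k n * (f ^ s) ^ ((n : ℕ) % d)) *
          ((f ^ s) ^ (d - 1 - (n : ℕ) % d) * X ^ ((n : ℕ) / d)))).eval x) = 0 := by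
    refine Finset.sum_eq_zero fun l hl => ?_
    rw [← Finset.mul_sum, ← map_sum C, ← eval_finsetSum, hk l (mem_range.1 hl)]
    simp
  rw [hz, sub_zero] at hsum
  exact (IsUnit.dvd_mul_left ((isUnit_C).2 (IsUnit.mk0 _ (pow_ne_zero _ hγ0)))).1 hsum

/-- Stepanov's bound for the number of solutions of `f(x) ^ ((|F| - 1) / d) = ζ`, when `f` has a
simple root at `0`. -/
theorem stepanov_card_le [Fintype F] [DecidableEq F] {p h d M s : ℕ} [CharP F p] [Fact p.Prime]
    (hM : M = p ^ h) (hF : Fintype.card F = M * M) (hd : 0 < d) (hs : M = s * d + 1)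
    {f₁ : F[X]} (hf₁ : f₁.eval 0 ≠ 0) {m : ℕ} (hm : (X * f₁).natDegree ≤ m) (hm1 : 1 ≤ m)
    (hMm : d * m + 3 ≤ M) {ζ : F} (hζ : ζ ≠ 0) :
    #{x : F | (X * f₁).eval x ^ (s * (M + 1)) = ζ} ≤ M * (s + 2 * m + 4) := by
  set f := X * f₁ with hf
  set c := s * (M + 1) with hc
  set I := s + m + 4 with hI
  set N := I * d with hN
  have hQ : c * d + 1 = M * M := by
    rw [hc, hs]; ring
  have hdiv : ∀ n < N, n / d ≤ I - 1 := by
    intro n hn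
    have : n / d < I := (Nat.div_lt_iff_lt_mul hd).2 hn
    omega
  have hsd : (d - 1) * (s * m) ≤ M * m := by
    calc (d - 1) * (s * m) = ((d - 1) * s) * m := by ring
      _ ≤ (d * s) * m := by gcongr; omega
      _ ≤ M * m := by gcongr; rw [hs, mul_comm]; omega
  obtain ⟨k, hk0, hkc, hk⟩ := exists_stepanov_coefficients (N := N) (c := c) (M := M)
    (L := c + M * m + I) hd (f ^ s) (natDegree_pow_le.trans (Nat.mul_le_mul_left s hm)) ζ
    (fun n hn => by
      have := hdiv n hn
      omega) (by
      obtain ⟨a, ha⟩ : ∃ a, a = d * m + 3 := ⟨_, rfl⟩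
      have h1 : N * c + I = I * (M * M) := by
        rw [hN, ← hQ]; ring
      have h2 : M + a ≤ d * I := by
        rw [hI, ha, hs]
        nlinarith
      have h4 : M * (c + M * m) + I * M + I < I * (M * M) := by
        apply lt_of_mul_lt_mul_left (a := d) _ (Nat.zero_le d)
        have e1 : d * (M * (c + M * m) + I * M + I)
          = M * (c * d) + M * M * (d * m) + (d * I) * (M + 1) := by ring
        have e2 : d * (I * (M * M)) = (d * I) * (M * M) := by ring
        rw [e1, e2]
        have h3 : M * M = c * d + 1 := hQ.symm
        have ha' : d * m = a - 3 := by omega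
        have hMa : a ≤ M := by omega
        rw [ha']
        obtain ⟨b, hb⟩ : ∃ b, a = b + 3 := ⟨a - 3, by omega⟩
        obtain ⟨e, he⟩ : ∃ e, d * I = M + a + e := ⟨d * I - (M + a), by omega⟩
        rw [he]
        have hcd : c * d = M * M - 1 := by omega
        have hcd' : M * (c * d) + M = M * M * M := by
          rw [mul_assoc, ← hQ]; ring
        have hb' : a - 3 = b := by omega
        rw [hb']
        subst hb
        have hM2 : M + 1 ≤ M * M := by nlinarith
        have : e * (M + 1) ≤ e * (M * M) := Nat.mul_le_mul_left _ hM2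
        nlinarith
      have : M * (c + M * m + I) = M * (c + M * m) + I * M := by ring
      omega)
  set r := ∑ n : Fin N, k n * (f ^ c) ^ ((n : ℕ) % d) * X ^ ((c * d + 1) * ((n : ℕ) / d)) with hr
  have hr0 : r ≠ 0 := by
    have := sum_mul_pow_ne_zero (c := c) (d := d) (g₁ := f₁ ^ c)
      (by simpa using fun h => absurd h hf₁) hkc hk0
    rwa [← mul_pow] at this
  set Z := ({x : F | f.eval x ^ c = ζ} : Finset F) with hZ
  have hdvd : ∏ x ∈ Z, (X - C x) ^ M ∣ r := by
    refine Finset.prod_dvd_of_coprime ?_ ?_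
    · intro x _ y _ hxy
      exact ((pairwise_coprime_X_sub_C Function.injective_id) hxy).pow
    · intro x hx
      refine X_sub_C_pow_dvd_stepanov hM hd hc f hζ ?_ (by simpa [hZ] using hx) hQ k hk
      rw [← hF]
      exact FiniteField.pow_card x
  have hdeg := natDegree_le_of_dvd hdvd hr0
  rw [natDegree_prod_of_monic _ _ (fun x _ => (monic_X_sub_C x).pow M)] at hdeg
  simp only [natDegree_pow, natDegree_X_sub_C, mul_one, sum_const, smul_eq_mul] at hdeg
  have hrdeg : r ∈ degreeLT F (c + (d - 1) * (c * m) + (M * M) * (I - 1)) := by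
    refine Submodule.sum_mem _ fun n _ => ?_
    have h1 := mul_mem_degreeLT (hkc n) (natDegree_pow_mul_X_pow_le (f ^ c)
      (e := (n : ℕ) % d) (i := (c * d + 1) * ((n : ℕ) / d))
      (natDegree_pow_le.trans (Nat.mul_le_mul_left c hm)))
    rw [mul_assoc (k n)]
    refine degreeLT_mem_mono ?_ h1
    rw [add_assoc, hQ]
    have := Nat.mod_lt (n : ℕ) hd
    have h2 : (n : ℕ) % d ≤ d - 1 := by omega
    exact Nat.add_le_add_left (Nat.add_le_add (Nat.mul_le_mul_right _ h2)
      (Nat.mul_le_mul_left _ (hdiv n n.2))) c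
  rw [mem_degreeLT, degree_eq_natDegree hr0] at hrdeg
  norm_cast at hrdeg
  have hfin : M * #Z ≤ M * (M * (s + 2 * m + 4)) := by
    rw [mul_comm M #Z]
    refine (hdeg.trans hrdeg.le).trans ?_
    have e1 : c + (d - 1) * (c * m) ≤ M * M * m := by
      rw [← hQ]
      have h1 : c ≤ c * m := Nat.le_mul_of_pos_right c hm1
      calc c + (d - 1) * (c * m) ≤ c * m + (d - 1) * (c * m) := by gcongr
        _ = ((d - 1) + 1) * (c * m) := by ring
        _ = c * d * m := by rw [Nat.sub_add_cancel hd]; ring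
        _ ≤ (c * d + 1) * m := by gcongr; omega
    have e2 : M * M * (I - 1) ≤ M * M * I := Nat.mul_le_mul_left _ (Nat.sub_le _ _)
    calc _ ≤ M * M * m + M * M * I := add_le_add e1 e2
      _ = _ := by rw [hI]; ring
  have hM0 : 0 < M := by omega
  exact Nat.le_of_mul_le_mul_left hfin hM0

end Stepanov

section NormSum

open Polynomial

/-- Square-root cancellation over even degree extensions of a prime field, with a constant
independent of the degree of the extension. -/
theorem norm_sum_char_norm_eval_le {p : ℕ} [Fact p.Prime] {χ : MulChar (ZMod p) ℂ} (hχ : χ ≠ 1)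
    {F : Type*} [Field F] [Fintype F] [Algebra (ZMod p) F] {h : ℕ}
    (hF : Module.finrank (ZMod p) F = 2 * h) {x₀ : F}
    {f₁ : F[X]} (hf₁ : f₁.eval x₀ ≠ 0) {m : ℕ} (hm : ((X - C x₀) * f₁).natDegree ≤ m)
    (hm1 : 1 ≤ m) (hMm : (p - 1) * m + 3 ≤ p ^ h) :
    ‖∑ x : F, χ (Algebra.norm (ZMod p) (((X - C x₀) * f₁).eval x))‖
      ≤ ((p - 1 : ℕ) * (2 * m + 4) : ℕ) * (p : ℝ) ^ h := by
  classical
  have hp : p.Prime := Fact.out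
  have : CharP F p := charP_of_injective_algebraMap (algebraMap (ZMod p) F).injective p
  set f := (X - C x₀) * f₁ with hf
  set M := p ^ h with hM
  have hcard : Fintype.card F = M * M := by
    rw [Module.card_eq_pow_finrank (K := ZMod p) (V := F), ZMod.card, hF, hM]
    ring
  obtain ⟨s, hs⟩ : (p - 1) ∣ M - 1 := by
    simpa using Nat.sub_dvd_pow_sub_pow p 1 h
  have hM1 : 1 ≤ M := Nat.one_le_pow _ _ hp.pos
  have hs' : M = s * (p - 1) + 1 := by rw [mul_comm, ← hs]; omega
  have hd : 0 < p - 1 := by have := hp.two_le; omega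
  have hnorm : ∀ y : F, algebraMap (ZMod p) F (Algebra.norm (ZMod p) y) = y ^ (s * (M + 1)) := by
    intro y
    rw [FiniteField.algebraMap_norm_eq_pow]
    congr 1
    rw [Nat.card_eq_fintype_card, Nat.card_eq_fintype_card, ZMod.card, hcard]
    refine Nat.div_eq_of_eq_mul_left hd ?_
    rw [hs']
    simp only [Nat.add_mul, Nat.mul_add]
    rw [Nat.sub_eq_iff_eq_add (by nlinarith)]
    ring
  set n : ZMod p → ℕ := fun ζ => #{x : F | Algebra.norm (ZMod p) (f.eval x) = ζ} with hn
  set U := M * (s + 2 * m + 4) with hU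
  have hnU : ∀ ζ, ζ ≠ 0 → n ζ ≤ U := by
    intro ζ hζ
    have hζ' : algebraMap (ZMod p) F ζ ≠ 0 := by simpa using hζ
    have hcomp : f.comp (X + C x₀) = X * f₁.comp (X + C x₀) := by
      rw [hf, mul_comp]; simp
    have := stepanov_card_le (p := p) (h := h) hM hcard hd hs' (f₁ := f₁.comp (X + C x₀))
      (by simpa [eval_comp] using hf₁) (m := m) (by
        rw [← hcomp, natDegree_comp]; simpa using hm) hm1 hMm hζ'
    refine le_trans (le_of_eq ?_) this
    rw [hn]
    refine Finset.card_bij (fun x _ => x - x₀) ?_ ?_ ?_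
    · intro x hx
      simp only [mem_filter, mem_univ, true_and] at hx ⊢
      rw [← hcomp, eval_comp, ← hx, hnorm]
      simp
    · intro a _ b _ hab
      simpa using hab
    · intro b hb
      refine ⟨b + x₀, ?_, by simp⟩
      simp only [mem_filter, mem_univ, true_and] at hb ⊢
      apply (algebraMap (ZMod p) F).injective
      rw [hnorm, ← hb, ← hcomp, eval_comp]
      simp
  have hf0 : f ≠ 0 := by
    intro h0
    have : f₁ = 0 := by
      rcases mul_eq_zero.1 (hf.symm.trans h0) with h | h
      · exact absurd h (X_sub_C_ne_zero x₀)
      · exact h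
    simp [this] at hf₁
  have hn0 : n 0 ≤ m := by
    refine le_trans ?_ ((card_roots' f).trans hm)
    refine le_trans (Finset.card_le_card (t := f.roots.toFinset) ?_) (Multiset.toFinset_card_le _)
    intro x hx
    simp only [mem_filter, mem_univ, true_and, Algebra.norm_eq_zero_iff] at hx
    simpa [hf0] using hx
  have htotal : ∑ ζ : ZMod p, n ζ = M * M := by
    rw [← hcard, ← Finset.card_univ]
    exact (Finset.card_eq_sum_card_fiberwise (fun _ _ => mem_coe.2 (mem_univ _))).symm
  have hS : ∑ x : F, χ (Algebra.norm (ZMod p) (f.eval x)) = ∑ ζ : ZMod p, χ ζ * n ζ := by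
    rw [← Finset.sum_fiberwise_of_maps_to (g := fun x => Algebra.norm (ZMod p) (f.eval x))
      (t := univ) (fun _ _ => mem_univ _)]
    refine Finset.sum_congr rfl fun ζ _ => ?_
    rw [Finset.sum_congr rfl (g := fun _ => χ ζ) (fun x hx => by rw [(mem_filter.1 hx).2])]
    rw [Finset.sum_const, nsmul_eq_mul, mul_comm]
  have hS2 : ∑ ζ : ZMod p, χ ζ * n ζ = ∑ ζ ∈ univ.erase (0 : ZMod p), χ ζ * ((n ζ : ℂ) - U) := by
    have h0 : ∑ ζ : ZMod p, χ ζ * ((n ζ : ℂ) - U) = ∑ ζ : ZMod p, χ ζ * n ζ := by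
      simp_rw [mul_sub]
      rw [Finset.sum_sub_distrib, ← Finset.sum_mul, MulChar.sum_eq_zero_of_ne_one hχ]
      simp
    rw [← h0]
    refine (Finset.sum_erase _ ?_).symm
    rw [MulChar.map_zero, zero_mul]
  rw [hS, hS2]
  have hbound : ‖∑ ζ ∈ univ.erase (0 : ZMod p), χ ζ * ((n ζ : ℂ) - U)‖
      ≤ ∑ ζ ∈ univ.erase (0 : ZMod p), ((U : ℝ) - n ζ) := by
    refine norm_sum_le_of_le _ fun ζ hζ => ?_
    have h1 : (n ζ : ℝ) ≤ U := by exact_mod_cast hnU ζ (ne_of_mem_erase hζ)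
    have h2 : ‖χ ζ‖ ≤ 1 := DirichletCharacter.norm_le_one χ ζ
    have h3 : ‖(n ζ : ℂ) - U‖ = U - n ζ := by
      rw [← Complex.ofReal_natCast, ← Complex.ofReal_natCast, ← Complex.ofReal_sub,
        Complex.norm_real, Real.norm_eq_abs, abs_sub_comm, abs_of_nonneg (by linarith)]
    rw [norm_mul, h3]
    exact mul_le_of_le_one_left (by linarith) h2
  refine hbound.trans ?_
  rw [Finset.sum_sub_distrib, Finset.sum_const, Finset.card_erase_of_mem (mem_univ _),
    Finset.card_univ, ZMod.card]
  have h5 : ∑ ζ ∈ univ.erase (0 : ZMod p), (n ζ : ℝ) = M * M - n 0 := by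
    have := Finset.add_sum_erase univ (fun ζ => (n ζ : ℝ)) (mem_univ (0 : ZMod p))
    have h6 : ∑ ζ : ZMod p, (n ζ : ℝ) = M * M := by exact_mod_cast htotal
    linarith
  rw [h5, nsmul_eq_mul]
  have h7 : ((p - 1 : ℕ) : ℝ) * U = M * (M - 1) + ((p - 1 : ℕ) * (2 * m + 4) : ℕ) * M := by
    have : (M : ℝ) - 1 = s * ((p - 1 : ℕ) : ℝ) := by rw [hs']; push_cast; ring
    rw [this, hU]
    push_cast
    ring
  have h8 : (n 0 : ℝ) ≤ M := by
    have : n 0 ≤ M := by nlinarith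
    exact_mod_cast this
  rw [h7]
  have h9 : (M : ℝ) = (p : ℝ) ^ h := by rw [hM]; push_cast; rfl
  rw [← h9]
  linarith

end NormSum

section LFunction

open Polynomial UniqueFactorizationMonoid

variable {K : Type*} [Field K] [Finite K]

lemma finite_monic_natDegree_eq (k : ℕ) : {g : K[X] | g.Monic ∧ g.natDegree = k}.Finite := by
  have : Finite (degreeLT K (k + 1)) := Module.finite_of_finite K
  refine (Set.toFinite (degreeLT K (k + 1) : Set K[X])).subset ?_
  rintro g ⟨hg, rfl⟩
  rw [SetLike.mem_coe, mem_degreeLT, degree_eq_natDegree hg.ne_zero]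
  exact_mod_cast Nat.lt_succ_self _

variable (K) in
/-- The finite set of monic polynomials of degree `k` over a finite field. -/
noncomputable def monicPolys (k : ℕ) : Finset K[X] := (finite_monic_natDegree_eq k).toFinset

@[simp] lemma mem_monicPolys {k : ℕ} {g : K[X]} :
    g ∈ monicPolys K k ↔ g.Monic ∧ g.natDegree = k := by
  simp [monicPolys]

open Classical in
variable (K) in
/-- The finite set of monic irreducible polynomials of degree `k` over a finite field. -/
noncomputable def irreduciblePolys (k : ℕ) : Finset K[X] :=
  (monicPolys K k).filter Irreducible

@[simp] lemma mem_irreduciblePolys {k : ℕ} {g : K[X]} :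
    g ∈ irreduciblePolys K k ↔ (g.Monic ∧ g.natDegree = k) ∧ Irreducible g := by
  simp [irreduciblePolys]

open Classical in
/-- The degree of a monic polynomial, computed from its prime power divisors. -/
lemma natDegree_eq_sum_irreduciblePolys {g : K[X]} (hg : g.Monic) :
    g.natDegree = ∑ d ∈ Icc 1 g.natDegree, ∑ a ∈ Icc 1 g.natDegree,
      ∑ π ∈ irreduciblePolys K d, if π ^ a ∣ g then d else 0 := by
  set k := g.natDegree with hk
  have hcount : ∀ π : K[X], π.Monic → Irreducible π →
      (∑ a ∈ Icc 1 k, if π ^ a ∣ g then 1 else 0) = (normalizedFactors g).count π := by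
    intro π hπm hπ
    have h1 : ∀ a : ℕ, π ^ a ∣ g ↔ a ≤ (normalizedFactors g).count π := by
      intro a
      rw [pow_dvd_iff_le_emultiplicity, emultiplicity_eq_count_normalizedFactors hπ hg.ne_zero,
        hπm.normalize_eq_self]
      norm_cast
    have h2 : (normalizedFactors g).count π ≤ k := by
      have h3 := (h1 _).2 le_rfl
      have h4 := natDegree_le_of_dvd h3 hg.ne_zero
      rw [natDegree_pow] at h4
      have h5 := hπ.natDegree_pos
      nlinarith
    rw [← Finset.card_filter]
    have : (Icc 1 k).filter (fun a => π ^ a ∣ g) = Icc 1 ((normalizedFactors g).count π) := by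
      ext a
      simp only [mem_filter, mem_Icc, h1]
      omega
    rw [this]
    simp
  have hprod : (normalizedFactors g).prod = g :=
    (prod_normalizedFactors_eq hg.ne_zero).trans hg.normalize_eq_self
  have hmem : ∀ π ∈ normalizedFactors g, π.Monic ∧ Irreducible π ∧ π ∣ g := by
    intro π hπ
    have hirr := irreducible_of_normalized_factor π hπ
    refine ⟨?_, hirr, dvd_of_mem_normalizedFactors hπ⟩
    have := normalize_normalized_factor π hπ
    rw [← this]
    exact Polynomial.monic_normalize hirr.ne_zero
  have hdeg : k = ((normalizedFactors g).map natDegree).sum := by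
    conv_lhs => rw [hk, ← hprod]
    exact natDegree_multiset_prod_of_monic _ fun π hπ => (hmem π hπ).1
  have hswap : ∑ d ∈ Icc 1 k, ∑ a ∈ Icc 1 k, ∑ π ∈ irreduciblePolys K d,
      (if π ^ a ∣ g then d else 0)
      = ∑ d ∈ Icc 1 k, ∑ π ∈ irreduciblePolys K d, (normalizedFactors g).count π * π.natDegree := by
    refine Finset.sum_congr rfl fun d _ => ?_
    rw [Finset.sum_comm]
    refine Finset.sum_congr rfl fun π hπ => ?_
    rw [mem_irreduciblePolys] at hπ
    rw [← hcount π hπ.1.1 hπ.2, Finset.sum_mul, hπ.1.2]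
    refine Finset.sum_congr rfl fun a _ => ?_
    split_ifs <;> simp
  rw [Finset.sum_multiset_map_count] at hdeg
  rw [hswap]
  refine hdeg.trans ?_
  rw [Finset.sum_sigma']
  symm
  refine Finset.sum_bij_ne_zero (fun x _ _ => x.2) ?_ ?_ ?_ ?_
  · rintro ⟨d, π⟩ _ hne
    simp only [ne_eq, mul_eq_zero, not_or] at hne
    rw [Multiset.mem_toFinset]
    exact Multiset.count_pos.1 (Nat.pos_of_ne_zero hne.1)
  · rintro ⟨d, π⟩ h _ ⟨d', π'⟩ h' _ heq
    simp only [mem_sigma, mem_irreduciblePolys] at h h' heq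
    subst heq
    have : d = d' := h.2.1.2.symm.trans h'.2.1.2
    subst this
    rfl
  · intro π hπ hne
    rw [Multiset.mem_toFinset] at hπ
    obtain ⟨h1, h2, h3⟩ := hmem π hπ
    refine ⟨⟨π.natDegree, π⟩, ?_, ?_, rfl⟩
    · simp only [mem_sigma, mem_irreduciblePolys, mem_Icc]
      exact ⟨⟨h2.natDegree_pos, natDegree_le_of_dvd h3 hg.ne_zero⟩, ⟨h1, trivial⟩, h2⟩
    · simpa using hne
  · rintro ⟨d, π⟩ _ _
    simp

/-- The coefficients of the `L`-function attached to a multiplicative function on polynomials. -/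
noncomputable def lCoeff (X : K[X] →* ℂ) (k : ℕ) : ℂ := ∑ g ∈ monicPolys K k, X g

/-- The power sums of the `L`-function attached to a multiplicative function on polynomials. -/
noncomputable def lPowerSum (X : K[X] →* ℂ) (j : ℕ) : ℂ :=
  ∑ x ∈ j.divisorsAntidiagonal, ∑ π ∈ irreduciblePolys K x.1, (x.1 : ℂ) * X π ^ x.2

open Classical in
lemma sum_monicPolys_dvd (X : K[X] →* ℂ) {ρ : K[X]} (hρ : ρ.Monic) {k : ℕ}
    (hk : ρ.natDegree ≤ k) :
    ∑ g ∈ monicPolys K k, (if ρ ∣ g then X g else 0) = X ρ * lCoeff X (k - ρ.natDegree) := by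
  rw [← Finset.sum_filter, lCoeff, Finset.mul_sum]
  symm
  refine Finset.sum_bij (fun g _ => ρ * g) ?_ ?_ ?_ ?_
  · intro g hg
    rw [mem_monicPolys] at hg
    rw [mem_filter, mem_monicPolys]
    refine ⟨⟨hρ.mul hg.1, ?_⟩, dvd_mul_right _ _⟩
    rw [hρ.natDegree_mul hg.1, hg.2]
    omega
  · intro a _ b _ hab
    exact mul_left_cancel₀ hρ.ne_zero hab
  · intro b hb
    rw [mem_filter, mem_monicPolys] at hb
    obtain ⟨⟨hb1, hb2⟩, g, rfl⟩ := hb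
    have hg := hρ.of_mul_monic_left hb1
    refine ⟨g, ?_, rfl⟩
    rw [mem_monicPolys]
    refine ⟨hg, ?_⟩
    rw [← hb2, hρ.natDegree_mul hg]
    omega
  · intro g _
    rw [map_mul]

/-- Newton's identity between the coefficients and the power sums of an `L`-function. -/
theorem lCoeff_newton (X : K[X] →* ℂ) (k : ℕ) :
    (k : ℂ) * lCoeff X k = ∑ j ∈ Icc 1 k, lPowerSum X j * lCoeff X (k - j) := by
  classical
  have hL : (k : ℂ) * lCoeff X k = ∑ d ∈ Icc 1 k, ∑ a ∈ Icc 1 k, ∑ π ∈ irreduciblePolys K d,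
      ∑ g ∈ monicPolys K k, (d : ℂ) * (if π ^ a ∣ g then X g else 0) := by
    rw [lCoeff, Finset.mul_sum]
    have : ∀ g ∈ monicPolys K k, (k : ℂ) * X g = ∑ d ∈ Icc 1 k, ∑ a ∈ Icc 1 k,
        ∑ π ∈ irreduciblePolys K d, (d : ℂ) * (if π ^ a ∣ g then X g else 0) := by
      intro g hg
      rw [mem_monicPolys] at hg
      have h := natDegree_eq_sum_irreduciblePolys hg.1
      rw [hg.2] at h
      conv_lhs => rw [h]
      push_cast
      simp_rw [Finset.sum_mul]
      refine Finset.sum_congr rfl fun d _ => Finset.sum_congr rfl fun a _ =>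
        Finset.sum_congr rfl fun π _ => ?_
      split_ifs <;> simp
    rw [Finset.sum_congr rfl this, Finset.sum_comm]
    refine Finset.sum_congr rfl fun d _ => ?_
    rw [Finset.sum_comm]
    refine Finset.sum_congr rfl fun a _ => ?_
    rw [Finset.sum_comm]
  have hR : ∑ j ∈ Icc 1 k, lPowerSum X j * lCoeff X (k - j)
      = ∑ x ∈ (Icc 1 k ×ˢ Icc 1 k).filter (fun x => x.1 * x.2 ≤ k),
        ∑ π ∈ irreduciblePolys K x.1, (x.1 : ℂ) * X π ^ x.2 * lCoeff X (k - x.1 * x.2) := by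
    have : ∀ j ∈ Icc 1 k, lPowerSum X j * lCoeff X (k - j)
        = ∑ x ∈ j.divisorsAntidiagonal, ∑ π ∈ irreduciblePolys K x.1,
          (x.1 : ℂ) * X π ^ x.2 * lCoeff X (k - x.1 * x.2) := by
      intro j _
      rw [lPowerSum, Finset.sum_mul]
      refine Finset.sum_congr rfl fun x hx => ?_
      rw [(Nat.mem_divisorsAntidiagonal.1 hx).1, Finset.sum_mul]
    rw [Finset.sum_congr rfl this, Finset.sum_sigma']
    refine Finset.sum_bij' (fun x _ => x.2) (fun x _ => ⟨x.1 * x.2, x⟩) ?_ ?_ ?_ ?_ ?_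
    · rintro ⟨j, d, a⟩ h
      simp only [mem_sigma, mem_Icc, Nat.mem_divisorsAntidiagonal] at h
      simp only [mem_filter, mem_product, mem_Icc]
      obtain ⟨⟨h1, h2⟩, rfl, h4⟩ := h
      have hd : 0 < d := Nat.pos_of_ne_zero (by rintro rfl; simp at h4)
      have ha : 0 < a := Nat.pos_of_ne_zero (by rintro rfl; simp at h4)
      refine ⟨⟨⟨hd, ?_⟩, ha, ?_⟩, h2⟩
      · exact (Nat.le_mul_of_pos_right d ha).trans h2
      · exact (Nat.le_mul_of_pos_left a hd).trans h2
    · rintro ⟨d, a⟩ h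
      simp only [mem_filter, mem_product, mem_Icc] at h
      simp only [mem_sigma, mem_Icc, Nat.mem_divisorsAntidiagonal]
      have : 0 < d * a := Nat.mul_pos h.1.1.1 h.1.2.1
      exact ⟨⟨this, h.2⟩, trivial, this.ne'⟩
    · rintro ⟨j, d, a⟩ h
      simp only [mem_sigma, Nat.mem_divisorsAntidiagonal] at h
      obtain ⟨_, rfl, _⟩ := h
      rfl
    · rintro ⟨d, a⟩ _
      rfl
    · rintro ⟨j, d, a⟩ _
      rfl
  rw [hL, hR, Finset.sum_filter, Finset.sum_product]
  refine Finset.sum_congr rfl fun d hd => Finset.sum_congr rfl fun a ha => ?_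
  split_ifs with h
  · refine Finset.sum_congr rfl fun π hπ => ?_
    rw [mem_irreduciblePolys] at hπ
    have hdeg : (π ^ a).natDegree = d * a := by rw [natDegree_pow, hπ.1.2, mul_comm]
    rw [← Finset.mul_sum, sum_monicPolys_dvd X (hπ.1.1.pow a) (hdeg.trans_le h), hdeg, map_pow]
    ring
  · refine Finset.sum_eq_zero fun π hπ => Finset.sum_eq_zero fun g hg => ?_
    rw [mem_irreduciblePolys] at hπ
    rw [mem_monicPolys] at hg
    rw [if_neg, mul_zero]
    intro hdvd
    have := natDegree_le_of_dvd hdvd hg.1.ne_zero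
    rw [natDegree_pow, hπ.1.2, hg.2, mul_comm] at this
    exact h this

end LFunction

section WeilNorm

open Polynomial Module IntermediateField

variable {K F : Type*} [Field K] [Field F] [Algebra K F]

lemma norm_eq_coeff_minpoly_pow [FiniteDimensional K F] (x : F) :
    Algebra.norm K x = ((-1) ^ (minpoly K x).natDegree * (minpoly K x).coeff 0)
      ^ (finrank K F / (minpoly K x).natDegree) := by
  have hx : IsIntegral K x := Algebra.IsIntegral.isIntegral x
  have h1 : finrank K K⟮x⟯ = (minpoly K x).natDegree := adjoin.finrank hx
  have h2 : finrank K F / (minpoly K x).natDegree = finrank K⟮x⟯ F := by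
    rw [← h1, ← finrank_mul_finrank K K⟮x⟯ F]
    exact Nat.mul_div_cancel_left _ finrank_pos
  rw [h2, Algebra.norm_eq_norm_adjoin, ← adjoin.powerBasis_gen hx,
    Algebra.PowerBasis.norm_gen_eq_coeff_zero_minpoly, adjoin.powerBasis_gen hx,
    minpoly_gen, adjoin.powerBasis_dim]

lemma norm_algebraMap_sub [FiniteDimensional K F] (x : F) (u : K) :
    Algebra.norm K (algebraMap K F u - x)
      = (minpoly K x).eval u ^ (finrank K F / (minpoly K x).natDegree) := by
  have hx : IsIntegral K x := Algebra.IsIntegral.isIntegral x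
  have hm := minpoly.sub_algebraMap x u
  have hdeg : (minpoly K (x - algebraMap K F u)).natDegree = (minpoly K x).natDegree := by
    rw [hm, natDegree_comp, natDegree_X_add_C, mul_one]
  have hcoeff : (minpoly K (x - algebraMap K F u)).coeff 0 = (minpoly K x).eval u := by
    rw [hm, coeff_zero_eq_eval_zero, eval_comp]
    simp
  have hdvd : (minpoly K x).natDegree ∣ finrank K F := minpoly.degree_dvd hx
  have h1 : algebraMap K F u - x = algebraMap K F (-1) * (x - algebraMap K F u) := by
    simp
  rw [h1, map_mul, Algebra.norm_algebraMap, norm_eq_coeff_minpoly_pow (x - algebraMap K F u),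
    hdeg, hcoeff, mul_pow, ← mul_assoc, ← pow_mul, Nat.mul_div_cancel' hdvd, ← mul_pow]
  simp

lemma card_filter_minpoly_eq [Fintype F] [DecidableEq K[X]] {π : K[X]} (hπ : Irreducible π)
    (hm : π.Monic) (hd : π.natDegree ∣ finrank K F) :
    (univ.filter fun x : F => minpoly K x = π).card = π.natDegree := by
  have : Fact (Irreducible π) := ⟨hπ⟩
  have h1 : finrank K (AdjoinRoot π) = π.natDegree := by
    rw [(AdjoinRoot.powerBasis hπ.ne_zero).finrank, AdjoinRoot.powerBasis_dim]
  have h2 : Nat.card (AdjoinRoot π →ₐ[K] F) = π.natDegree := by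
    rw [← h1] at hd ⊢
    exact FiniteField.natCard_algHom_of_finrank_dvd hd
  rw [← h2, Nat.card_congr (AdjoinRoot.equiv F K π hπ.ne_zero), ← Fintype.card_subtype,
    Fintype.card_eq_nat_card]
  refine Nat.card_congr (Equiv.subtypeEquivRight fun x => ?_)
  rw [mem_aroots]
  constructor
  · rintro rfl
    exact ⟨hπ.ne_zero, minpoly.aeval K x⟩
  · rintro ⟨_, h⟩
    exact (minpoly.eq_of_irreducible_of_monic hπ h hm).symm

/-- The completely multiplicative function on polynomials attached to a product of characters
at points of the ground field. -/
noncomputable def evalChar {ι : Type*} [Fintype ι] (χ : MulChar K ℂ) (u : ι → K) (e : ι → ℕ) :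
    K[X] →* ℂ where
  toFun g := ∏ i, χ (g.eval (u i)) ^ e i
  map_one' := by simp
  map_mul' f g := by simp [mul_pow, Finset.prod_mul_distrib]

lemma evalChar_apply {ι : Type*} [Fintype ι] (χ : MulChar K ℂ) (u : ι → K) (e : ι → ℕ)
    (g : K[X]) : evalChar χ u e g = ∏ i, χ (g.eval (u i)) ^ e i := rfl

end WeilNorm

section WeilPowerSum

open Polynomial Module

variable {K F : Type*} [Field K] [Fintype K] [Field F] [Fintype F] [Algebra K F]

lemma lPowerSum_eq_sum_minpoly (X : K[X] →* ℂ) :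
    lPowerSum X (finrank K F)
      = ∑ x : F, X (minpoly K x) ^ (finrank K F / (minpoly K x).natDegree) := by
  classical
  have hpos : 0 < finrank K F := finrank_pos
  rw [lPowerSum, Finset.sum_sigma']
  rw [← Finset.sum_fiberwise_of_maps_to (s := univ)
    (t := (finrank K F).divisorsAntidiagonal.sigma fun x => irreduciblePolys K x.1)
    (g := fun x : F => ⟨((minpoly K x).natDegree, finrank K F / (minpoly K x).natDegree),
      minpoly K x⟩)]
  · refine Finset.sum_congr rfl ?_
    rintro ⟨⟨d, a⟩, π⟩ h
    simp only [mem_sigma, Nat.mem_divisorsAntidiagonal, mem_irreduciblePolys] at h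
    obtain ⟨⟨h1, h2⟩, ⟨h3, rfl⟩, h5⟩ := h
    have hd : 0 < π.natDegree := h5.natDegree_pos
    have ha : finrank K F / π.natDegree = a := by
      rw [← h1]; exact Nat.mul_div_cancel_left _ hd
    have hfib : (univ.filter fun x : F => (⟨((minpoly K x).natDegree,
        finrank K F / (minpoly K x).natDegree), minpoly K x⟩ : Σ _ : ℕ × ℕ, K[X])
          = ⟨(π.natDegree, a), π⟩) = univ.filter fun x : F => minpoly K x = π := by
      ext x
      simp only [mem_filter, mem_univ, true_and]
      constructor
      · intro h
        exact eq_of_heq (Sigma.mk.inj h).2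
      · intro h
        rw [h, ha]
    rw [hfib]
    rw [Finset.sum_congr rfl (g := fun _ => X π ^ a), Finset.sum_const,
      card_filter_minpoly_eq h5 h3 ⟨a, h1.symm⟩, nsmul_eq_mul]
    intro x hx
    rw [(mem_filter.1 hx).2, ha]
  · intro x _
    have hx : IsIntegral K x := Algebra.IsIntegral.isIntegral x
    simp only [mem_sigma, Nat.mem_divisorsAntidiagonal, mem_irreduciblePolys]
    exact ⟨⟨Nat.mul_div_cancel' (minpoly.degree_dvd hx), hpos.ne'⟩, ⟨minpoly.monic hx, trivial⟩,
      minpoly.irreducible hx⟩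

lemma lPowerSum_evalChar {ι : Type*} [Fintype ι] (χ : MulChar K ℂ) (u : ι → K) (e : ι → ℕ) :
    lPowerSum (evalChar χ u e) (finrank K F)
      = ∑ x : F, χ (Algebra.norm K (∏ i, (algebraMap K F (u i) - x) ^ e i)) := by
  rw [lPowerSum_eq_sum_minpoly (F := F)]
  refine Finset.sum_congr rfl fun x _ => ?_
  rw [evalChar_apply, map_prod, map_prod, ← Finset.prod_pow]
  refine Finset.prod_congr rfl fun i _ => ?_
  rw [map_pow, norm_algebraMap_sub, map_pow, map_pow]
  ring

lemma lCoeff_zero (X : K[X] →* ℂ) : lCoeff X 0 = 1 := by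
  have : monicPolys K 0 = {1} := by
    ext g
    rw [mem_monicPolys, mem_singleton]
    constructor
    · rintro ⟨h1, h2⟩
      exact h1.natDegree_eq_zero.1 h2
    · rintro rfl
      exact ⟨monic_one, natDegree_one⟩
  rw [lCoeff, this, sum_singleton, map_one]

lemma lCoeff_evalChar_eq_zero {ι : Type*} [Fintype ι] [DecidableEq ι] {χ : MulChar K ℂ}
    (hχ : χ ≠ 1) {u : ι → K} {e : ι → ℕ} {i₀ : ι} (he : e i₀ = 1) (hu : ∀ i ≠ i₀, u i ≠ u i₀)
    {k : ℕ} (hk : Fintype.card ι ≤ k) : lCoeff (evalChar χ u e) k = 0 := by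
  classical
  set h : K[X] := ∏ i ∈ univ.erase i₀, (X - C (u i)) with hh
  have hdeg : h.natDegree < k := by
    rw [hh, natDegree_prod_of_monic _ _ fun i _ => monic_X_sub_C _]
    simp only [natDegree_X_sub_C, sum_const, smul_eq_mul, mul_one]
    rw [card_erase_of_mem (mem_univ _), card_univ]
    have : 0 < Fintype.card ι := Fintype.card_pos_iff.2 ⟨i₀⟩
    omega
  have h0 : h.eval (u i₀) ≠ 0 := by
    rw [hh, eval_prod, prod_ne_zero_iff]
    intro i hi
    simpa [sub_eq_zero] using (hu i (ne_of_mem_erase hi)).symm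
  have h1 : ∀ i ≠ i₀, h.eval (u i) = 0 := by
    intro i hi
    rw [hh, eval_prod]
    exact prod_eq_zero (mem_erase.2 ⟨hi, mem_univ _⟩) (by simp)
  have hlt : ∀ (g : K[X]), g.natDegree = k → ∀ a : K, (C a * h).degree < g.degree := by
    intro g hg a
    have hg0 : g ≠ 0 := by
      rintro rfl
      simp at hg
      omega
    rw [degree_eq_natDegree hg0, hg]
    refine degree_le_natDegree.trans_lt ?_
    exact_mod_cast (natDegree_C_mul_le a h).trans_lt hdeg
  have hshift : ∀ a : K, lCoeff (evalChar χ u e) k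
      = ∑ g ∈ monicPolys K k, evalChar χ u e (g + C a * h) := by
    intro a
    have hmem : ∀ (a : K), ∀ g ∈ monicPolys K k, g + C a * h ∈ monicPolys K k := by
      intro a g hg
      rw [mem_monicPolys] at hg ⊢
      have := hlt g hg.2 a
      refine ⟨hg.1.add_of_left this, ?_⟩
      rw [natDegree_add_eq_left_of_degree_lt this, hg.2]
    rw [lCoeff]
    refine Finset.sum_bij' (fun g _ => g + C (-a) * h) (fun g _ => g + C a * h)
      (hmem (-a)) (hmem a) ?_ ?_ ?_
    · intro g _
      simp
    · intro g _
      simp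
    · intro g _
      simp
  have hsum : (Fintype.card K : ℂ) * lCoeff (evalChar χ u e) k = 0 := by
    have : (Fintype.card K : ℂ) * lCoeff (evalChar χ u e) k
        = ∑ a : K, lCoeff (evalChar χ u e) k := by simp
    rw [this, Finset.sum_congr rfl fun a _ => hshift a, Finset.sum_comm]
    refine Finset.sum_eq_zero fun g _ => ?_
    have hev : ∀ a : K, evalChar χ u e (g + C a * h)
        = χ (g.eval (u i₀) + a * h.eval (u i₀))
          * ∏ i ∈ univ.erase i₀, χ (g.eval (u i)) ^ e i := by
      intro a
      rw [evalChar_apply, ← Finset.mul_prod_erase _ _ (mem_univ i₀), he]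
      congr 1
      · simp
      · refine Finset.prod_congr rfl fun i hi => ?_
        simp [h1 i (ne_of_mem_erase hi)]
    rw [Finset.sum_congr rfl fun a _ => hev a, ← Finset.sum_mul]
    have hbij : Function.Bijective fun a : K => g.eval (u i₀) + a * h.eval (u i₀) := by
      refine Finite.injective_iff_bijective.1 fun a b hab => ?_
      exact mul_right_cancel₀ h0 (add_left_cancel hab)
    rw [Function.Bijective.sum_comp hbij (fun y => χ y), MulChar.sum_eq_zero_of_ne_one hχ, zero_mul]
  have hK : (Fintype.card K : ℂ) ≠ 0 := by exact_mod_cast Fintype.card_ne_zero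
  exact (mul_eq_zero.1 hsum).resolve_left hK

end WeilPowerSum

section InverseRoots

/-- A sequence with finite support starting with `1` consists of the signed elementary symmetric
functions of finitely many complex numbers. -/
lemma exists_eq_esymm {c : ℕ → ℂ} (hc0 : c 0 = 1) {n : ℕ} (hcn : ∀ k, n < k → c k = 0) :
    ∃ ω : Fin n → ℂ, ∀ k, c k = (-1) ^ k * (Multiset.map ω univ.val).esymm k := by
  classical
  set Q : Polynomial ℂ := ∑ k ∈ range (n + 1), Polynomial.C (c k) * Polynomial.X ^ (n - k) with hQ
  have hcoeff : ∀ k, k ≤ n → Q.coeff (n - k) = c k := by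
    intro k hk
    rw [hQ, Polynomial.finsetSum_coeff, Finset.sum_eq_single k]
    · simp
    · intro j hj hjk
      rw [mem_range] at hj
      rw [Polynomial.coeff_C_mul_X_pow, if_neg]
      omega
    · intro hk'
      rw [mem_range] at hk'
      omega
  have hdeg : Q.natDegree = n := by
    refine le_antisymm ?_ (Polynomial.le_natDegree_of_ne_zero ?_)
    · refine Polynomial.natDegree_sum_le_of_forall_le _ _ fun k _ => ?_
      exact (Polynomial.natDegree_C_mul_X_pow_le _ _).trans (Nat.sub_le _ _)
    · have := hcoeff 0 (Nat.zero_le _)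
      rw [Nat.sub_zero, hc0] at this
      rw [this]
      exact one_ne_zero
  have hlead : Q.leadingCoeff = 1 := by
    rw [Polynomial.leadingCoeff, hdeg]
    simpa [hc0] using hcoeff 0 (Nat.zero_le _)
  have hcard : Q.roots.card = Q.natDegree := IsAlgClosed.card_roots_eq_natDegree
  have hω : ∀ (s : Multiset ℂ) (m : ℕ), s.card = m → ∃ ω : Fin m → ℂ,
      Multiset.map ω univ.val = s := by
    rintro s m rfl
    rw [← Multiset.length_toList]
    refine ⟨s.toList.get, ?_⟩
    rw [Fin.univ_val_map, List.ofFn_get, Multiset.coe_toList]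
  obtain ⟨ω, hω⟩ := hω Q.roots n (hcard.trans hdeg)
  refine ⟨ω, fun k => ?_⟩
  rw [hω]
  rcases le_or_gt k n with hk | hk
  · rw [← hcoeff k hk, Polynomial.coeff_eq_esymm_roots_of_card hcard (by omega), hlead, hdeg,
      Nat.sub_sub_self hk, one_mul]
  · rw [hcn k hk, Multiset.esymm, Multiset.powersetCard_eq_empty _ (by omega)]
    simp

/-- Newton's identities determine the power sums. -/
lemma eq_neg_sum_pow {c S : ℕ → ℂ} (hc0 : c 0 = 1)
    (hN : ∀ k : ℕ, (k : ℂ) * c k = ∑ j ∈ Icc 1 k, S j * c (k - j)) {n : ℕ} {ω : Fin n → ℂ}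
    (hω : ∀ k, c k = (-1) ^ k * (Multiset.map ω univ.val).esymm k) {k : ℕ} (hk : 1 ≤ k) :
    S k = - ∑ i, ω i ^ k := by
  have hnewton : ∀ k : ℕ, (k : ℂ) * c k = ∑ j ∈ Icc 1 k, (- ∑ i, ω i ^ j) * c (k - j) := by
    intro k
    have h := congrArg (MvPolynomial.aeval ω) (MvPolynomial.mul_esymm_eq_sum (Fin n) ℂ k)
    rw [map_mul, map_mul, map_sum, MvPolynomial.aeval_esymm_eq_multiset_esymm] at h
    simp only [map_mul, map_natCast, map_pow, map_neg, map_one, MvPolynomial.psum, map_sum,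
      MvPolynomial.aeval_X, MvPolynomial.aeval_esymm_eq_multiset_esymm] at h
    simp_rw [← hω] at h
    rw [hω k, mul_left_comm, h, ← mul_assoc, ← pow_add]
    rw [show (-1 : ℂ) ^ (k + (k + 1)) = -1 by
      rw [← add_assoc, pow_succ, ← two_mul, pow_mul]; simp]
    rw [neg_one_mul, ← Finset.sum_neg_distrib]
    refine Finset.sum_bij' (fun a _ => a.2) (fun j _ => (k - j, j)) ?_ ?_ ?_ ?_ ?_
    · rintro ⟨a, b⟩ h
      simp only [mem_filter, HasAntidiagonal.mem_antidiagonal] at h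
      simp only [mem_Icc]
      omega
    · intro j h
      simp only [mem_Icc] at h
      simp only [mem_filter, HasAntidiagonal.mem_antidiagonal]
      omega
    · rintro ⟨a, b⟩ h
      simp only [mem_filter, HasAntidiagonal.mem_antidiagonal] at h
      simp only [Prod.mk.injEq, and_true]
      omega
    · intro j _
      rfl
    · rintro ⟨a, b⟩ h
      simp only [mem_filter, HasAntidiagonal.mem_antidiagonal] at h
      have : k - b = a := by omega
      simp only [this]
      ring
  induction k using Nat.strong_induction_on with
  | _ k ih =>
    obtain ⟨l, rfl⟩ : ∃ l, k = l + 1 := ⟨k - 1, by omega⟩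
    have h := (hN (l + 1)).symm.trans (hnewton (l + 1))
    rw [Finset.sum_Icc_succ_top (by omega), Finset.sum_Icc_succ_top (by omega)] at h
    rw [Nat.sub_self, hc0, mul_one, mul_one] at h
    rw [Finset.sum_congr rfl (g := fun j => (- ∑ i, ω i ^ j) * c (l + 1 - j))] at h
    · exact add_left_cancel h
    · intro j hj
      rw [mem_Icc] at hj
      rw [ih j (by omega) hj.1]

/-- Frequencies of an exponential sum of controlled growth are controlled. -/
lemma norm_le_of_norm_sum_pow_le {n : ℕ} {v : Fin n → ℂ} {C q : ℝ} (hq : 0 < q) {h₀ : ℕ}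
    (hb : ∀ h, h₀ ≤ h → ‖∑ i, v i ^ h‖ ≤ C * q ^ h) (i₀ : Fin n) : ‖v i₀‖ ≤ q := by
  classical
  set P : Polynomial ℂ := ∏ w ∈ (univ.image v).erase (v i₀), (Polynomial.X - Polynomial.C w) with hP
  have hP0 : P.eval (v i₀) ≠ 0 := by
    rw [hP, Polynomial.eval_prod, prod_ne_zero_iff]
    intro w hw
    simpa [sub_eq_zero] using (ne_of_mem_erase hw).symm
  have hP1 : ∀ i, v i ≠ v i₀ → P.eval (v i) = 0 := by
    intro i hi
    rw [hP, Polynomial.eval_prod]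
    exact prod_eq_zero (mem_erase.2 ⟨hi, mem_image_of_mem _ (mem_univ _)⟩) (by simp)
  set N : ℕ := (univ.filter fun i => v i = v i₀).card with hN
  have hNpos : 0 < N := card_pos.2 ⟨i₀, by simp⟩
  have hkey : ∀ h, ∑ k ∈ range (P.natDegree + 1), P.coeff k * ∑ i, v i ^ (h + k)
      = N * (P.eval (v i₀) * v i₀ ^ h) := by
    intro h
    simp_rw [Finset.mul_sum]
    rw [Finset.sum_comm]
    have : ∀ i ∈ univ, ∑ k ∈ range (P.natDegree + 1), P.coeff k * v i ^ (h + k)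
        = if v i = v i₀ then P.eval (v i₀) * v i₀ ^ h else 0 := by
      intro i _
      have h1 : ∑ k ∈ range (P.natDegree + 1), P.coeff k * v i ^ (h + k)
          = P.eval (v i) * v i ^ h := by
        rw [Polynomial.eval_eq_sum_range, Finset.sum_mul]
        refine Finset.sum_congr rfl fun k _ => ?_
        ring
      rw [h1]
      split_ifs with hi
      · rw [hi]
      · rw [hP1 i hi, zero_mul]
    rw [Finset.sum_congr rfl this, ← Finset.sum_filter, Finset.sum_const, nsmul_eq_mul]
  set D : ℝ := ∑ k ∈ range (P.natDegree + 1), ‖P.coeff k‖ * (C * q ^ k) with hD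
  have hgrow : ∀ h, h₀ ≤ h → (N * ‖P.eval (v i₀)‖) * ‖v i₀‖ ^ h ≤ D * q ^ h := by
    intro h hh
    have h1 := congrArg norm (hkey h)
    rw [norm_mul, norm_mul, norm_pow, Complex.norm_natCast, ← mul_assoc] at h1
    rw [← h1, hD, Finset.sum_mul]
    refine (norm_sum_le _ _).trans (Finset.sum_le_sum fun k _ => ?_)
    rw [norm_mul, mul_assoc]
    refine mul_le_mul_of_nonneg_left ?_ (norm_nonneg _)
    refine (hb (h + k) (by omega)).trans_eq ?_
    ring
  by_contra! hlt
  have hr : 1 < ‖v i₀‖ / q := by rwa [one_lt_div hq]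
  have hpos : 0 < N * ‖P.eval (v i₀)‖ := by
    have := norm_pos_iff.2 hP0
    positivity
  obtain ⟨h, hh1, hh2⟩ := (((tendsto_pow_atTop_atTop_of_one_lt hr).eventually_gt_atTop
    (D / (N * ‖P.eval (v i₀)‖))).and (Filter.eventually_ge_atTop h₀)).exists
  rw [div_pow, div_lt_div_iff₀ hpos (by positivity)] at hh1
  have := hgrow h hh2
  linarith

/-- The first power sum attached to a polynomial `L`-function is controlled by the growth of the
even power sums. -/
theorem norm_powerSum_one_le {c S : ℕ → ℂ} (hc0 : c 0 = 1)
    (hN : ∀ k : ℕ, (k : ℂ) * c k = ∑ j ∈ Icc 1 k, S j * c (k - j)) {n : ℕ}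
    (hcn : ∀ k, n < k → c k = 0) {C q : ℝ} (hq : 0 < q) {h₀ : ℕ}
    (hb : ∀ h, h₀ ≤ h → ‖S (2 * h)‖ ≤ C * q ^ (2 * h)) : ‖S 1‖ ≤ n * q := by
  obtain ⟨ω, hω⟩ := exists_eq_esymm hc0 hcn
  have hroot : ∀ i, ‖ω i‖ ≤ q := by
    intro i
    have := norm_le_of_norm_sum_pow_le (v := fun i => ω i ^ 2) (C := C) (q := q ^ 2) (by positivity)
      (h₀ := h₀ + 1) (fun h hh => ?_) i
    · rw [norm_pow] at this
      exact (pow_le_pow_iff_left₀ (norm_nonneg _) hq.le two_ne_zero).1 this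
    · have h1 := hb h (by omega)
      rw [eq_neg_sum_pow hc0 hN hω (by omega), norm_neg] at h1
      simpa only [pow_mul] using h1
  rw [eq_neg_sum_pow hc0 hN hω le_rfl, norm_neg]
  refine (norm_sum_le _ _).trans ?_
  refine (Finset.sum_le_sum (g := fun _ => q) fun i _ => by simpa using hroot i).trans_eq ?_
  simp

end InverseRoots

section WeilBound

open Polynomial Module

variable {p : ℕ} [Fact p.Prime]

/-- Sums of norms of products of linear factors over large extensions of even degree. -/
lemma norm_lPowerSum_evalChar_le {ι : Type*} [Fintype ι] [DecidableEq ι]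
    {χ : MulChar (ZMod p) ℂ} (hχ : χ ≠ 1) {u : ι → ZMod p} {e : ι → ℕ} {i₀ : ι} (he : e i₀ = 1)
    (hu : ∀ i ≠ i₀, u i ≠ u i₀) {h : ℕ} (hh : (p - 1) * (∑ i, e i) + 3 ≤ h) :
    ‖lPowerSum (evalChar χ u e) (2 * h)‖
      ≤ ((p - 1 : ℕ) * (2 * (∑ i, e i) + 4) : ℕ) * Real.sqrt p ^ (2 * h) := by
  have hp : p.Prime := Fact.out
  have hh0 : 2 * h ≠ 0 := by omega
  have hfr : finrank (ZMod p) (GaloisField p (2 * h)) = 2 * h := GaloisField.finrank p hh0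
  have : Fintype (GaloisField p (2 * h)) := Fintype.ofFinite _
  set F := GaloisField p (2 * h)
  set f₁ : F[X] := - ∏ i ∈ univ.erase i₀, (C (algebraMap (ZMod p) F (u i)) - X) ^ e i with hf₁
  have hfac : (X - C (algebraMap (ZMod p) F (u i₀))) * f₁
      = ∏ i, (C (algebraMap (ZMod p) F (u i)) - X) ^ e i := by
    rw [← Finset.mul_prod_erase univ (fun i => (C (algebraMap (ZMod p) F (u i)) - X) ^ e i)
      (mem_univ i₀), he, hf₁]
    ring
  have h1 : f₁.eval (algebraMap (ZMod p) F (u i₀)) ≠ 0 := by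
    rw [hf₁, eval_neg, neg_ne_zero, eval_prod, prod_ne_zero_iff]
    intro i hi
    rw [eval_pow, eval_sub, eval_C, eval_X]
    refine pow_ne_zero _ (sub_ne_zero.2 fun h => hu i (ne_of_mem_erase hi) ?_)
    exact (algebraMap (ZMod p) F).injective h
  have h2 : ((X - C (algebraMap (ZMod p) F (u i₀))) * f₁).natDegree ≤ ∑ i, e i := by
    rw [hfac]
    refine (natDegree_prod_le _ _).trans (Finset.sum_le_sum fun i _ => ?_)
    refine natDegree_pow_le.trans ?_
    refine (Nat.mul_le_mul_left _ (?_ : _ ≤ 1)).trans_eq (mul_one _)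
    exact (natDegree_sub_le _ _).trans (by simp)
  have h3 : 1 ≤ ∑ i, e i :=
    he.symm.le.trans (Finset.single_le_sum (fun i _ => Nat.zero_le (e i)) (mem_univ i₀))
  have h4 : (p - 1) * (∑ i, e i) + 3 ≤ p ^ h :=
    hh.trans (Nat.lt_pow_self hp.one_lt).le
  have h5 := norm_sum_char_norm_eval_le hχ (F := F) hfr h1 h2 h3 h4
  have h6 := lPowerSum_evalChar (F := F) χ u e
  rw [hfr] at h6
  rw [h6, pow_mul, Real.sq_sqrt (Nat.cast_nonneg p)]
  refine (Eq.le ?_).trans h5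
  congr 1
  refine Finset.sum_congr rfl fun x _ => ?_
  rw [hfac, eval_prod]
  simp

/-- **Weil's bound** for multiplicative character sums of products of linear factors. -/
theorem norm_sum_mulChar_prod_le {ι : Type*} [Fintype ι] [DecidableEq ι]
    {χ : MulChar (ZMod p) ℂ} (hχ : χ ≠ 1) {u : ι → ZMod p} {e : ι → ℕ} {i₀ : ι} (he : e i₀ = 1)
    (hu : ∀ i ≠ i₀, u i ≠ u i₀) :
    ‖∑ x : ZMod p, ∏ i, χ (u i - x) ^ e i‖ ≤ Fintype.card ι * Real.sqrt p := by
  have hp : p.Prime := Fact.out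
  have hpos : 0 < Fintype.card ι := Fintype.card_pos_iff.2 ⟨i₀⟩
  have h := norm_powerSum_one_le (lCoeff_zero (evalChar χ u e)) (lCoeff_newton (evalChar χ u e))
    (n := Fintype.card ι - 1)
    (fun k hk => lCoeff_evalChar_eq_zero hχ he hu (by omega))
    (Real.sqrt_pos.2 (by exact_mod_cast hp.pos : (0 : ℝ) < p))
    (fun h hh => norm_lPowerSum_evalChar_le hχ he hu hh)
  have h1 := lPowerSum_evalChar (F := ZMod p) χ u e
  rw [finrank_self] at h1
  rw [h1] at h
  have h2 : ∑ x : ZMod p, ∏ i, χ (u i - x) ^ e i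
      = ∑ x : ZMod p, χ (Algebra.norm (ZMod p) (∏ i, (algebraMap (ZMod p) (ZMod p) (u i) - x) ^ e i)) := by
    refine Finset.sum_congr rfl fun x _ => ?_
    rw [Algebra.norm_self]
    simp
  rw [h2]
  refine h.trans ?_
  gcongr
  omega

end WeilBound

section Moment

/-- Few tuples have no value that is attained exactly once. -/
lemma card_filter_repeated_le {ι κ : Type*} [Fintype ι] [DecidableEq ι] [Fintype κ] [DecidableEq κ]
    {r : ℕ} (hr : 0 < r) (hι : Fintype.card ι = 2 * r) :
    (univ.filter fun τ : ι → κ => ∀ i, ∃ j, j ≠ i ∧ τ j = τ i).card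
      ≤ r ^ (2 * r) * Fintype.card κ ^ r := by
  have hsub : (univ.filter fun τ : ι → κ => ∀ i, ∃ j, j ≠ i ∧ τ j = τ i)
      ⊆ (univ : Finset ((ι → Fin r) × (Fin r → κ))).image (fun x => x.2 ∘ x.1) := by
    intro τ hτ
    rw [mem_filter] at hτ
    rw [mem_image]
    have hcard : (univ.image τ).card ≤ r := by
      have h := mul_card_image_le_card (f := τ) univ 2 fun b hb => by
        obtain ⟨i, _, rfl⟩ := mem_image.1 hb
        obtain ⟨j, hji, hj⟩ := hτ.2 i
        exact one_lt_card.2 ⟨j, by simp [hj], i, by simp, hji⟩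
      rw [card_univ, hι] at h
      omega
    obtain ⟨i₀⟩ : Nonempty ι := Fintype.card_pos_iff.1 (by omega)
    obtain ⟨g⟩ : Nonempty ({ x // x ∈ univ.image τ } ↪ Fin r) :=
      Function.Embedding.nonempty_of_card_le
        (by rwa [Fintype.card_coe, Fintype.card_fin])
    refine ⟨(fun i => g ⟨τ i, mem_image_of_mem _ (mem_univ _)⟩,
      Function.extend g Subtype.val fun _ => τ i₀), mem_univ _, ?_⟩
    funext i
    exact g.injective.extend_apply Subtype.val (fun _ => τ i₀) ⟨τ i, mem_image_of_mem _ (mem_univ _)⟩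
  refine (card_le_card hsub).trans (card_image_le.trans_eq ?_)
  rw [card_univ, Fintype.card_prod, Fintype.card_fun, Fintype.card_fun, Fintype.card_fin, hι]

variable {p : ℕ} [Fact p.Prime]

/-- Weil's bound for products of values of a character and of its inverse. -/
lemma norm_sum_prod_mulChar_le {ι : Type*} [Fintype ι] [DecidableEq ι] {χ : MulChar (ZMod p) ℂ}
    (hχ : χ ≠ 1) {ψ : ι → MulChar (ZMod p) ℂ} (hψ : ∀ i, ψ i = χ ∨ ψ i = χ⁻¹)
    {u : ι → ZMod p} {i₀ : ι} (hu : ∀ i ≠ i₀, u i ≠ u i₀) :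
    ‖∑ y : ZMod p, ∏ i, ψ i (y + u i)‖ ≤ Fintype.card ι * Real.sqrt p := by
  have h0 : ψ i₀ ≠ 1 := by
    rcases hψ i₀ with h | h
    · rwa [h]
    · rwa [h, ne_eq, inv_eq_one]
  set N := 2 * Fintype.card (ZMod p)ˣ - 1 with hN
  have hpos : 0 < Fintype.card (ZMod p)ˣ := Fintype.card_pos
  have hinv : ∀ θ : MulChar (ZMod p) ℂ, θ⁻¹ = θ ^ N := by
    intro θ
    rw [inv_eq_iff_mul_eq_one, ← pow_succ', hN, Nat.sub_add_cancel (by omega), mul_comm, pow_mul,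
      θ.pow_card_eq_one, one_pow]
  have hexp : ∀ i, ∃ e : ℕ, e ≠ 0 ∧ (i = i₀ → e = 1) ∧ ψ i = ψ i₀ ^ e := by
    intro i
    by_cases hi : i = i₀
    · exact ⟨1, one_ne_zero, fun _ => rfl, by rw [hi, pow_one]⟩
    by_cases heq : ψ i = ψ i₀
    · exact ⟨1, one_ne_zero, fun _ => rfl, by rw [heq, pow_one]⟩
    · refine ⟨N, by omega, fun h => absurd h hi, ?_⟩
      rw [← hinv]
      rcases hψ i with h | h <;> rcases hψ i₀ with h' | h'
      · exact absurd (h.trans h'.symm) heq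
      · rw [h, h', inv_inv]
      · rw [h, h']
      · exact absurd (h.trans h'.symm) heq
  choose e he0 he1 he2 using hexp
  have h := norm_sum_mulChar_prod_le h0 (u := u) (he1 i₀ rfl) hu
  rw [← Equiv.sum_comp (Equiv.neg (ZMod p))]
  refine (Eq.le ?_).trans h
  congr 1
  refine Finset.sum_congr rfl fun x _ => Finset.prod_congr rfl fun i _ => ?_
  rw [he2 i, MulChar.pow_apply' _ (he0 i), Equiv.neg_apply, neg_add_eq_sub]

/-- The even moments of short character sums. -/
theorem sum_norm_sum_mulChar_pow_le {κ : Type*} [Fintype κ] {χ : MulChar (ZMod p) ℂ} (hχ : χ ≠ 1)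
    {s : κ → ZMod p} (hs : Function.Injective s) {r : ℕ} (hr : 0 < r) :
    ∑ y : ZMod p, ‖∑ t, χ (y + s t)‖ ^ (2 * r)
      ≤ (r : ℝ) ^ (2 * r) * (Fintype.card κ : ℝ) ^ r * p
        + (Fintype.card κ : ℝ) ^ (2 * r) * (2 * r * Real.sqrt p) := by
  classical
  set ψ : Fin r ⊕ Fin r → MulChar (ZMod p) ℂ := Sum.elim (fun _ => χ) fun _ => χ⁻¹ with hψ
  have hψ' : ∀ i, ψ i = χ ∨ ψ i = χ⁻¹ := by
    rintro (i | i)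
    · exact Or.inl rfl
    · exact Or.inr rfl
  have hι : Fintype.card (Fin r ⊕ Fin r) = 2 * r := by simp [two_mul]
  have hexpand : ((∑ y : ZMod p, ‖∑ t, χ (y + s t)‖ ^ (2 * r) : ℝ) : ℂ)
      = ∑ τ : Fin r ⊕ Fin r → κ, ∑ y : ZMod p, ∏ i, ψ i (y + s (τ i)) := by
    rw [Finset.sum_comm]
    push_cast
    refine Finset.sum_congr rfl fun y _ => ?_
    rw [← Fintype.prod_sum (fun i t => ψ i (y + s t)), Fintype.prod_sum_type, pow_mul,
      ← Complex.mul_conj', mul_pow]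
    simp only [hψ, Sum.elim_inl, Sum.elim_inr, prod_const, card_univ, Fintype.card_fin]
    congr 2
    rw [map_sum]
    refine Finset.sum_congr rfl fun t _ => ?_
    exact MulChar.star_apply' χ _
  have hnn : 0 ≤ ∑ y : ZMod p, ‖∑ t, χ (y + s t)‖ ^ (2 * r) := by positivity
  have hnorm : ∑ y : ZMod p, ‖∑ t, χ (y + s t)‖ ^ (2 * r)
      ≤ ∑ τ : Fin r ⊕ Fin r → κ, ‖∑ y : ZMod p, ∏ i, ψ i (y + s (τ i))‖ := by
    have h := norm_sum_le univ fun τ : Fin r ⊕ Fin r → κ => ∑ y : ZMod p, ∏ i, ψ i (y + s (τ i))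
    rwa [← hexpand, Complex.norm_real, Real.norm_of_nonneg hnn] at h
  refine hnorm.trans ?_
  rw [← Finset.sum_filter_add_sum_filter_not univ
    (fun τ : Fin r ⊕ Fin r → κ => ∀ i, ∃ j, j ≠ i ∧ τ j = τ i)]
  refine add_le_add ?_ ?_
  · have htriv : ∀ τ : Fin r ⊕ Fin r → κ, ‖∑ y : ZMod p, ∏ i, ψ i (y + s (τ i))‖ ≤ p := by
      intro τ
      refine (norm_sum_le _ _).trans ?_
      refine (Finset.sum_le_sum (g := fun _ => (1 : ℝ)) fun y _ => ?_).trans_eq (by simp [ZMod.card])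
      rw [norm_prod]
      exact Finset.prod_le_one (fun _ _ => norm_nonneg _)
        fun i _ => DirichletCharacter.norm_le_one (ψ i) _
    refine (Finset.sum_le_card_nsmul _ _ _ fun τ _ => htriv τ).trans ?_
    rw [nsmul_eq_mul]
    have := card_filter_repeated_le (κ := κ) hr hι
    refine mul_le_mul_of_nonneg_right ?_ (Nat.cast_nonneg _)
    exact_mod_cast this
  · have hweil : ∀ τ ∈ univ.filter (fun τ : Fin r ⊕ Fin r → κ =>
        ¬ ∀ i, ∃ j, j ≠ i ∧ τ j = τ i),
        ‖∑ y : ZMod p, ∏ i, ψ i (y + s (τ i))‖ ≤ 2 * r * Real.sqrt p := by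
      intro τ hτ
      rw [mem_filter] at hτ
      obtain ⟨i₀, hi₀⟩ := not_forall.1 hτ.2
      push Not at hi₀
      have := norm_sum_prod_mulChar_le hχ hψ' (u := fun i => s (τ i)) (i₀ := i₀)
        fun i hi h => hi₀ i hi (hs h)
      rwa [hι, Nat.cast_mul, Nat.cast_ofNat] at this
    refine (Finset.sum_le_card_nsmul _ _ _ hweil).trans ?_
    rw [nsmul_eq_mul]
    refine mul_le_mul_of_nonneg_right ?_ (by positivity)
    have : (univ.filter (fun τ : Fin r ⊕ Fin r → κ => ¬ ∀ i, ∃ j, j ≠ i ∧ τ j = τ i)).card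
        ≤ Fintype.card κ ^ (2 * r) := by
      refine (card_le_univ _).trans_eq ?_
      rw [Fintype.card_fun, hι]
    exact_mod_cast this

end Moment

section Fourier

variable {p : ℕ} [Fact p.Prime]

lemma half_le_re_stdAddChar {j : ℤ} (h : 6 * |j| ≤ p) :
    1 / 2 ≤ (ZMod.stdAddChar (j : ZMod p)).re := by
  have hp : (0 : ℝ) < p := by exact_mod_cast (Fact.out : p.Prime).pos
  have h1 : 2 * (Real.pi : ℂ) * Complex.I * (j : ℂ) / (p : ℂ)
      = ((2 * Real.pi * j / p : ℝ) : ℂ) * Complex.I := by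
    push_cast
    ring
  rw [ZMod.stdAddChar_coe, h1, Complex.exp_ofReal_mul_I_re, ← Real.cos_pi_div_three,
    ← Real.cos_abs (2 * Real.pi * j / p)]
  have h2 : (6 : ℝ) * |(j : ℝ)| ≤ p := by exact_mod_cast h
  have h3 : |2 * Real.pi * j / p| ≤ Real.pi / 3 := by
    rw [abs_div, abs_mul, abs_of_pos Real.two_pi_pos, abs_of_pos hp, div_le_iff₀ hp]
    nlinarith [Real.pi_pos]
  exact Real.cos_le_cos_of_nonneg_of_le_pi (abs_nonneg _) (by linarith [Real.pi_pos]) h3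

lemma norm_sum_stdAddChar_sq {α : Type*} (J : Finset α) (f : α → ZMod p) :
    ((‖∑ j ∈ J, ZMod.stdAddChar (f j)‖ ^ 2 : ℝ) : ℂ)
      = ∑ x ∈ J ×ˢ J, ZMod.stdAddChar (f x.1 - f x.2) := by
  push_cast
  rw [← Complex.mul_conj', map_sum, Finset.sum_mul_sum, Finset.sum_product]
  refine Finset.sum_congr rfl fun i _ => Finset.sum_congr rfl fun j _ => ?_
  rw [sub_eq_add_neg, AddChar.map_add_eq_mul, AddChar.map_neg_eq_conj]

lemma card_sq_le_norm_sum_stdAddChar_sq {α : Type*} {J : Finset α} {f : α → ZMod p}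
    (h : ∀ j ∈ J, 1 / 2 ≤ (ZMod.stdAddChar (f j)).re) :
    (J.card : ℝ) ^ 2 ≤ 4 * ‖∑ j ∈ J, ZMod.stdAddChar (f j)‖ ^ 2 := by
  have h1 : (J.card : ℝ) / 2 ≤ ‖∑ j ∈ J, ZMod.stdAddChar (f j)‖ := by
    refine le_trans ?_ (Complex.re_le_norm _)
    rw [Complex.re_sum]
    refine le_trans (Eq.le ?_) (Finset.card_nsmul_le_sum _ _ _ h)
    rw [nsmul_eq_mul]
    ring
  have h2 : (0 : ℝ) ≤ (J.card : ℝ) / 2 := by positivity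
  nlinarith

lemma sum_stdAddChar_mul (b : ZMod p) :
    ∑ x, ZMod.stdAddChar (x * b) = if b = 0 then (p : ℂ) else 0 := by
  rw [AddChar.sum_mulShift b (ZMod.isPrimitive_stdAddChar p), ZMod.card]
  split_ifs <;> simp

lemma sum_stdAddChar_dotProduct {ι : Type*} [Fintype ι] [DecidableEq ι] (w : ι → ZMod p) :
    ∑ x : ι → ZMod p, ZMod.stdAddChar (x ⬝ᵥ w)
      = if w = 0 then (p : ℂ) ^ Fintype.card ι else 0 := by
  have h : ∀ x : ι → ZMod p, ZMod.stdAddChar (x ⬝ᵥ w) = ∏ i, ZMod.stdAddChar (x i * w i) := by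
    intro x
    rw [dotProduct]
    exact map_prod (ZMod.stdAddChar (N := p)).toMonoidHom
      (fun i => Multiplicative.ofAdd (x i * w i)) univ
  simp_rw [h]
  rw [← Fintype.prod_sum fun i (y : ZMod p) => ZMod.stdAddChar (y * w i)]
  simp_rw [sum_stdAddChar_mul]
  split_ifs with hw
  · subst hw
    simp
  · obtain ⟨i, hi⟩ := Function.ne_iff.1 hw
    exact Finset.prod_eq_zero (mem_univ i) (if_neg hi)

/-- The large spectrum of a set is small. -/
lemma card_mul_card_le_of_half_le_re {T U : Finset (ZMod p)}
    (h : ∀ t ∈ T, ∀ u ∈ U, 1 / 2 ≤ (ZMod.stdAddChar (t * u)).re) :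
    T.card * U.card ≤ 4 * p := by
  have h1 : ∑ t : ZMod p, ‖∑ u ∈ U, ZMod.stdAddChar (t * u)‖ ^ 2 = p * U.card := by
    have : ((∑ t : ZMod p, ‖∑ u ∈ U, ZMod.stdAddChar (t * u)‖ ^ 2 : ℝ) : ℂ)
        = (p : ℂ) * U.card := by
      rw [Complex.ofReal_sum]
      simp_rw [norm_sum_stdAddChar_sq]
      rw [Finset.sum_comm]
      simp_rw [← mul_sub, sum_stdAddChar_mul, sub_eq_zero]
      rw [Finset.sum_product]
      rw [Finset.sum_congr rfl (g := fun _ => (p : ℂ)) fun u hu => by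
        rw [Finset.sum_ite_eq, if_pos hu]]
      rw [Finset.sum_const, nsmul_eq_mul, mul_comm]
    exact_mod_cast this
  have h2 : (T.card : ℝ) * (U.card : ℝ) ^ 2 ≤ 4 * (p * U.card) := by
    rw [← h1, Finset.mul_sum, ← nsmul_eq_mul, ← Finset.sum_const]
    refine (Finset.sum_le_sum fun t ht => card_sq_le_norm_sum_stdAddChar_sq (h t ht)).trans ?_
    exact Finset.sum_le_sum_of_subset_of_nonneg (subset_univ _) fun _ _ _ => by positivity
  rcases Nat.eq_zero_or_pos U.card with h0 | h0
  · simp [h0]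
  · have h3 : (0 : ℝ) < U.card := by exact_mod_cast h0
    have h4 : (T.card : ℝ) * U.card ≤ 4 * p := by
      refine le_of_mul_le_mul_right ?_ h3
      calc (T.card : ℝ) * U.card * U.card = T.card * (U.card : ℝ) ^ 2 := by ring
        _ ≤ 4 * (p * U.card) := h2
        _ = 4 * p * U.card := by ring
    exact_mod_cast h4

/-- A set of points on a hyperplane is bounded by a count of multiples of the normal vector. -/
lemma card_mul_card_le_of_hyperplane {ι : Type*} [Fintype ι] [DecidableEq ι] {c : ι → ZMod p}
    {S J : Finset (ι → ZMod p)} (hS : ∀ x ∈ S, x ⬝ᵥ c = 0)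
    (h : ∀ x ∈ S, ∀ j ∈ J, 1 / 2 ≤ (ZMod.stdAddChar (x ⬝ᵥ j)).re) :
    p * (S.card * J.card) ≤ 4 * p ^ Fintype.card ι
      * (univ.filter fun t : ZMod p => ∃ j ∈ J, ∃ j' ∈ J, j' - j = t • c).card := by
  set B := univ.filter fun t : ZMod p => ∃ j ∈ J, ∃ j' ∈ J, j' - j = t • c with hB
  set n := Fintype.card ι with hn
  have horth : ∀ x : ι → ZMod p, ∑ t : ZMod p, ZMod.stdAddChar (t * (x ⬝ᵥ c))
      = if x ⬝ᵥ c = 0 then (p : ℂ) else 0 := fun x => sum_stdAddChar_mul _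
  set E : ℕ := ∑ t : ZMod p, ((J ×ˢ J).filter fun y => y.2 - y.1 = t • c).card with hE
  have hsum : ∑ x : ι → ZMod p, (if x ⬝ᵥ c = 0 then (p : ℝ) else 0)
      * ‖∑ j ∈ J, ZMod.stdAddChar (x ⬝ᵥ j)‖ ^ 2 = p ^ n * E := by
    have : ((∑ x : ι → ZMod p, (if x ⬝ᵥ c = 0 then (p : ℝ) else 0)
        * ‖∑ j ∈ J, ZMod.stdAddChar (x ⬝ᵥ j)‖ ^ 2 : ℝ) : ℂ) = (p : ℂ) ^ n * E := by
      rw [Complex.ofReal_sum]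
      have h1 : ∀ x : ι → ZMod p, (((if x ⬝ᵥ c = 0 then (p : ℝ) else 0)
          * ‖∑ j ∈ J, ZMod.stdAddChar (x ⬝ᵥ j)‖ ^ 2 : ℝ) : ℂ)
          = ∑ t : ZMod p, ∑ y ∈ J ×ˢ J, ZMod.stdAddChar (x ⬝ᵥ (t • c + (y.1 - y.2))) := by
        intro x
        rw [Complex.ofReal_mul, norm_sum_stdAddChar_sq]
        have h2 : (((if x ⬝ᵥ c = 0 then (p : ℝ) else 0 : ℝ)) : ℂ)
            = ∑ t : ZMod p, ZMod.stdAddChar (t * (x ⬝ᵥ c)) := by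
          rw [horth]
          split_ifs <;> simp
        rw [h2, Finset.sum_mul]
        refine Finset.sum_congr rfl fun t _ => ?_
        rw [Finset.mul_sum]
        refine Finset.sum_congr rfl fun y _ => ?_
        rw [← AddChar.map_add_eq_mul, dotProduct_add, dotProduct_smul, dotProduct_sub, smul_eq_mul]
      rw [Finset.sum_congr rfl fun x _ => h1 x, Finset.sum_comm, hE, Nat.cast_sum, Finset.mul_sum]
      refine Finset.sum_congr rfl fun t _ => ?_
      rw [Finset.sum_comm]
      simp_rw [sum_stdAddChar_dotProduct]
      rw [← Finset.sum_filter, Finset.sum_const, nsmul_eq_mul, mul_comm]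
      congr 3
      refine Finset.filter_congr fun y _ => ?_
      rw [← neg_sub y.2 y.1, add_neg_eq_zero, eq_comm]
    exact_mod_cast this
  have hE1 : E ≤ B.card * J.card := by
    rw [hE, ← Finset.sum_subset (subset_univ B)]
    · rw [← smul_eq_mul]
      refine Finset.sum_le_card_nsmul _ _ _ fun t _ => ?_
      refine Finset.card_le_card_of_injOn Prod.fst ?_ ?_
      · intro y hy
        exact (mem_product.1 (mem_filter.1 hy).1).1
      · rintro ⟨y1, y2⟩ hy ⟨z1, z2⟩ hz (rfl : y1 = z1)
        have h1 := (mem_filter.1 hy).2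
        have h2 := (mem_filter.1 hz).2
        simp only at h1 h2
        rw [← h2] at h1
        rw [sub_left_inj.1 h1]
    · intro t _ ht
      rw [card_eq_zero, filter_eq_empty_iff]
      intro y hy h
      rw [mem_product] at hy
      exact ht (mem_filter.2 ⟨mem_univ _, y.1, hy.1, y.2, hy.2, h⟩)
  have hS1 : (p : ℝ) * (S.card * (J.card : ℝ) ^ 2) ≤ 4 * (p ^ n * E) := by
    rw [← hsum, Finset.mul_sum, ← nsmul_eq_mul (S.card), ← Finset.sum_const, Finset.mul_sum]
    refine le_trans (Finset.sum_le_sum (g := fun x => 4 * ((if x ⬝ᵥ c = 0 then (p : ℝ) else 0)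
      * ‖∑ j ∈ J, ZMod.stdAddChar (x ⬝ᵥ j)‖ ^ 2)) fun x hx => ?_) ?_
    · rw [if_pos (hS x hx), mul_left_comm 4]
      exact mul_le_mul_of_nonneg_left (card_sq_le_norm_sum_stdAddChar_sq (h x hx))
        (Nat.cast_nonneg _)
    · exact Finset.sum_le_sum_of_subset_of_nonneg (subset_univ _) fun x _ _ => by
        split_ifs <;> positivity
  rcases Nat.eq_zero_or_pos J.card with h0 | h0
  · simp [h0]
  · have h2 : p * (S.card * J.card ^ 2) ≤ 4 * (p ^ n * E) := by exact_mod_cast hS1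
    refine Nat.le_of_mul_le_mul_right ?_ h0
    calc p * (S.card * J.card) * J.card = p * (S.card * J.card ^ 2) := by ring
      _ ≤ 4 * (p ^ n * E) := h2
      _ ≤ 4 * (p ^ n * (B.card * J.card)) := by gcongr
      _ = 4 * p ^ n * B.card * J.card := by ring

end Fourier

section Pigeonhole

open Module

/-- A finite spanning set contains a basis in which all of its elements have coordinates bounded
by one. -/
lemma exists_basis_forall_abs_repr_le_one {W : Type*} [AddCommGroup W] [Module ℝ W]
    [FiniteDimensional ℝ W] (S : Finset W) (hS : Submodule.span ℝ (S : Set W) = ⊤) :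
    ∃ b : Basis (Fin (finrank ℝ W)) ℝ W, (∀ i, b i ∈ S) ∧ ∀ s ∈ S, ∀ i, |b.repr s i| ≤ 1 := by
  classical
  set e := finBasis ℝ W with he
  have hfr : finrank ℝ (Submodule.span ℝ (S : Set W)) = finrank ℝ W := by
    rw [hS, finrank_top]
  have hex := Submodule.exists_fun_fin_finrank_span_eq ℝ (S : Set W)
  rw [hfr, hS] at hex
  obtain ⟨g, hgS, hgspan, hgli⟩ := hex
  obtain ⟨v, hv, hmax⟩ := Finset.exists_max_image (Fintype.piFinset fun _ => S)
    (fun v => |e.det v|) ⟨g, Fintype.mem_piFinset.2 hgS⟩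
  rw [Fintype.mem_piFinset] at hv
  have hpos : 0 < |e.det v| := by
    refine lt_of_lt_of_le ?_ (hmax g (Fintype.mem_piFinset.2 hgS))
    exact abs_pos.2 (e.is_basis_iff_det.1 ⟨hgli, hgspan⟩).ne_zero
  obtain ⟨hli, hsp⟩ := e.is_basis_iff_det.2 (isUnit_iff_ne_zero.2 (abs_pos.1 hpos))
  refine ⟨Basis.mk hli hsp.ge, fun i => by simpa using hv i, fun s hs i => ?_⟩
  have h := LinearMap.congr_fun (e.det_smul_mk_coord_eq_det_update hli hsp.ge i) s
  rw [LinearMap.smul_apply, MultilinearMap.toLinearMap_apply, smul_eq_mul, Basis.coord_apply] at h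
  have h1 := hmax (Function.update v i s) (Fintype.mem_piFinset.2 fun j => by
    rcases eq_or_ne j i with rfl | hj
    · simpa using hs
    · simpa [Function.update_of_ne hj] using hv j)
  have h2 : |e.det v| * |(Basis.mk hli hsp.ge).repr s i| ≤ |e.det v| * 1 := by
    rw [mul_one, ← abs_mul, h]
    exact h1
  exact le_of_mul_le_mul_left h2 hpos

/-- A large finite set of small rank contains two points that are close to each other. -/
theorem exists_ne_forall_mul_abs_sub_le {V κ : Type*} [AddCommGroup V] [Module ℝ V] {S : Finset V}
    {r M : ℕ} (hr : finrank ℝ (Submodule.span ℝ (S : Set V)) ≤ r) (hM : (2 * M + 1) ^ r < S.card)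
    {f : κ → V →ₗ[ℝ] ℝ} {H : κ → ℝ} (hf : ∀ k, ∀ s ∈ S, |f k s| ≤ H k) :
    ∃ z ∈ S, ∃ z' ∈ S, z ≠ z' ∧ ∀ k, M * |f k z - f k z'| ≤ r * H k := by
  classical
  set W := Submodule.span ℝ (S : Set V) with hW
  have hfin : FiniteDimensional ℝ W := FiniteDimensional.span_finset ℝ S
  set S' : Finset W := S.attach.image fun s => ⟨s.1, Submodule.subset_span s.2⟩ with hS'
  have hS'mem : ∀ w : W, w ∈ S' ↔ (w : V) ∈ S := by
    intro w
    simp only [hS', mem_image, mem_attach, true_and, Subtype.exists]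
    constructor
    · rintro ⟨a, ha, rfl⟩
      exact ha
    · intro h
      exact ⟨w, h, rfl⟩
  have hspan : Submodule.span ℝ (S' : Set W) = ⊤ := by
    have : (S' : Set W) = ((↑) : W → V) ⁻¹' (S : Set V) := by
      ext w
      simp [hS'mem]
    rw [this]
    exact Submodule.span_span_coe_preimage
  obtain ⟨b, hbS, hb⟩ := exists_basis_forall_abs_repr_le_one S' hspan
  set cell : V → Fin (finrank ℝ W) → ℤ := fun v i =>
    if h : v ∈ W then ⌊(M : ℝ) * b.repr ⟨v, h⟩ i⌋ else 0 with hcell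
  have hmaps : Set.MapsTo cell S (Fintype.piFinset fun _ : Fin (finrank ℝ W) =>
      Icc (-(M : ℤ)) M) := by
    intro s hs
    have hs' : s ∈ W := Submodule.subset_span hs
    rw [mem_coe, Fintype.mem_piFinset]
    intro i
    have h1 := abs_le.1 (hb ⟨s, hs'⟩ ((hS'mem _).2 hs) i)
    have hM0 : (0 : ℝ) ≤ M := Nat.cast_nonneg M
    rw [hcell]
    simp only [hs', dif_pos, mem_Icc]
    constructor
    · rw [Int.le_floor]
      push_cast
      nlinarith
    · have h2 : (M : ℝ) * b.repr ⟨s, hs'⟩ i ≤ M := by nlinarith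
      exact_mod_cast (Int.floor_le _).trans h2
  have hcard : (Fintype.piFinset fun _ : Fin (finrank ℝ W) => Icc (-(M : ℤ)) M).card < S.card := by
    refine lt_of_le_of_lt ?_ hM
    rw [Fintype.card_piFinset_const, Int.card_Icc]
    have : (↑M + 1 - -(M : ℤ)).toNat = 2 * M + 1 := by omega
    rw [this]
    exact Nat.pow_le_pow_right (by omega) hr
  obtain ⟨z, hz, z', hz', hne, heq⟩ := Finset.exists_ne_map_eq_of_card_lt_of_maps_to hcard hmaps
  refine ⟨z, hz, z', hz', hne, fun k => ?_⟩
  have hzW : z ∈ W := Submodule.subset_span hz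
  have hzW' : z' ∈ W := Submodule.subset_span hz'
  have hH : 0 ≤ H k := (abs_nonneg _).trans (hf k z hz)
  have hclose : ∀ i, M * |b.repr ⟨z, hzW⟩ i - b.repr ⟨z', hzW'⟩ i| ≤ 1 := by
    intro i
    have h := congrFun heq i
    simp only [hcell, hzW, hzW', dif_pos] at h
    have h1 := (Int.abs_sub_lt_one_of_floor_eq_floor h).le
    rwa [← mul_sub, abs_mul, Nat.abs_cast] at h1
  have hdiff : f k z - f k z'
      = ∑ i, (b.repr ⟨z, hzW⟩ i - b.repr ⟨z', hzW'⟩ i) * f k (b i : V) := by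
    have h1 : ∀ w : W, f k (w : V) = ∑ i, b.repr w i * f k (b i : V) := by
      intro w
      calc f k (w : V) = (f k ∘ₗ W.subtype) (∑ i, b.repr w i • b i) := by rw [b.sum_repr]; rfl
        _ = ∑ i, b.repr w i * f k (b i : V) := by
          rw [map_sum]
          exact Finset.sum_congr rfl fun i _ => by rw [map_smul]; rfl
    rw [show f k z = _ from h1 ⟨z, hzW⟩, show f k z' = _ from h1 ⟨z', hzW'⟩,
      ← Finset.sum_sub_distrib]
    simp_rw [sub_mul]
  rw [hdiff]
  calc (M : ℝ) * |∑ i, (b.repr ⟨z, hzW⟩ i - b.repr ⟨z', hzW'⟩ i) * f k (b i : V)|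
      ≤ M * ∑ i, |(b.repr ⟨z, hzW⟩ i - b.repr ⟨z', hzW'⟩ i) * f k (b i : V)| := by
        gcongr
        exact Finset.abs_sum_le_sum_abs _ _
    _ = ∑ i, M * |b.repr ⟨z, hzW⟩ i - b.repr ⟨z', hzW'⟩ i| * |f k (b i : V)| := by
        rw [Finset.mul_sum]
        simp_rw [abs_mul, mul_assoc]
    _ ≤ ∑ _i : Fin (finrank ℝ W), H k := by
        refine Finset.sum_le_sum fun i _ => ?_
        refine (mul_le_mul (hclose i) (hf k _ ((hS'mem _).1 (hbS i))) (abs_nonneg _)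
          zero_le_one).trans_eq (one_mul _)
    _ = finrank ℝ W * H k := by simp
    _ ≤ r * H k := by
        gcongr

end Pigeonhole

section IntegerVectors

open Module

variable {ι : Type*}

/-- An integer vector seen as a real vector. -/
def realVec {ι : Type*} (v : ι → ℤ) : ι → ℝ := fun k => v k

lemma realVec_injective : Function.Injective (realVec (ι := ι)) := fun v w h => by
  ext k
  exact Int.cast_injective (congrFun h k)

/-- The dimension of the real span of a finite set of integer vectors. -/
noncomputable def realRank {ι : Type*} (S : Finset (ι → ℤ)) : ℕ :=
  finrank ℝ (Submodule.span ℝ (realVec '' (S : Set (ι → ℤ))))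

lemma realRank_le_one {S : Finset (ι → ℤ)} {w : ι → ℝ}
    (h : ∀ v ∈ S, ∃ c : ℝ, realVec v = c • w) : realRank S ≤ 1 := by
  have hle : Submodule.span ℝ (realVec '' (S : Set (ι → ℤ))) ≤ Submodule.span ℝ {w} := by
    rw [Submodule.span_le]
    rintro _ ⟨v, hv, rfl⟩
    obtain ⟨c, hc⟩ := h v hv
    exact Submodule.mem_span_singleton.2 ⟨c, hc.symm⟩
  refine (Submodule.finrank_mono hle).trans ?_
  have := finrank_span_le_card (R := ℝ) ({w} : Set (ι → ℝ))
  simpa using this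

variable [Fintype ι]

/-- A large set of integer vectors of small rank contains two vectors that are close. -/
lemma exists_ne_forall_mul_abs_sub_le_of_realRank {S : Finset (ι → ℤ)} {r M : ℕ}
    (hr : realRank S ≤ r) (hM : (2 * M + 1) ^ r < S.card) {H : ι → ℕ}
    (hH : ∀ v ∈ S, ∀ k, |v k| ≤ H k) :
    ∃ z ∈ S, ∃ z' ∈ S, z ≠ z' ∧ ∀ k, (M : ℤ) * |z k - z' k| ≤ r * H k := by
  classical
  have h := exists_ne_forall_mul_abs_sub_le (S := S.image realVec) (r := r) (M := M)
    (f := fun k => LinearMap.proj k) (H := fun k => (H k : ℝ)) (by rwa [coe_image])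
    (by rwa [card_image_of_injective _ realVec_injective]) (by
      intro k s hs
      obtain ⟨v, hv, rfl⟩ := mem_image.1 hs
      have := hH v hv k
      simp only [LinearMap.proj_apply, realVec]
      exact_mod_cast this)
  obtain ⟨_, hz, _, hz', hne, hc⟩ := h
  obtain ⟨v, hv, rfl⟩ := mem_image.1 hz
  obtain ⟨v', hv', rfl⟩ := mem_image.1 hz'
  refine ⟨v, hv, v', hv', fun h => hne (by rw [h]), fun k => ?_⟩
  have := hc k
  simp only [LinearMap.proj_apply, realVec] at this
  exact_mod_cast this

/-- Orthogonal sets of integer vectors have complementary ranks. -/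
lemma realRank_add_realRank_le {S T : Finset (ι → ℤ)}
    (h : ∀ v ∈ S, ∀ w ∈ T, v ⬝ᵥ w = 0) : realRank S + realRank T ≤ Fintype.card ι := by
  have horth : ∀ v ∈ Submodule.span ℝ (realVec '' (S : Set (ι → ℤ))),
      ∀ w ∈ Submodule.span ℝ (realVec '' (T : Set (ι → ℤ))), v ⬝ᵥ w = 0 := by
    intro v hv w hw
    induction hv using Submodule.span_induction with
    | mem x hx =>
      obtain ⟨x, hx, rfl⟩ := hx
      induction hw using Submodule.span_induction with
      | mem y hy =>
        obtain ⟨y, hy, rfl⟩ := hy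
        have := h x hx y hy
        simp only [dotProduct, realVec] at this ⊢
        exact_mod_cast this
      | zero => simp
      | add y z _ _ hy hz => rw [dotProduct_add, hy, hz, add_zero]
      | smul c y _ hy => rw [dotProduct_smul, hy, smul_zero]
    | zero => simp
    | add y z _ _ hy hz => rw [add_dotProduct, hy, hz, add_zero]
    | smul c y _ hy => rw [smul_dotProduct, hy, smul_zero]
  have hdisj : Disjoint (Submodule.span ℝ (realVec '' (S : Set (ι → ℤ))))
      (Submodule.span ℝ (realVec '' (T : Set (ι → ℤ)))) := by
    rw [Submodule.disjoint_def]
    intro x hx hy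
    exact dotProduct_self_eq_zero.1 (horth x hx x hy)
  have := Submodule.finrank_add_finrank_le_of_disjoint hdisj
  rwa [finrank_fintype_fun_eq_card] at this

/-- Restricting coordinates lowers the rank if it identifies two vectors. -/
lemma realRank_image_comp_add_one_le {κ : Type*} [Fintype κ] [DecidableEq (κ → ℤ)]
    {S : Finset (ι → ℤ)} (e : κ → ι) {z z' : ι → ℤ}
    (hz : z ∈ S) (hz' : z' ∈ S) (hne : z ≠ z') (heq : z ∘ e = z' ∘ e) :
    realRank (S.image fun v => v ∘ e) + 1 ≤ realRank S := by
  set U := Submodule.span ℝ (realVec '' (S : Set (ι → ℤ))) with hU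
  set π : (ι → ℝ) →ₗ[ℝ] (κ → ℝ) := LinearMap.funLeft ℝ ℝ e with hπ
  have hmap : Submodule.span ℝ (realVec '' ((S.image fun v => v ∘ e : Finset (κ → ℤ)) :
      Set (κ → ℤ))) = LinearMap.range (π.domRestrict U) := by
    rw [LinearMap.range_domRestrict, hU, Submodule.map_span, coe_image, Set.image_image,
      Set.image_image]
    rfl
  have hrn := LinearMap.finrank_range_add_finrank_ker (π.domRestrict U)
  have hker : 0 < finrank ℝ (LinearMap.ker (π.domRestrict U)) := by
    have hmem : realVec z - realVec z' ∈ U :=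
      U.sub_mem (Submodule.subset_span ⟨z, hz, rfl⟩) (Submodule.subset_span ⟨z', hz', rfl⟩)
    have hk : (⟨realVec z - realVec z', hmem⟩ : U) ∈ LinearMap.ker (π.domRestrict U) := by
      rw [LinearMap.mem_ker, LinearMap.domRestrict_apply, map_sub, sub_eq_zero]
      ext k
      have := congrFun heq k
      simp only [Function.comp_apply] at this
      simp [hπ, LinearMap.funLeft_apply, realVec, this]
    rw [Nat.pos_iff_ne_zero, Ne, Submodule.finrank_eq_zero]
    intro h
    rw [h, Submodule.mem_bot, Subtype.ext_iff] at hk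
    exact hne (realVec_injective (sub_eq_zero.1 hk))
  have hS : realRank S = finrank ℝ U := rfl
  rw [hS, realRank, hmap]
  omega

end IntegerVectors

section LatticeBox

variable {p : ℕ}

/-- The integer points `v` of a box with `v ⬝ᵥ c = 0` modulo `p`. -/
noncomputable def latticeBox {ι : Type*} [Fintype ι] [DecidableEq ι] (c : ι → ZMod p) (β : ι → ℕ) :
    Finset (ι → ℤ) :=
  (Fintype.piFinset fun k => Ioo (-(β k : ℤ)) (β k)).filter
    fun v => (fun k => (v k : ZMod p)) ⬝ᵥ c = 0

lemma mem_latticeBox {ι : Type*} [Fintype ι] [DecidableEq ι] {c : ι → ZMod p} {β : ι → ℕ}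
    {v : ι → ℤ} : v ∈ latticeBox c β ↔
      (∀ k, |v k| < β k) ∧ (fun k => (v k : ZMod p)) ⬝ᵥ c = 0 := by
  simp [latticeBox, abs_lt]

/-- The solutions of `a₁ x₁ + a₂ x₂ = l (a₁ y₁ + a₂ y₂)` with `|xᵢ|, |yᵢ| < bᵢ`. -/
noncomputable def ratioLattice (a₁ a₂ : ZMod p) (b₁ b₂ : ℕ) (l : ZMod p) : Finset (Fin 4 → ℤ) :=
  latticeBox ![a₁, a₂, -(l * a₁), -(l * a₂)] ![b₁, b₂, b₁, b₂]

variable {a₁ a₂ l : ZMod p} {b₁ b₂ : ℕ}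

lemma mem_ratioLattice {v : Fin 4 → ℤ} : v ∈ ratioLattice a₁ a₂ b₁ b₂ l ↔
    (|v 0| < b₁ ∧ |v 1| < b₂ ∧ |v 2| < b₁ ∧ |v 3| < b₂) ∧
      a₁ * v 0 + a₂ * v 1 = l * (a₁ * v 2 + a₂ * v 3) := by
  rw [ratioLattice, mem_latticeBox, Fin.forall_fin_succ, Fin.forall_fin_succ,
    Fin.forall_fin_succ, Fin.forall_fin_succ, dotProduct, Fin.sum_univ_four, ← sub_eq_zero (b := l * _)]
  have h : (v 0 : ZMod p) * a₁ + v 1 * a₂ + v 2 * -(l * a₁) + v 3 * -(l * a₂)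
      = a₁ * v 0 + a₂ * v 1 - l * (a₁ * v 2 + a₂ * v 3) := by ring
  rw [← h]
  simp [and_assoc]

lemma eq_zero_of_intCast_of_abs_lt {x : ℤ} (h : (x : ZMod p) = 0) (hx : |x| < p) : x = 0 :=
  Int.eq_zero_of_abs_lt_dvd ((ZMod.intCast_zmod_eq_zero_iff_dvd x p).1 h) hx

lemma realRank_latticeBox_le_one (h : 8 * b₁ ^ 2 < p) :
    realRank (latticeBox ![1, -l] ![2 * b₁, 2 * b₁]) ≤ 1 := by
  set S := latticeBox ![1, -l] ![2 * b₁, 2 * b₁] with hS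
  have hmem : ∀ v ∈ S, (|v 0| < 2 * b₁ ∧ |v 1| < 2 * b₁) ∧ (v 0 : ZMod p) = l * v 1 := by
    intro v hv
    rw [hS, mem_latticeBox, Fin.forall_fin_two, dotProduct, Fin.sum_univ_two] at hv
    simp only [Matrix.cons_val_zero, Matrix.cons_val_one, Nat.cast_mul, Nat.cast_ofNat] at hv
    exact ⟨hv.1, by linear_combination hv.2⟩
  by_cases h0 : ∃ w ∈ S, w 1 ≠ 0
  · obtain ⟨w, hw, hw1⟩ := h0
    have hw1' : (w 1 : ℝ) ≠ 0 := by exact_mod_cast hw1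
    refine realRank_le_one (w := realVec w) fun v hv => ⟨v 1 / w 1, ?_⟩
    obtain ⟨⟨hv0, hv1⟩, hvl⟩ := hmem v hv
    obtain ⟨⟨hw0, hw1''⟩, hwl⟩ := hmem w hw
    have hdet : v 0 * w 1 - v 1 * w 0 = 0 := by
      refine eq_zero_of_intCast_of_abs_lt (p := p) ?_ ?_
      · push_cast
        rw [hvl, hwl]
        ring
      · have h1 : |v 0 * w 1| ≤ 2 * b₁ * (2 * b₁) := by
          rw [abs_mul]
          exact mul_le_mul hv0.le hw1''.le (abs_nonneg _) (by positivity)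
        have h2 : |v 1 * w 0| ≤ 2 * b₁ * (2 * b₁) := by
          rw [abs_mul]
          exact mul_le_mul hv1.le hw0.le (abs_nonneg _) (by positivity)
        have h3 : (8 * b₁ ^ 2 : ℤ) < p := by exact_mod_cast h
        have h4 := abs_sub (v 0 * w 1) (v 1 * w 0)
        nlinarith
    have hdet' : (v 0 : ℝ) * w 1 = v 1 * w 0 := by exact_mod_cast sub_eq_zero.1 hdet
    ext k
    rw [Pi.smul_apply, smul_eq_mul, div_mul_eq_mul_div, eq_div_iff hw1']
    simp only [realVec]
    revert k
    rw [Fin.forall_fin_two]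
    exact ⟨hdet', rfl⟩
  · push Not at h0
    refine realRank_le_one (w := 0) fun v hv => ⟨0, ?_⟩
    obtain ⟨⟨hv0, hv1⟩, hvl⟩ := hmem v hv
    have h1 := h0 v hv
    have h2 : v 0 = 0 := by
      refine eq_zero_of_intCast_of_abs_lt (p := p) (by rw [hvl, h1]; simp) ?_
      have h3 : (8 * b₁ ^ 2 : ℤ) < p := by exact_mod_cast h
      nlinarith
    rw [zero_smul]
    ext k
    revert k
    rw [Fin.forall_fin_two]
    simp [realVec, h1, h2]

lemma card_le_of_realRank_le_one {κ : Type*} [Fintype κ] {S : Finset (κ → ℤ)} {b : ℕ}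
    (hr : realRank S ≤ 1) (hS : ∀ v ∈ S, ∀ k, |v k| < b) : S.card ≤ 2 * b + 1 := by
  by_contra! hcard
  obtain ⟨z, hz, z', hz', hne, h⟩ := exists_ne_forall_mul_abs_sub_le_of_realRank (M := b)
    (H := fun _ => b - 1) hr (by simpa using hcard) (fun v hv k => by
      have := hS v hv k
      push_cast [show 1 ≤ b by have := abs_nonneg (v k); omega]
      omega)
  refine hne (funext fun k => ?_)
  have hb : 1 ≤ b := by
    have := hS z hz k
    have := abs_nonneg (z k)
    omega
  have h1 := h k
  push_cast [hb] at h1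
  by_contra hk
  have h2 : 1 ≤ |z k - z' k| := Int.one_le_abs (sub_ne_zero.2 hk)
  nlinarith

lemma ratioLattice_card_le {z z' : Fin 4 → ℤ} (hz : z ∈ ratioLattice a₁ a₂ b₁ b₂ l)
    (hz' : z' ∈ ratioLattice a₁ a₂ b₁ b₂ l) (hne : z ≠ z') (h1 : z 1 = z' 1) (h3 : z 3 = z' 3)
    (hr : realRank (ratioLattice a₁ a₂ b₁ b₂ l) ≤ 2) [Fact p.Prime] (ha₁ : a₁ ≠ 0) :
    (ratioLattice a₁ a₂ b₁ b₂ l).card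
      ≤ (latticeBox ![1, -l] ![2 * b₁, 2 * b₁]).card * (2 * b₂ + 1) := by
  set L := ratioLattice a₁ a₂ b₁ b₂ l with hL
  set e : Fin 2 → Fin 4 := ![1, 3] with he
  have hrank := realRank_image_comp_add_one_le e hz hz' hne (by
    ext k
    revert k
    rw [Fin.forall_fin_two]
    exact ⟨h1, h3⟩)
  have hP : (L.image fun v => v ∘ e).card ≤ 2 * b₂ + 1 := by
    refine card_le_of_realRank_le_one (by omega) fun v hv => ?_
    obtain ⟨w, hw, rfl⟩ := mem_image.1 hv
    have := mem_ratioLattice.1 hw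
    rw [Fin.forall_fin_two]
    exact ⟨this.1.2.1, this.1.2.2.2⟩
  refine (card_le_mul_card_image L _ fun y hy => ?_).trans (Nat.mul_le_mul_left _ hP)
  obtain ⟨w, hw, rfl⟩ := mem_image.1 hy
  refine card_le_card_of_injOn (fun v => ![v 0 - w 0, v 2 - w 2]) ?_ ?_
  · intro v hv
    obtain ⟨hv, hvw⟩ := mem_filter.1 hv
    have e1 : v 1 = w 1 := congrFun hvw 0
    have e3 : v 3 = w 3 := congrFun hvw 1
    obtain ⟨⟨hv0, hv1, hv2, hv3⟩, hvl⟩ := mem_ratioLattice.1 hv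
    obtain ⟨⟨hw0, hw1, hw2, hw3⟩, hwl⟩ := mem_ratioLattice.1 hw
    rw [mem_coe, mem_latticeBox, Fin.forall_fin_two, dotProduct, Fin.sum_univ_two]
    refine ⟨⟨?_, ?_⟩, ?_⟩
    · simp only [Matrix.cons_val_zero]
      have := abs_sub (v 0) (w 0)
      push_cast
      omega
    · simp only [Matrix.cons_val_one]
      have := abs_sub (v 2) (w 2)
      push_cast
      omega
    · simp only [Matrix.cons_val_zero, Matrix.cons_val_one]
      push_cast
      refine mul_left_cancel₀ ha₁ ?_
      rw [e1, e3] at hvl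
      linear_combination hvl - hwl
  · intro v hv u hu huv
    obtain ⟨hv, hvw⟩ := mem_filter.1 hv
    obtain ⟨hu, huw⟩ := mem_filter.1 hu
    have e1 : v 1 = w 1 := congrFun hvw 0
    have e3 : v 3 = w 3 := congrFun hvw 1
    have f1 : u 1 = w 1 := congrFun huw 0
    have f3 : u 3 = w 3 := congrFun huw 1
    have g0 : v 0 - w 0 = u 0 - w 0 := congrFun huv 0
    have g2 : v 2 - w 2 = u 2 - w 2 := congrFun huv 1
    ext k
    fin_cases k
    · exact sub_left_inj.1 g0
    · exact e1.trans f1.symm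
    · exact sub_left_inj.1 g2
    · exact e3.trans f3.symm

/-- If the projection is not injective then the ratio `l` is a quotient of small integers. -/
lemma exists_small_ratio [Fact p.Prime] {n : ℕ} {z z' : Fin 4 → ℤ}
    (hz : z ∈ ratioLattice a₁ a₂ b₁ b₂ l)
    (hz' : z' ∈ ratioLattice a₁ a₂ b₁ b₂ l) (hne : z ≠ z') (h1 : z 1 = z' 1) (h3 : z 3 = z' 3)
    (hr : realRank (ratioLattice a₁ a₂ b₁ b₂ l) ≤ 2) (ha₁ : a₁ ≠ 0) (hp : 8 * b₁ ^ 2 < p)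
    (hb₂ : 1 ≤ b₂) (hn : n ≤ (ratioLattice a₁ a₂ b₁ b₂ l).card) :
    ∃ y y' : ℤ, (y : ZMod p) = l * y' ∧ (y' : ZMod p) ≠ 0 ∧
      n * |y| ≤ 48 * (b₁ * b₂) ∧ n * |y'| ≤ 48 * (b₁ * b₂) := by
  suffices h : ∃ y y' : ℤ, ∃ M : ℕ, 1 ≤ M ∧ n ≤ 24 * b₂ * M ∧ (y : ZMod p) = l * y' ∧
      (y ≠ 0 ∨ y' ≠ 0) ∧ M * |y| ≤ 2 * b₁ ∧ M * |y'| ≤ 2 * b₁ by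
    obtain ⟨y, y', M, hM, hnM, hl, h0, hy, hy'⟩ := h
    have hM' : (1 : ℤ) ≤ M := by exact_mod_cast hM
    have hnM' : (n : ℤ) ≤ 24 * b₂ * M := by exact_mod_cast hnM
    have key : ∀ x : ℤ, M * |x| ≤ 2 * b₁ → n * |x| ≤ 48 * (b₁ * b₂) := by
      intro x hx
      calc (n : ℤ) * |x| ≤ 24 * b₂ * M * |x| := mul_le_mul_of_nonneg_right hnM' (abs_nonneg x)
        _ = 24 * b₂ * (M * |x|) := by ring
        _ ≤ 24 * b₂ * (2 * b₁) := by gcongr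
        _ = 48 * (b₁ * b₂) := by ring
    have hsmall : ∀ x : ℤ, M * |x| ≤ 2 * b₁ → |x| < p := by
      intro x hx
      have h8 : (8 * b₁ ^ 2 : ℤ) < p := by exact_mod_cast hp
      have hx' : |x| ≤ 2 * b₁ := by nlinarith [abs_nonneg x]
      have hb0 : (0 : ℤ) ≤ b₁ := by positivity
      rcases hb0.eq_or_lt with hb | hb
      · nlinarith
      · nlinarith
    refine ⟨y, y', hl, fun hy0 => ?_, key y hy, key y' hy'⟩
    have e1 := eq_zero_of_intCast_of_abs_lt hy0 (hsmall y' hy')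
    have e2 := eq_zero_of_intCast_of_abs_lt (p := p) (by rw [hl, hy0, mul_zero]) (hsmall y hy)
    simp [e1, e2] at h0
  by_cases hlt : n < 24 * b₂
  · obtain ⟨⟨hv0, hv1, hv2, hv3⟩, hvl⟩ := mem_ratioLattice.1 hz
    obtain ⟨⟨hw0, hw1, hw2, hw3⟩, hwl⟩ := mem_ratioLattice.1 hz'
    refine ⟨z 0 - z' 0, z 2 - z' 2, 1, le_rfl, by omega, ?_, ?_, ?_, ?_⟩
    · push_cast
      refine mul_left_cancel₀ ha₁ ?_
      rw [h1, h3] at hvl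
      linear_combination hvl - hwl
    · by_contra! hcon
      refine hne ?_
      ext k
      fin_cases k
      · exact sub_eq_zero.1 hcon.1
      · exact h1
      · exact sub_eq_zero.1 hcon.2
      · exact h3
    · have := abs_sub (z 0) (z' 0)
      push_cast
      omega
    · have := abs_sub (z 2) (z' 2)
      push_cast
      omega
  · push Not at hlt
    set M := n / (12 * b₂) with hM
    have hpos : 0 < 12 * b₂ := by omega
    have hM2 : 2 ≤ M := (Nat.le_div_iff_mul_le hpos).2 (by omega)
    have hMle : M * (12 * b₂) ≤ n := Nat.div_mul_le_self _ _
    have hMlt : n < 12 * b₂ * (M + 1) := Nat.lt_mul_div_succ n hpos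
    have hcard := hn.trans (ratioLattice_card_le hz hz' hne h1 h3 hr ha₁)
    have hlarge : (2 * M + 1) ^ 1 < (latticeBox ![1, -l] ![2 * b₁, 2 * b₁]).card := by
      rw [pow_one]
      by_contra! hcon
      have h2 : n ≤ (2 * M + 1) * (2 * b₂ + 1) := hcard.trans (Nat.mul_le_mul_right _ hcon)
      nlinarith
    obtain ⟨w, hw, w', hw', hww, hd⟩ := exists_ne_forall_mul_abs_sub_le_of_realRank
      (H := fun _ => 2 * b₁) (realRank_latticeBox_le_one hp) hlarge (fun v hv => by
        have hv := (mem_latticeBox.1 hv).1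
        rw [Fin.forall_fin_two] at hv ⊢
        exact ⟨hv.1.le, hv.2.le⟩)
    rw [mem_latticeBox, dotProduct, Fin.sum_univ_two] at hw hw'
    have hl := hw.2
    have hl' := hw'.2
    simp only [Matrix.cons_val_zero, Matrix.cons_val_one] at hl hl'
    refine ⟨w 0 - w' 0, w 1 - w' 1, M, by omega, by nlinarith, ?_, ?_, ?_, ?_⟩
    · push_cast
      linear_combination hl - hl'
    · by_contra! hcon
      refine hww ?_
      ext k
      fin_cases k
      · exact sub_eq_zero.1 hcon.1
      · exact sub_eq_zero.1 hcon.2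
    · simpa using hd 0
    · simpa using hd 1

end LatticeBox

section SmallMultiples

variable {p : ℕ}

lemma exists_ne_zero_mem_latticeBox {ι : Type*} [Fintype ι] [DecidableEq ι] {c : ι → ZMod p}
    {β : ι → ℕ} {n m : ℕ} (hm : m ^ 2 ≤ n) (hn2 : 2 ≤ n) (hn : n ≤ (latticeBox c β).card)
    (hr : realRank (latticeBox c β) ≤ 2) :
    ∃ v ∈ latticeBox c β, v ≠ 0 ∧ ∀ k, m * |v k| ≤ 16 * β k := by
  rcases Nat.lt_or_ge m 8 with hm8 | hm8
  · obtain ⟨v, hv, hv0⟩ := Finset.exists_mem_ne (by omega : 1 < (latticeBox c β).card) 0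
    refine ⟨v, hv, hv0, fun k => ?_⟩
    have h1 := (mem_latticeBox.1 hv).1 k
    have h2 := abs_nonneg (v k)
    have h3 : (m : ℤ) < 8 := by exact_mod_cast hm8
    nlinarith
  · set M := m / 4 with hM
    have hcard : (2 * M + 1) ^ 2 < (latticeBox c β).card :=
      (Nat.pow_lt_pow_left (by omega : 2 * M + 1 < m) two_ne_zero).trans_le (hm.trans hn)
    have hβ : ∀ v ∈ latticeBox c β, ∀ k, |v k| ≤ ((β k - 1 : ℕ) : ℤ) := by
      intro v hv k
      have h1 := (mem_latticeBox.1 hv).1 k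
      have h2 := abs_nonneg (v k)
      omega
    obtain ⟨z, hz, z', hz', hne, h⟩ :=
      exists_ne_forall_mul_abs_sub_le_of_realRank hr hcard hβ
    have hβ1 : ∀ k, ((β k - 1 : ℕ) : ℤ) = β k - 1 := by
      intro k
      have h1 := (mem_latticeBox.1 hz).1 k
      have h2 := abs_nonneg (z k)
      omega
    have hM2 : (2 : ℤ) ≤ M := by omega
    refine ⟨z - z', mem_latticeBox.2 ⟨fun k => ?_, ?_⟩, sub_ne_zero.2 hne, fun k => ?_⟩
    · have h1 := h k
      rw [hβ1] at h1
      rw [Pi.sub_apply]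
      push_cast at h1
      nlinarith [abs_nonneg (z k - z' k)]
    · have h1 := (mem_latticeBox.1 hz).2
      have h2 := (mem_latticeBox.1 hz').2
      have h3 : (fun k => (((z - z') k : ℤ) : ZMod p))
          = (fun k => (z k : ZMod p)) - fun k => (z' k : ZMod p) := by
        ext k
        simp
      rw [h3, sub_dotProduct, h1, h2, sub_zero]
    · have h1 := h k
      rw [hβ1] at h1
      rw [Pi.sub_apply]
      push_cast at h1
      have h4 : (m : ℤ) ≤ 8 * M := by omega
      nlinarith [abs_nonneg (z k - z' k)]

lemma abs_valMinAbs_le [NeZero p] {x : ZMod p} {u : ℤ} (h : (u : ZMod p) = x) :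
    |x.valMinAbs| ≤ |u| := by
  have := ZMod.natAbs_min_of_le_div_two p x.valMinAbs u (by rw [ZMod.coe_valMinAbs, h])
    (ZMod.natAbs_valMinAbs_le x)
  rw [Int.abs_eq_natAbs, Int.abs_eq_natAbs]
  exact_mod_cast this

/-- If the integer points of a hyperplane in a box have large rank, then the normal vector has a
small multiple. -/
lemma exists_small_smul [Fact p.Prime] {c : Fin 4 → ZMod p} {β q : Fin 4 → ℕ} {M : ℕ}
    (hc : c 0 ≠ 0) (hq : ∀ k, 24 * (β k * q k) ≤ p) (hq' : ∀ k, p ≤ 24 * (β k * (q k + 1)))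
    (hβ : ∀ k, 1 ≤ β k) (hβp : ∀ k, 2 * β k ≤ p) (hr : 3 ≤ realRank (latticeBox c β))
    (hM : (2 * M + 1) * (4 * 24 ^ 4 * ∏ k, β k) < p * (latticeBox c β).card) :
    ∃ s : ZMod p, s ≠ 0 ∧ ∀ k, M * |(s * c k).valMinAbs| ≤ q k := by
  have hp : 0 < p := (Fact.out : p.Prime).pos
  set L := latticeBox c β with hL
  set S : Finset (Fin 4 → ZMod p) := L.image fun v k => (v k : ZMod p) with hS
  set J : Finset (Fin 4 → ZMod p) := Fintype.piFinset fun k =>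
    (range (q k + 1)).image fun m : ℕ => (m : ZMod p) with hJ
  set B := univ.filter fun t : ZMod p => ∃ j ∈ J, ∃ j' ∈ J, j' - j = t • c with hB
  have hSc : S.card = L.card := by
    refine card_image_of_injOn fun v hv w hw hvw => ?_
    ext k
    have h1 := (mem_latticeBox.1 hv).1 k
    have h2 := (mem_latticeBox.1 hw).1 k
    have h3 := abs_sub (v k) (w k)
    have h4 := hβp k
    refine sub_eq_zero.1 (eq_zero_of_intCast_of_abs_lt (p := p) ?_ (by omega))
    have h5 : (v k : ZMod p) = w k := congrFun hvw k
    push_cast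
    rw [h5, sub_self]
  have hqp : ∀ k, q k < p := by
    intro k
    have h1 := hq k
    have h2 := hβ k
    nlinarith
  have hJc : J.card = ∏ k, (q k + 1) := by
    rw [hJ, Fintype.card_piFinset]
    refine Finset.prod_congr rfl fun k _ => ?_
    rw [card_image_of_injOn, card_range]
    intro x hx y hy hxy
    rw [mem_coe, mem_range] at hx hy
    have h1 := hqp k
    have := (ZMod.natCast_eq_natCast_iff' x y p).1 hxy
    rwa [Nat.mod_eq_of_lt (by omega), Nat.mod_eq_of_lt (by omega)] at this
  have hJlift : ∀ j ∈ J, ∃ m : Fin 4 → ℕ, ∀ k, m k ≤ q k ∧ (m k : ZMod p) = j k := by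
    intro j hj
    rw [hJ, Fintype.mem_piFinset] at hj
    have : ∀ k, ∃ m : ℕ, m ≤ q k ∧ (m : ZMod p) = j k := by
      intro k
      obtain ⟨m, hm, hmj⟩ := mem_image.1 (hj k)
      exact ⟨m, Nat.lt_succ_iff.1 (mem_range.1 hm), hmj⟩
    exact ⟨fun k => (this k).choose, fun k => (this k).choose_spec⟩
  have hdot : ∀ v ∈ L, ∀ w : Fin 4 → ℤ, (∀ k, |w k| ≤ q k) → 6 * |v ⬝ᵥ w| ≤ p := by
    intro v hv w hw
    have h1 : ∀ k, 24 * |v k * w k| ≤ p := by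
      intro k
      have h2 := (mem_latticeBox.1 hv).1 k
      have h3 : |v k * w k| ≤ β k * q k := by
        rw [abs_mul]
        exact mul_le_mul h2.le (hw k) (abs_nonneg _) (by positivity)
      have h4 : (24 * (β k * q k) : ℤ) ≤ p := by exact_mod_cast hq k
      linarith
    have h5 : |v ⬝ᵥ w| ≤ ∑ k, |v k * w k| := abs_sum_le_sum_abs _ _
    rw [Fin.sum_univ_four] at h5
    linarith [h1 0, h1 1, h1 2, h1 3]
  have hmain := card_mul_card_le_of_hyperplane (c := c) (S := S) (J := J) (by
      intro x hx
      obtain ⟨v, hv, rfl⟩ := mem_image.1 hx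
      exact (mem_latticeBox.1 hv).2) (by
      intro x hx j hj
      obtain ⟨v, hv, rfl⟩ := mem_image.1 hx
      obtain ⟨m, hm⟩ := hJlift j hj
      have h1 : (fun k => (v k : ZMod p)) ⬝ᵥ j = ((v ⬝ᵥ fun k => (m k : ℤ) : ℤ) : ZMod p) := by
        simp only [dotProduct, Int.cast_sum, Int.cast_mul, Int.cast_natCast]
        exact Finset.sum_congr rfl fun k _ => by rw [(hm k).2]
      rw [h1]
      refine half_le_re_stdAddChar (hdot v hv _ fun k => ?_)
      rw [Nat.abs_cast]
      exact_mod_cast (hm k).1)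
  rw [← hB, hSc, hJc, Fintype.card_fin] at hmain
  have hBw : ∀ t ∈ B, ∀ k, |(t * c k).valMinAbs| ≤ q k := by
    intro t ht k
    obtain ⟨j, hj, j', hj', h⟩ := (mem_filter.1 ht).2
    obtain ⟨m, hm⟩ := hJlift j hj
    obtain ⟨m', hm'⟩ := hJlift j' hj'
    refine (abs_valMinAbs_le (u := (m' k : ℤ) - m k) ?_).trans ?_
    · have := congrFun h k
      simp only [Pi.sub_apply, Pi.smul_apply, smul_eq_mul] at this
      push_cast
      rw [(hm k).2, (hm' k).2, this]
    · have h1 := (hm k).1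
      have h2 := (hm' k).1
      rw [abs_le]
      omega
  set W : Finset (Fin 4 → ℤ) := B.image fun t k => (t * c k).valMinAbs with hW
  have hWc : W.card = B.card := by
    refine card_image_of_injective _ fun t t' h => ?_
    exact mul_right_cancel₀ hc (ZMod.injective_valMinAbs (congrFun h 0))
  have hWr : realRank W ≤ 1 := by
    have := realRank_add_realRank_le (S := L) (T := W) (by
      intro v hv w hw
      obtain ⟨t, ht, rfl⟩ := mem_image.1 hw
      have h1 := hdot v hv _ (hBw t ht)
      refine eq_zero_of_intCast_of_abs_lt (p := p) ?_ ?_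
      · have h2 : t * ((fun k => (v k : ZMod p)) ⬝ᵥ c) = 0 := by
          rw [(mem_latticeBox.1 hv).2, mul_zero]
        rw [← h2]
        simp only [dotProduct, Int.cast_sum, Int.cast_mul, ZMod.coe_valMinAbs, Finset.mul_sum]
        exact Finset.sum_congr rfl fun k _ => by ring
      · have := abs_nonneg (v ⬝ᵥ fun k => (t * c k).valMinAbs)
        have hp' : (0 : ℤ) < p := by exact_mod_cast hp
        linarith)
    rw [Fintype.card_fin] at this
    omega
  have hWlarge : (2 * M + 1) ^ 1 < W.card := by
    rw [pow_one, hWc]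
    by_contra! hcon
    have h1 : p ^ 4 ≤ 24 ^ 4 * ((∏ k, β k) * ∏ k, (q k + 1)) := by
      calc p ^ 4 = ∏ _k : Fin 4, p := by simp
        _ ≤ ∏ k, 24 * (β k * (q k + 1)) := Finset.prod_le_prod' fun k _ => hq' k
        _ = _ := by simp [Finset.prod_mul_distrib]
    have h2 : p * L.card * p ^ 4 ≤ (2 * M + 1) * (4 * 24 ^ 4 * ∏ k, β k) * p ^ 4 := by
      calc p * L.card * p ^ 4
          ≤ p * L.card * (24 ^ 4 * ((∏ k, β k) * ∏ k, (q k + 1))) := Nat.mul_le_mul_left _ h1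
        _ = 24 ^ 4 * (∏ k, β k) * (p * (L.card * ∏ k, (q k + 1))) := by ring
        _ ≤ 24 ^ 4 * (∏ k, β k) * (4 * p ^ 4 * B.card) := Nat.mul_le_mul_left _ hmain
        _ ≤ 24 ^ 4 * (∏ k, β k) * (4 * p ^ 4 * (2 * M + 1)) := by gcongr
        _ = _ := by ring
    exact absurd (Nat.le_of_mul_le_mul_right h2 (by positivity)) (by omega)
  obtain ⟨z, hz, z', hz', hne, hd⟩ :=
    exists_ne_forall_mul_abs_sub_le_of_realRank hWr hWlarge (H := q) (by
      intro w hw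
      obtain ⟨t, ht, rfl⟩ := mem_image.1 hw
      exact hBw t ht)
  obtain ⟨t, ht, rfl⟩ := mem_image.1 hz
  obtain ⟨t', ht', rfl⟩ := mem_image.1 hz'
  refine ⟨t - t', sub_ne_zero.2 fun h => hne (by rw [h]), fun k => ?_⟩
  have h1 := hd k
  simp only [Nat.cast_one, one_mul] at h1
  refine le_trans ?_ h1
  refine mul_le_mul_of_nonneg_left (abs_valMinAbs_le ?_) (by positivity)
  push_cast [ZMod.coe_valMinAbs]
  ring

/-- The `t` for which `t a₁` and `t a₂` are both small. -/
def bohrSet (a₁ a₂ : ZMod p) (q₁ q₂ M : ℕ) [NeZero p] : Finset (ZMod p) :=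
  univ.filter fun t => M * |(t * a₁).valMinAbs| ≤ q₁ ∧ M * |(t * a₂).valMinAbs| ≤ q₂

lemma mem_bohrSet {a₁ a₂ : ZMod p} {q₁ q₂ M : ℕ} [NeZero p] {t : ZMod p} :
    t ∈ bohrSet a₁ a₂ q₁ q₂ M ↔
      M * |(t * a₁).valMinAbs| ≤ q₁ ∧ M * |(t * a₂).valMinAbs| ≤ q₂ := by
  simp [bohrSet]

variable [Fact p.Prime] {a₁ a₂ : ZMod p} {q₁ q₂ : ℕ}

lemma mul_card_bohrSet_le {M : ℕ} {s : ZMod p} (hs : s ∈ bohrSet a₁ a₂ q₁ q₂ M) (hs0 : s ≠ 0)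
    (ha₁ : a₁ ≠ 0) (hq : 2 * q₁ < p) :
    M * (bohrSet a₁ a₂ q₁ q₂ M).card ≤ 3 * (bohrSet a₁ a₂ q₁ q₂ 1).card := by
  obtain ⟨t, ht, hmax⟩ := Finset.exists_max_image (bohrSet a₁ a₂ q₁ q₂ M)
    (fun t => |(t * a₁).valMinAbs|) ⟨s, hs⟩
  have ht1 : 0 < |(t * a₁).valMinAbs| := by
    refine lt_of_lt_of_le ?_ (hmax s hs)
    rw [abs_pos, Ne, ZMod.valMinAbs_eq_zero]
    exact mul_ne_zero hs0 ha₁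
  set m := (M + 2) / 3 with hm
  have hMm : M ≤ 3 * m := by omega
  have hcoord : ∀ (a : ZMod p) (q : ℕ) (b : ZMod p), M * |(b * a).valMinAbs| ≤ q →
      M * |(t * a).valMinAbs| ≤ q → ∀ j < m,
      |(b * a).valMinAbs + 3 * j * (t * a).valMinAbs| ≤ q := by
    intro a q b hb ht j hj
    have hjM : 3 * (j : ℤ) + 1 ≤ M := by omega
    have h1 := abs_add_le (b * a).valMinAbs (3 * j * (t * a).valMinAbs)
    rw [abs_mul, abs_of_nonneg (by positivity : (0 : ℤ) ≤ 3 * j)] at h1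
    have hM : (0 : ℤ) < M := by omega
    refine le_of_mul_le_mul_left ?_ hM
    have hj0 : (0 : ℤ) ≤ 3 * j := by positivity
    have hq0 : (0 : ℤ) ≤ q := by positivity
    calc M * |(b * a).valMinAbs + 3 * j * (t * a).valMinAbs|
        ≤ M * (|(b * a).valMinAbs| + 3 * j * |(t * a).valMinAbs|) := by gcongr
      _ = M * |(b * a).valMinAbs| + 3 * j * (M * |(t * a).valMinAbs|) := by ring
      _ ≤ q + 3 * j * q := by gcongr
      _ = (3 * j + 1) * q := by ring
      _ ≤ M * q := by gcongr
  have hcard : (bohrSet a₁ a₂ q₁ q₂ M ×ˢ range m).card ≤ (bohrSet a₁ a₂ q₁ q₂ 1).card := by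
    refine card_le_card_of_injOn (fun x => x.1 + 3 * (x.2 : ZMod p) * t) ?_ ?_
    · rintro ⟨b, j⟩ hx
      obtain ⟨hb, hj⟩ := mem_product.1 hx
      rw [mem_range] at hj
      rw [mem_bohrSet] at hb ht
      rw [mem_coe, mem_bohrSet, Nat.cast_one, one_mul, one_mul]
      refine ⟨(abs_valMinAbs_le ?_).trans (hcoord a₁ q₁ b hb.1 ht.1 j hj),
        (abs_valMinAbs_le ?_).trans (hcoord a₂ q₂ b hb.2 ht.2 j hj)⟩ <;>
      · push_cast [ZMod.coe_valMinAbs]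
        ring
    · rintro ⟨b, j⟩ hx ⟨b', j'⟩ hx' heq
      obtain ⟨hb, hj⟩ := mem_product.1 hx
      obtain ⟨hb', hj'⟩ := mem_product.1 hx'
      rw [mem_range] at hj hj'
      simp only at heq hb hb' hj hj'
      have h1 := hcoord a₁ q₁ b (mem_bohrSet.1 hb).1 (mem_bohrSet.1 ht).1 j hj
      have h2 := hcoord a₁ q₁ b' (mem_bohrSet.1 hb').1 (mem_bohrSet.1 ht).1 j' hj'
      have h3 := eq_zero_of_intCast_of_abs_lt (p := p)
        (x := (b * a₁).valMinAbs + 3 * j * (t * a₁).valMinAbs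
          - ((b' * a₁).valMinAbs + 3 * j' * (t * a₁).valMinAbs)) (by
          push_cast [ZMod.coe_valMinAbs]
          linear_combination a₁ * heq) (by
          have := abs_sub ((b * a₁).valMinAbs + 3 * j * (t * a₁).valMinAbs)
            ((b' * a₁).valMinAbs + 3 * j' * (t * a₁).valMinAbs)
          have hq' : (2 * q₁ : ℤ) < p := by exact_mod_cast hq
          linarith)
      have h4 : 3 * ((j' : ℤ) - j) * (t * a₁).valMinAbs
          = (b * a₁).valMinAbs - (b' * a₁).valMinAbs := by linarith
      have h5 : 3 * |(j' : ℤ) - j| * |(t * a₁).valMinAbs| ≤ 2 * |(t * a₁).valMinAbs| := by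
        have h6 := congrArg abs h4
        rw [abs_mul, abs_mul, abs_of_pos (by norm_num : (0 : ℤ) < 3)] at h6
        rw [h6]
        have h7 := abs_sub (b * a₁).valMinAbs (b' * a₁).valMinAbs
        have h8 := hmax b hb
        have h9 := hmax b' hb'
        linarith
      have h6 : 3 * |(j' : ℤ) - j| ≤ 2 := le_of_mul_le_mul_right h5 ht1
      have h7 : (j' : ℤ) - j = 0 := abs_eq_zero.1 (by have := abs_nonneg ((j' : ℤ) - j); omega)
      have h8 : j = j' := by omega
      subst h8
      rw [add_left_inj] at heq
      rw [heq]
  rw [card_product, card_range] at hcard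
  calc M * (bohrSet a₁ a₂ q₁ q₂ M).card ≤ 3 * m * (bohrSet a₁ a₂ q₁ q₂ M).card := by gcongr
    _ = 3 * ((bohrSet a₁ a₂ q₁ q₂ M).card * m) := by ring
    _ ≤ _ := by gcongr

lemma card_bohrSet_mul_le {b₁ b₂ : ℕ} (hq₁ : 12 * (b₁ * q₁) ≤ p) (hq₂ : 12 * (b₂ * q₂) ≤ p)
    (hprop : ∀ x y : ℤ, |x| < b₁ → |y| < b₂ → a₁ * x + a₂ * y = 0 → x = 0 ∧ y = 0) :
    (bohrSet a₁ a₂ q₁ q₂ 1).card * (b₁ * b₂) ≤ 4 * p := by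
  set U : Finset (ZMod p) := (range b₁ ×ˢ range b₂).image
    fun x => a₁ * (x.1 : ZMod p) + a₂ * (x.2 : ZMod p) with hU
  have hUc : U.card = b₁ * b₂ := by
    rw [hU, card_image_of_injOn, card_product, card_range, card_range]
    rintro ⟨x, y⟩ hx ⟨x', y'⟩ hx' h
    simp only [mem_coe, mem_product, mem_range] at hx hx'
    obtain ⟨h1, h2⟩ := hprop (x - x') (y - y') (by rw [abs_lt]; omega) (by rw [abs_lt]; omega) (by
      push_cast
      linear_combination h)
    rw [Prod.mk.injEq]
    omega
  rw [← hUc]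
  refine card_mul_card_le_of_half_le_re fun t ht u hu => ?_
  obtain ⟨⟨x, y⟩, hx, rfl⟩ := mem_image.1 hu
  simp only [mem_product, mem_range] at hx
  rw [mem_bohrSet, Nat.cast_one, one_mul, one_mul] at ht
  have h1 : t * (a₁ * (x : ZMod p) + a₂ * (y : ZMod p))
      = ((x * (t * a₁).valMinAbs + y * (t * a₂).valMinAbs : ℤ) : ZMod p) := by
    push_cast [ZMod.coe_valMinAbs]
    ring
  rw [h1]
  refine half_le_re_stdAddChar ?_
  have h2 : |(x : ℤ) * (t * a₁).valMinAbs| ≤ b₁ * q₁ := by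
    rw [abs_mul, Nat.abs_cast]
    exact mul_le_mul (by exact_mod_cast hx.1.le) ht.1 (abs_nonneg _) (by positivity)
  have h3 : |(y : ℤ) * (t * a₂).valMinAbs| ≤ b₂ * q₂ := by
    rw [abs_mul, Nat.abs_cast]
    exact mul_le_mul (by exact_mod_cast hx.2.le) ht.2 (abs_nonneg _) (by positivity)
  have h4 := abs_add_le ((x : ℤ) * (t * a₁).valMinAbs) (y * (t * a₂).valMinAbs)
  have h5 : (12 * (b₁ * q₁) : ℤ) ≤ p := by exact_mod_cast hq₁
  have h6 : (12 * (b₂ * q₂) : ℤ) ≤ p := by exact_mod_cast hq₂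
  linarith

end SmallMultiples

section LevelSets

variable {p : ℕ} [Fact p.Prime] {a₁ a₂ : ZMod p} {b₁ b₂ : ℕ}

lemma mul_two_mul_div_add_one_le {m N : ℕ} (h : m ≤ N) : m * (2 * (N / m) + 1) ≤ 3 * N := by
  rcases Nat.eq_zero_or_pos m with rfl | hm
  · simp
  · have h1 : N / m * m ≤ N := Nat.div_mul_le_self _ _
    nlinarith

lemma mem_Icc_div_of_mul_abs_le {m N : ℕ} (hm : 0 < m) {x : ℤ} (h : m * |x| ≤ N) :
    x ∈ Icc (-((N / m : ℕ) : ℤ)) ((N / m : ℕ) : ℤ) := by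
  rw [mem_Icc, ← abs_le, Int.natCast_div, Int.le_ediv_iff_mul_le (by exact_mod_cast hm), mul_comm]
  exact h

lemma card_Icc_neg_natCast (R : ℕ) : (Icc (-(R : ℤ)) R).card = 2 * R + 1 := by
  rw [Int.card_Icc]
  omega

lemma sq_mul_card_le_of_small_ratio {n N : ℕ} (hn : 0 < n) {T : Finset (ZMod p)}
    (hT : ∀ l ∈ T, ∃ y y' : ℤ, (y : ZMod p) = l * y' ∧ (y' : ZMod p) ≠ 0 ∧
      n * |y| ≤ N ∧ n * |y'| ≤ N) : n ^ 2 * T.card ≤ (3 * N) ^ 2 := by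
  rcases T.eq_empty_or_nonempty with rfl | ⟨l₀, hl₀⟩
  · simp
  have hnN : n ≤ N := by
    obtain ⟨y, y', -, h0, -, h⟩ := hT l₀ hl₀
    have h1 : y' ≠ 0 := by
      rintro rfl
      simp at h0
    have h2 := Int.one_le_abs h1
    have hn' : (0 : ℤ) < n := by exact_mod_cast hn
    have h3 : (n : ℤ) ≤ N := by nlinarith
    exact_mod_cast h3
  set I := Icc (-((N / n : ℕ) : ℤ)) ((N / n : ℕ) : ℤ) with hI
  have hcard : T.card ≤ (2 * (N / n) + 1) ^ 2 := by
    have hsub : T ⊆ (I ×ˢ I).image fun x => (x.1 : ZMod p) / x.2 := by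
      intro l hl
      obtain ⟨y, y', h, h0, hy, hy'⟩ := hT l hl
      refine mem_image.2 ⟨(y, y'), mem_product.2 ⟨mem_Icc_div_of_mul_abs_le hn hy,
        mem_Icc_div_of_mul_abs_le hn hy'⟩, ?_⟩
      rw [div_eq_iff h0, h]
    refine (card_le_card hsub).trans (card_image_le.trans_eq ?_)
    rw [card_product, hI, card_Icc_neg_natCast, sq]
  calc n ^ 2 * T.card ≤ n ^ 2 * (2 * (N / n) + 1) ^ 2 := by gcongr
    _ = (n * (2 * (N / n) + 1)) ^ 2 := by ring
    _ ≤ _ := Nat.pow_le_pow_left (mul_two_mul_div_add_one_le hnN) 2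

lemma pow_mul_card_le_of_small_vector {m : ℕ} (hm0 : 0 < m) (hm₁ : m ≤ 16 * b₁)
    (hm₂ : m ≤ 16 * b₂)
    (hprop : ∀ x y : ℤ, |x| < b₁ → |y| < b₂ → a₁ * x + a₂ * y = 0 → x = 0 ∧ y = 0)
    {T : Finset (ZMod p)} (hT : ∀ l ∈ T, ∃ v ∈ ratioLattice a₁ a₂ b₁ b₂ l, v ≠ 0 ∧
      ∀ k, m * |v k| ≤ 16 * (![b₁, b₂, b₁, b₂] k : ℕ)) :
    m ^ 4 * T.card ≤ 48 ^ 4 * (b₁ * b₂) ^ 2 := by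
  set R : Fin 4 → ℕ := fun k => 16 * ![b₁, b₂, b₁, b₂] k / m with hR
  have hsub : T ⊆ (Fintype.piFinset fun k => Icc (-(R k : ℤ)) (R k)).image
      fun v => (a₁ * v 0 + a₂ * v 1) / (a₁ * v 2 + a₂ * v 3) := by
    intro l hl
    obtain ⟨v, hv, hv0, hvk⟩ := hT l hl
    obtain ⟨⟨h0, h1, h2, h3⟩, hvl⟩ := mem_ratioLattice.1 hv
    refine mem_image.2 ⟨v, ?_, ?_⟩
    · rw [Fintype.mem_piFinset]
      intro k
      exact mem_Icc_div_of_mul_abs_le hm0 (by exact_mod_cast hvk k)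
    · rw [div_eq_iff, hvl]
      intro hzero
      rw [hzero, mul_zero] at hvl
      obtain ⟨e0, e1⟩ := hprop _ _ h0 h1 hvl
      obtain ⟨e2, e3⟩ := hprop _ _ h2 h3 hzero
      refine hv0 ?_
      ext k
      fin_cases k <;> assumption
  have hcard : T.card ≤ ∏ k, (2 * R k + 1) := by
    refine (card_le_card hsub).trans (card_image_le.trans_eq ?_)
    rw [Fintype.card_piFinset]
    exact Finset.prod_congr rfl fun k _ => card_Icc_neg_natCast _
  calc m ^ 4 * T.card ≤ m ^ 4 * ∏ k, (2 * R k + 1) := by gcongr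
    _ = ∏ k, m * (2 * R k + 1) := by simp [Finset.prod_mul_distrib]
    _ ≤ ∏ k, 3 * (16 * ![b₁, b₂, b₁, b₂] k) := by
      refine Finset.prod_le_prod' fun k _ => mul_two_mul_div_add_one_le ?_
      fin_cases k <;> assumption
    _ = _ := by
      rw [Fin.prod_univ_four]
      simp
      ring

lemma sq_mul_card_le_of_bohrSet {n D M q₁ q₂ : ℕ} (ha₁ : a₁ ≠ 0) (hM1 : 1 ≤ M)
    (hM' : p * n < 4 * (4 * 24 ^ 4) * D ^ 2 * (M + 1))
    (hq : 2 * q₁ < p) (hcard : (bohrSet a₁ a₂ q₁ q₂ 1).card * D ≤ 4 * p)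
    {T : Finset (ZMod p)} (hT : ∀ l ∈ T, ∃ s ∈ bohrSet a₁ a₂ q₁ q₂ M, s ≠ 0 ∧
      ∃ s' ∈ bohrSet a₁ a₂ q₁ q₂ M, s' = -(l * s)) :
    n ^ 2 * T.card ≤ (96 * (4 * 24 ^ 4)) ^ 2 * D ^ 2 := by
  have hp : 0 < p := (Fact.out : p.Prime).pos
  rcases T.eq_empty_or_nonempty with rfl | ⟨l₀, hl₀⟩
  · simp
  obtain ⟨s, hs, hs0, -⟩ := hT l₀ hl₀
  have h1 := mul_card_bohrSet_le hs hs0 ha₁ hq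
  set B := bohrSet a₁ a₂ q₁ q₂ M with hB
  have hcardT : T.card ≤ B.card ^ 2 := by
    have hsub : T ⊆ (B ×ˢ B).image fun x => -(x.1 / x.2) := by
      intro l hl
      obtain ⟨s, hs, hs0, s', hs', h⟩ := hT l hl
      refine mem_image.2 ⟨(s', s), mem_product.2 ⟨hs', hs⟩, ?_⟩
      simp only [h]
      rw [neg_div, neg_neg, mul_div_assoc, div_self hs0, mul_one]
    refine (card_le_card hsub).trans (card_image_le.trans_eq ?_)
    rw [card_product, sq]
  have h2 : n * B.card ≤ 96 * (4 * 24 ^ 4) * D := by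
    refine Nat.le_of_mul_le_mul_left ?_ hp
    calc p * (n * B.card) = p * n * B.card := by ring
      _ ≤ 8 * (4 * 24 ^ 4) * D ^ 2 * M * B.card := by
        refine Nat.mul_le_mul_right _ ?_
        nlinarith [Nat.mul_le_mul_left (4 * (4 * 24 ^ 4) * D ^ 2) hM1]
      _ = 8 * (4 * 24 ^ 4) * D ^ 2 * (M * B.card) := by ring
      _ ≤ 8 * (4 * 24 ^ 4) * D ^ 2 * (3 * (bohrSet a₁ a₂ q₁ q₂ 1).card) := by gcongr
      _ = 24 * (4 * 24 ^ 4) * D * ((bohrSet a₁ a₂ q₁ q₂ 1).card * D) := by ring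
      _ ≤ 24 * (4 * 24 ^ 4) * D * (4 * p) := by gcongr
      _ = _ := by ring
  calc n ^ 2 * T.card ≤ n ^ 2 * B.card ^ 2 := by gcongr
    _ = (n * B.card) ^ 2 := by ring
    _ ≤ (96 * (4 * 24 ^ 4) * D) ^ 2 := Nat.pow_le_pow_left h2 2
    _ = _ := by ring

set_option maxHeartbeats 800000 in
/-- For few ratios `l` are there many solutions of `a₁ x₁ + a₂ x₂ = l (a₁ y₁ + a₂ y₂)`. -/
lemma sq_mul_card_filter_le_of_le (ha₁ : a₁ ≠ 0) (hb₂ : 1 ≤ b₂) (hb : b₂ ≤ b₁)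
    (hp : 4 * (4 * 24 ^ 4) * (b₁ * b₂) ^ 2 ≤ p)
    (hprop : ∀ x y : ℤ, |x| < b₁ → |y| < b₂ → a₁ * x + a₂ * y = 0 → x = 0 ∧ y = 0)
    {n : ℕ} (hn : 2 ≤ n) :
    n ^ 2 * (univ.filter fun l : ZMod p => n ≤ (ratioLattice a₁ a₂ b₁ b₂ l).card).card
      ≤ (100 * (4 * 24 ^ 4)) ^ 2 * (b₁ * b₂) ^ 2 := by
  classical
  set D := b₁ * b₂ with hD
  have hDpos : 0 < D := Nat.mul_pos (by omega) (by omega)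
  have hb₁D : b₁ ≤ D := Nat.le_mul_of_pos_right _ (by omega)
  have hb₂D : b₂ ≤ D := Nat.le_mul_of_pos_left _ (by omega)
  have hDD : D ≤ D ^ 2 := Nat.le_self_pow two_ne_zero D
  set T := univ.filter fun l : ZMod p => n ≤ (ratioLattice a₁ a₂ b₁ b₂ l).card with hT
  set q₁ := p / (24 * b₁) with hq₁
  set q₂ := p / (24 * b₂) with hq₂
  set M := p * n / (4 * (4 * 24 ^ 4) * D ^ 2) with hM
  set m := Nat.sqrt n with hm
  have hq : ∀ b : ℕ, 1 ≤ b → 24 * (b * (p / (24 * b))) ≤ p ∧ p ≤ 24 * (b * (p / (24 * b) + 1)) := by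
    intro b hb
    have h1 := Nat.mul_div_le p (24 * b)
    have h2 := Nat.lt_mul_div_succ p (show 0 < 24 * b by omega)
    constructor <;> nlinarith
  set β : Fin 4 → ℕ := ![b₁, b₂, b₁, b₂] with hβ
  set PA : ZMod p → Prop := fun l => ∃ y y' : ℤ, (y : ZMod p) = l * y' ∧ (y' : ZMod p) ≠ 0 ∧
    n * |y| ≤ (48 * D : ℕ) ∧ n * |y'| ≤ (48 * D : ℕ) with hPA
  set PB : ZMod p → Prop := fun l => m ≤ 2 * b₂ ∧ ∃ v ∈ ratioLattice a₁ a₂ b₁ b₂ l, v ≠ 0 ∧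
    ∀ k, m * |v k| ≤ 16 * (β k : ℕ) with hPB
  set PC : ZMod p → Prop := fun l => ∃ s ∈ bohrSet a₁ a₂ q₁ q₂ M, s ≠ 0 ∧
    ∃ s' ∈ bohrSet a₁ a₂ q₁ q₂ M, s' = -(l * s) with hPC
  have hDM : 0 < 4 * (4 * 24 ^ 4) * D ^ 2 := by positivity
  have hM1 : 1 ≤ M := (Nat.le_div_iff_mul_le hDM).2 (by nlinarith)
  have hMle : 4 * (4 * 24 ^ 4) * D ^ 2 * M ≤ p * n := Nat.mul_div_le _ _
  have hMlt : p * n < 4 * (4 * 24 ^ 4) * D ^ 2 * (M + 1) := Nat.lt_mul_div_succ _ hDM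
  have hm2 : m ^ 2 ≤ n := Nat.sqrt_le' n
  have hm1 : 1 ≤ m := Nat.le_sqrt'.2 (by omega)
  have hnm : n ≤ 4 * m ^ 2 := by
    have := Nat.lt_succ_sqrt' n
    rw [← hm, Nat.succ_eq_add_one] at this
    nlinarith
  have hcover : ∀ l ∈ T, PA l ∨ PB l ∨ PC l := by
    intro l hl
    have hnl : n ≤ (ratioLattice a₁ a₂ b₁ b₂ l).card := (mem_filter.1 hl).2
    rcases Nat.lt_or_ge 2 (realRank (ratioLattice a₁ a₂ b₁ b₂ l)) with hr | hr
    · right; right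
      obtain ⟨s, hs0, hs⟩ := exists_small_smul (c := ![a₁, a₂, -(l * a₁), -(l * a₂)]) (β := β)
        (q := ![q₁, q₂, q₁, q₂]) (M := M) ha₁
        (by
          intro k
          fin_cases k
          exacts [(hq b₁ (by omega)).1, (hq b₂ hb₂).1, (hq b₁ (by omega)).1, (hq b₂ hb₂).1])
        (by
          intro k
          fin_cases k
          exacts [(hq b₁ (by omega)).2, (hq b₂ hb₂).2, (hq b₁ (by omega)).2, (hq b₂ hb₂).2])
        (by
          intro k
          fin_cases k
          exacts [by simp [β]; omega, by simp [β]; omega, by simp [β]; omega, by simp [β]; omega])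
        (by
          intro k
          fin_cases k
          exacts [by simp [β]; omega, by simp [β]; omega, by simp [β]; omega, by simp [β]; omega])
        hr
        (by
          have hprod : ∏ k, β k = D ^ 2 := by
            rw [Fin.prod_univ_four]
            simp [β, D]
            ring
          rw [hprod]
          have h1 : p * n ≤ p * (ratioLattice a₁ a₂ b₁ b₂ l).card := Nat.mul_le_mul_left _ hnl
          refine lt_of_lt_of_le ?_ (hMle.trans h1)
          nlinarith)
      refine ⟨s, mem_bohrSet.2 ⟨hs 0, hs 1⟩, hs0, -(l * s), mem_bohrSet.2 ⟨?_, ?_⟩, rfl⟩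
      · have := hs 2
        rwa [show -(l * s) * a₁ = s * (![a₁, a₂, -(l * a₁), -(l * a₂)] : Fin 4 → ZMod p) 2 by
          simp
          ring]
      · have := hs 3
        rwa [show -(l * s) * a₂ = s * (![a₁, a₂, -(l * a₁), -(l * a₂)] : Fin 4 → ZMod p) 3 by
          simp
          ring]
    · by_cases hinj : Set.InjOn (fun v : Fin 4 → ℤ => (v 1, v 3)) (ratioLattice a₁ a₂ b₁ b₂ l)
      · right; left
        refine ⟨?_, exists_ne_zero_mem_latticeBox hm2 hn hnl hr⟩
        have hcard : (ratioLattice a₁ a₂ b₁ b₂ l).card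
            ≤ (Ioo (-(b₂ : ℤ)) b₂ ×ˢ Ioo (-(b₂ : ℤ)) b₂).card := by
          refine card_le_card_of_injOn _ (fun v hv => ?_) hinj
          obtain ⟨⟨h0, h1, h2, h3⟩, -⟩ := mem_ratioLattice.1 hv
          simp only [coe_product, coe_Ioo, Set.mem_prod, Set.mem_Ioo]
          exact ⟨abs_lt.1 h1, abs_lt.1 h3⟩
        rw [card_product, Int.card_Ioo] at hcard
        have h1 : ((b₂ : ℤ) - -(b₂ : ℤ) - 1).toNat ≤ 2 * b₂ := by omega
        have h2 : m ^ 2 ≤ (2 * b₂) ^ 2 := by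
          rw [sq (2 * b₂)]
          exact (hm2.trans hnl).trans (hcard.trans (Nat.mul_le_mul h1 h1))
        exact (Nat.pow_le_pow_iff_left two_ne_zero).1 h2
      · left
        rw [Set.InjOn] at hinj
        push Not at hinj
        obtain ⟨z, hz, z', hz', h, hne⟩ := hinj
        rw [Prod.mk.injEq] at h
        obtain ⟨y, y', h1, h2, h3, h4⟩ := exists_small_ratio hz hz' hne h.1 h.2 hr ha₁
          (by nlinarith) hb₂ hnl
        exact ⟨y, y', h1, h2, by push_cast [D]; exact h3, by push_cast [D]; exact h4⟩
  have hsub : T ⊆ T.filter PA ∪ (T.filter PB ∪ T.filter PC) := by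
    intro l hl
    rcases hcover l hl with h | h | h
    · exact mem_union_left _ (mem_filter.2 ⟨hl, h⟩)
    · exact mem_union_right _ (mem_union_left _ (mem_filter.2 ⟨hl, h⟩))
    · exact mem_union_right _ (mem_union_right _ (mem_filter.2 ⟨hl, h⟩))
  have hbq₁ : 24 * (b₁ * q₁) ≤ p := (hq b₁ (by omega)).1
  have hbq₂ : 24 * (b₂ * q₂) ≤ p := (hq b₂ hb₂).1
  have hA := sq_mul_card_le_of_small_ratio (n := n) (N := 48 * D) (by omega) (T := T.filter PA)
    fun l hl => (mem_filter.1 hl).2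
  have hB : m ^ 4 * (T.filter PB).card ≤ 48 ^ 4 * D ^ 2 := by
    by_cases h : m ≤ 2 * b₂
    · exact pow_mul_card_le_of_small_vector hm1 (by omega) (by omega) hprop
        fun l hl => (mem_filter.1 hl).2.2
    · rw [filter_eq_empty_iff.2 fun l _ hl => h hl.1]
      simp
  have hC := sq_mul_card_le_of_bohrSet (n := n) (q₁ := q₁) (q₂ := q₂) ha₁ hM1 hMlt
    (by nlinarith) (card_bohrSet_mul_le (by omega) (by omega) hprop)
    (T := T.filter PC) fun l hl => (mem_filter.1 hl).2
  have hB' : n ^ 2 * (T.filter PB).card ≤ 16 * (48 ^ 4 * D ^ 2) := by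
    calc n ^ 2 * (T.filter PB).card ≤ (4 * m ^ 2) ^ 2 * (T.filter PB).card := by gcongr
      _ = 16 * (m ^ 4 * (T.filter PB).card) := by ring
      _ ≤ _ := by gcongr
  have hcardT : T.card ≤ (T.filter PA).card + ((T.filter PB).card + (T.filter PC).card) :=
    (card_le_card hsub).trans ((card_union_le _ _).trans
      (Nat.add_le_add_left (card_union_le _ _) _))
  calc n ^ 2 * T.card
      ≤ n ^ 2 * ((T.filter PA).card + ((T.filter PB).card + (T.filter PC).card)) := by gcongr
    _ = n ^ 2 * (T.filter PA).card + (n ^ 2 * (T.filter PB).card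
        + n ^ 2 * (T.filter PC).card) := by ring
    _ ≤ (3 * (48 * D)) ^ 2 + (16 * (48 ^ 4 * D ^ 2)
        + (96 * (4 * 24 ^ 4)) ^ 2 * D ^ 2) := by gcongr
    _ ≤ _ := by nlinarith [sq_nonneg D]

end LevelSets

section Energy

variable {p : ℕ} {a₁ a₂ : ZMod p} {b₁ b₂ : ℕ}

lemma card_ratioLattice_swap (l : ZMod p) :
    (ratioLattice a₂ a₁ b₂ b₁ l).card = (ratioLattice a₁ a₂ b₁ b₂ l).card := by
  refine Finset.card_nbij' (fun v => ![v 1, v 0, v 3, v 2]) (fun v => ![v 1, v 0, v 3, v 2])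
    ?_ ?_ ?_ ?_
  · intro v hv
    obtain ⟨⟨h0, h1, h2, h3⟩, h⟩ := mem_ratioLattice.1 hv
    exact mem_ratioLattice.2 ⟨⟨h1, h0, h3, h2⟩, by simpa [add_comm] using h⟩
  · intro v hv
    obtain ⟨⟨h0, h1, h2, h3⟩, h⟩ := mem_ratioLattice.1 hv
    exact mem_ratioLattice.2 ⟨⟨h1, h0, h3, h2⟩, by simpa [add_comm] using h⟩
  · intro v _
    ext k
    fin_cases k <;> rfl
  · intro v _
    ext k
    fin_cases k <;> rfl

lemma card_ratioLattice_le (l : ZMod p) :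
    (ratioLattice a₁ a₂ b₁ b₂ l).card ≤ 16 * (b₁ * b₂) ^ 2 := by
  have h : ∀ b : ℕ, ((b : ℤ) - -(b : ℤ) - 1).toNat ≤ 2 * b := fun b => by omega
  calc (ratioLattice a₁ a₂ b₁ b₂ l).card
      ≤ ∏ k, (Ioo (-((![b₁, b₂, b₁, b₂] : Fin 4 → ℕ) k : ℤ))
          ((![b₁, b₂, b₁, b₂] : Fin 4 → ℕ) k)).card :=
        (card_filter_le _ _).trans (Fintype.card_piFinset _).le
    _ ≤ ∏ k, 2 * (![b₁, b₂, b₁, b₂] : Fin 4 → ℕ) k :=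
        Finset.prod_le_prod' fun k _ => by
          rw [Int.card_Ioo]
          exact h _
    _ = _ := by
        rw [Fin.prod_univ_four]
        simp
        ring

variable [Fact p.Prime]

lemma sq_mul_card_filter_le (ha₁ : a₁ ≠ 0) (ha₂ : a₂ ≠ 0) (hb₁ : 1 ≤ b₁) (hb₂ : 1 ≤ b₂)
    (hp : 4 * (4 * 24 ^ 4) * (b₁ * b₂) ^ 2 ≤ p)
    (hprop : ∀ x y : ℤ, |x| < b₁ → |y| < b₂ → a₁ * x + a₂ * y = 0 → x = 0 ∧ y = 0)
    {n : ℕ} (hn : 2 ≤ n) :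
    n ^ 2 * (univ.filter fun l : ZMod p => n ≤ (ratioLattice a₁ a₂ b₁ b₂ l).card).card
      ≤ (100 * (4 * 24 ^ 4)) ^ 2 * (b₁ * b₂) ^ 2 := by
  rcases le_total b₂ b₁ with h | h
  · exact sq_mul_card_filter_le_of_le ha₁ hb₂ h hp hprop hn
  · rw [mul_comm b₁ b₂] at hp ⊢
    have := sq_mul_card_filter_le_of_le (a₁ := a₂) (a₂ := a₁) ha₂ hb₁ h hp
      (fun x y hx hy hxy => (hprop y x hy hx (by rw [add_comm]; exact hxy)).symm) hn
    simpa only [card_ratioLattice_swap] using this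

lemma sq_le_two_mul_sum_Icc {N : ℕ} (hN : 2 ≤ N) : N ^ 2 ≤ 2 * ∑ n ∈ Icc 2 N, n := by
  induction N, hN using Nat.le_induction with
  | base => simp
  | succ m hm ih =>
    rw [Finset.sum_Icc_succ_top (by omega)]
    nlinarith

/-- The multiplicative energy of a two-dimensional progression. -/
lemma sum_sq_card_ratioLattice_le (ha₁ : a₁ ≠ 0) (ha₂ : a₂ ≠ 0) (hb₁ : 1 ≤ b₁) (hb₂ : 1 ≤ b₂)
    (hp : 4 * (4 * 24 ^ 4) * (b₁ * b₂) ^ 2 ≤ p)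
    (hprop : ∀ x y : ℤ, |x| < b₁ → |y| < b₂ → a₁ * x + a₂ * y = 0 → x = 0 ∧ y = 0) :
    ((∑ l ∈ univ.filter (fun l : ZMod p => 2 ≤ (ratioLattice a₁ a₂ b₁ b₂ l).card),
      (ratioLattice a₁ a₂ b₁ b₂ l).card ^ 2 : ℕ) : ℝ)
      ≤ 2 * (100 * (4 * 24 ^ 4)) ^ 2 * (b₁ * b₂) ^ 2 * (1 + Real.log p) := by
  set N : ZMod p → ℕ := fun l => (ratioLattice a₁ a₂ b₁ b₂ l).card with hN
  set T : ℕ → Finset (ZMod p) := fun n => univ.filter fun l => n ≤ N l with hT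
  have hNp : ∀ l, N l ≤ p := fun l => (card_ratioLattice_le l).trans (by omega)
  have h1 : ∑ l ∈ T 2, N l ^ 2 ≤ 2 * ∑ n ∈ Icc 2 p, n * (T n).card := by
    calc ∑ l ∈ T 2, N l ^ 2 ≤ ∑ l ∈ T 2, 2 * ∑ n ∈ Icc 2 p, if n ≤ N l then n else 0 := by
          refine Finset.sum_le_sum fun l hl => ?_
          refine (sq_le_two_mul_sum_Icc (mem_filter.1 hl).2).trans (Nat.mul_le_mul_left _ ?_)
          rw [← Finset.sum_filter]
          refine Finset.sum_le_sum_of_subset fun n hn => ?_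
          rw [mem_Icc] at hn
          exact mem_filter.2 ⟨mem_Icc.2 ⟨hn.1, hn.2.trans (hNp l)⟩, hn.2⟩
      _ ≤ ∑ l, 2 * ∑ n ∈ Icc 2 p, if n ≤ N l then n else 0 :=
          Finset.sum_le_sum_of_subset (subset_univ _)
      _ = 2 * ∑ n ∈ Icc 2 p, n * (T n).card := by
          rw [← Finset.mul_sum, Finset.sum_comm]
          congr 1
          refine Finset.sum_congr rfl fun n _ => ?_
          rw [← Finset.sum_filter, Finset.sum_const, smul_eq_mul, mul_comm]
  set K : ℝ := (100 * (4 * 24 ^ 4)) ^ 2 * (b₁ * b₂) ^ 2 with hK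
  have hK0 : 0 ≤ K := by positivity
  have h2 : ∀ n ∈ Icc 2 p, ((n * (T n).card : ℕ) : ℝ) ≤ K * (n : ℝ)⁻¹ := by
    intro n hn
    rw [mem_Icc] at hn
    have hn0 : (0 : ℝ) < n := by
      have : 0 < n := by omega
      exact_mod_cast this
    have h3 := sq_mul_card_filter_le ha₁ ha₂ hb₁ hb₂ hp hprop hn.1
    have h4 : (n : ℝ) ^ 2 * (T n).card ≤ K := by
      rw [hK]
      exact_mod_cast h3
    rw [← div_eq_mul_inv, le_div_iff₀ hn0]
    push_cast
    linarith
  have h5 : ∑ n ∈ Icc 2 p, (n : ℝ)⁻¹ ≤ 1 + Real.log p := by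
    refine le_trans ?_ (harmonic_le_one_add_log p)
    rw [harmonic_eq_sum_Icc]
    push_cast
    exact Finset.sum_le_sum_of_subset_of_nonneg (Icc_subset_Icc (by norm_num) le_rfl)
      fun _ _ _ => by positivity
  calc ((∑ l ∈ T 2, N l ^ 2 : ℕ) : ℝ) ≤ ((2 * ∑ n ∈ Icc 2 p, n * (T n).card : ℕ) : ℝ) := by
        exact_mod_cast h1
    _ = 2 * ∑ n ∈ Icc 2 p, ((n * (T n).card : ℕ) : ℝ) := by push_cast; rfl
    _ ≤ 2 * ∑ n ∈ Icc 2 p, K * (n : ℝ)⁻¹ := by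
        gcongr with n hn
        exact h2 n hn
    _ = 2 * (K * ∑ n ∈ Icc 2 p, (n : ℝ)⁻¹) := by rw [← Finset.mul_sum]
    _ ≤ 2 * (K * (1 + Real.log p)) := by gcongr
    _ = _ := by rw [hK]; ring

/-- The points `α + a₁ x₁ + a₂ x₂` with `0 ≤ xᵢ < bᵢ`. -/
def progression (α a₁ a₂ : ZMod p) (b₁ b₂ : ℕ) : Finset (ZMod p) :=
  (range b₁ ×ˢ range b₂).image fun x => α + a₁ * (x.1 : ZMod p) + a₂ * (x.2 : ZMod p)

lemma mem_progression {α x : ZMod p} : x ∈ progression α a₁ a₂ b₁ b₂ ↔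
    ∃ m : ℕ × ℕ, (m.1 < b₁ ∧ m.2 < b₂) ∧ α + a₁ * (m.1 : ZMod p) + a₂ * (m.2 : ZMod p) = x := by
  simp only [progression, mem_image, mem_product, mem_range]

lemma card_filter_ratio_le (α l : ZMod p) :
    ((progression α a₁ a₂ b₁ b₂ ×ˢ progression α a₁ a₂ b₁ b₂).filter
      fun x => x.1 = l * x.2).card ≤ (ratioLattice a₁ a₂ b₁ b₂ l).card := by
  set P := progression α a₁ a₂ b₁ b₂ with hP
  have hc : ∀ x : ZMod p, ∃ m : ℕ × ℕ, x ∈ P → (m.1 < b₁ ∧ m.2 < b₂) ∧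
      α + a₁ * (m.1 : ZMod p) + a₂ * (m.2 : ZMod p) = x := by
    intro x
    by_cases hx : x ∈ P
    · obtain ⟨m, hm⟩ := mem_progression.1 hx
      exact ⟨m, fun _ => hm⟩
    · exact ⟨0, fun h => absurd h hx⟩
  choose c hc using hc
  rcases ((P ×ˢ P).filter fun x => x.1 = l * x.2).eq_empty_or_nonempty with h | ⟨⟨s, s'⟩, hs⟩
  · rw [h]
    simp
  simp only [mem_filter, mem_product] at hs
  obtain ⟨⟨hsP, hsP'⟩, hs⟩ := hs
  refine card_le_card_of_injOn (fun x : ZMod p × ZMod p => ![((c x.1).1 : ℤ) - (c s).1,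
    ((c x.1).2 : ℤ) - (c s).2, ((c x.2).1 : ℤ) - (c s').1, ((c x.2).2 : ℤ) - (c s').2]) ?_ ?_
  · rintro ⟨x, x'⟩ hx
    simp only [mem_filter, mem_product, mem_coe] at hx
    obtain ⟨⟨hxP, hxP'⟩, hx⟩ := hx
    have k1 := (hc x hxP).1
    have k2 := (hc x' hxP').1
    have k3 := (hc s hsP).1
    have k4 := (hc s' hsP').1
    rw [mem_coe, mem_ratioLattice]
    refine ⟨⟨?_, ?_, ?_, ?_⟩, ?_⟩
    · simp [abs_lt]; omega
    · simp [abs_lt]; omega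
    · simp [abs_lt]; omega
    · simp [abs_lt]; omega
    · have e1 := (hc x hxP).2
      have e2 := (hc x' hxP').2
      have e3 := (hc s hsP).2
      have e4 := (hc s' hsP').2
      simp only [Matrix.cons_val_zero, Matrix.cons_val_one, Matrix.cons_val]
      push_cast
      linear_combination e1 - e3 - l * (e2 - e4) + hx - hs
  · rintro ⟨x, x'⟩ hx ⟨y, y'⟩ hy h
    simp only [mem_filter, mem_product, mem_coe] at hx hy
    have f0 : ((c x).1 : ℤ) - (c s).1 = (c y).1 - (c s).1 := congrFun h 0
    have f1 : ((c x).2 : ℤ) - (c s).2 = (c y).2 - (c s).2 := congrFun h 1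
    have f2 : ((c x').1 : ℤ) - (c s').1 = (c y').1 - (c s').1 := congrFun h 2
    have f3 : ((c x').2 : ℤ) - (c s').2 = (c y').2 - (c s').2 := congrFun h 3
    have g0 : (c x).1 = (c y).1 := by omega
    have g1 : (c x).2 = (c y).2 := by omega
    have g2 : (c x').1 = (c y').1 := by omega
    have g3 : (c x').2 = (c y').2 := by omega
    rw [Prod.mk.injEq]
    refine ⟨?_, ?_⟩
    · rw [← (hc x hx.1.1).2, ← (hc y hy.1.1).2, g0, g1]
    · rw [← (hc x' hx.1.2).2, ← (hc y' hy.1.2).2, g2, g3]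

lemma two_le_card_ratioLattice {l u u' : ZMod p} (hu : u ∈ progression 0 a₁ a₂ b₁ b₂)
    (hu' : u' ∈ progression 0 a₁ a₂ b₁ b₂) (h0 : u ≠ 0) (h : u = l * u') :
    2 ≤ (ratioLattice a₁ a₂ b₁ b₂ l).card := by
  obtain ⟨m, ⟨hm1, hm2⟩, hm⟩ := mem_progression.1 hu
  obtain ⟨m', ⟨hm1', hm2'⟩, hm'⟩ := mem_progression.1 hu'
  rw [zero_add] at hm hm'
  refine Finset.one_lt_card.2 ⟨![(m.1 : ℤ), m.2, m'.1, m'.2], ?_, 0, ?_, ?_⟩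
  · rw [mem_ratioLattice]
    refine ⟨⟨?_, ?_, ?_, ?_⟩, ?_⟩
    · simpa using hm1
    · simpa using hm2
    · simpa using hm1'
    · simpa using hm2'
    · simp only [Matrix.cons_val_zero, Matrix.cons_val_one, Matrix.cons_val, Int.cast_natCast]
      rw [hm, hm', h]
  · rw [mem_ratioLattice]
    simp
    omega
  · intro h
    have e0 : (m.1 : ℤ) = 0 := congrFun h 0
    have e1 : (m.2 : ℤ) = 0 := congrFun h 1
    refine h0 ?_
    rw [← hm]
    simp [Int.natCast_eq_zero.1 e0, Int.natCast_eq_zero.1 e1]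

lemma sum_sq_card_fiber_le (α : ZMod p) :
    ∑ y : ZMod p, ((progression α a₁ a₂ b₁ b₂ ×ˢ (progression 0 a₁ a₂ b₁ b₂).erase 0).filter
      fun x => x.1 / x.2 = y).card ^ 2
      ≤ ∑ l ∈ univ.filter (fun l : ZMod p => 2 ≤ (ratioLattice a₁ a₂ b₁ b₂ l).card),
        (ratioLattice a₁ a₂ b₁ b₂ l).card ^ 2 := by
  set P := progression α a₁ a₂ b₁ b₂ with hP
  set P₀ := progression 0 a₁ a₂ b₁ b₂ with hP₀
  set Q := P ×ˢ P₀.erase 0 with hQ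
  set E := (Q ×ˢ Q).filter fun x => x.1.1 / x.1.2 = x.2.1 / x.2.2 with hE
  have h1 : ∑ y : ZMod p, (Q.filter fun x => x.1 / x.2 = y).card ^ 2 = E.card := by
    rw [Finset.card_eq_sum_card_fiberwise (f := fun x => x.1.1 / x.1.2) (t := univ)
      fun _ _ => mem_coe.2 (mem_univ _)]
    refine Finset.sum_congr rfl fun y _ => ?_
    rw [sq, ← card_product]
    congr 1
    ext ⟨x, x'⟩
    simp only [hE, mem_product, mem_filter]
    constructor
    · rintro ⟨⟨h1, h2⟩, h3, h4⟩
      exact ⟨⟨⟨h1, h3⟩, h2.trans h4.symm⟩, h2⟩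
    · rintro ⟨⟨⟨h1, h3⟩, h2⟩, h4⟩
      exact ⟨⟨h1, h4⟩, h3, h2.symm.trans h4⟩
  rw [h1, Finset.card_eq_sum_card_fiberwise (f := fun x => x.1.2 / x.2.2) (t := univ)
      fun _ _ => mem_coe.2 (mem_univ _), Finset.sum_filter]
  refine Finset.sum_le_sum fun l _ => ?_
  have hmem : ∀ x ∈ E.filter (fun x => x.1.2 / x.2.2 = l), (x.1.1 ∈ P ∧ x.2.1 ∈ P) ∧
      (x.1.2 ∈ P₀ ∧ x.2.2 ∈ P₀) ∧ x.1.2 ≠ 0 ∧ x.1.2 = l * x.2.2 ∧ x.1.1 = l * x.2.1 := by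
    intro x hx
    simp only [hE, hQ, mem_filter, mem_product, mem_erase] at hx
    obtain ⟨⟨⟨⟨h1, h2, h3⟩, h4, h5, h6⟩, h7⟩, h8⟩ := hx
    rw [div_eq_iff h5] at h8
    refine ⟨⟨h1, h4⟩, ⟨h3, h6⟩, h2, h8, ?_⟩
    rw [div_eq_div_iff h2 h5, h8] at h7
    exact mul_right_cancel₀ h5 (by linear_combination h7)
  split_ifs with h2
  · have h3 : (E.filter fun x => x.1.2 / x.2.2 = l).card
        ≤ (((P ×ˢ P).filter fun x => x.1 = l * x.2) ×ˢ
          ((P₀ ×ˢ P₀).filter fun x => x.1 = l * x.2)).card := by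
      refine card_le_card_of_injOn (fun x => ((x.1.1, x.2.1), (x.1.2, x.2.2))) ?_ ?_
      · intro x hx
        obtain ⟨h4, h5, -, h6, h7⟩ := hmem x hx
        rw [mem_coe, mem_product, mem_filter, mem_filter, mem_product, mem_product]
        exact ⟨⟨h4, h7⟩, h5, h6⟩
      · rintro ⟨⟨x1, x2⟩, x3, x4⟩ _ ⟨⟨y1, y2⟩, y3, y4⟩ _ h
        simp only [Prod.mk.injEq] at h ⊢
        tauto
    rw [card_product] at h3
    rw [sq]
    exact h3.trans (Nat.mul_le_mul (card_filter_ratio_le α l) (card_filter_ratio_le 0 l))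
  · rw [Nat.le_zero, card_eq_zero, eq_empty_iff_forall_notMem]
    intro x hx
    obtain ⟨-, h5, h0, h6, -⟩ := hmem x hx
    exact h2 (two_le_card_ratioLattice h5.1 h5.2 h0 h6)

end Energy

section Holder

lemma sum_mul_pow_two_mul_le {ι : Type*} (s : Finset ι) {w f : ι → ℝ} (hw : ∀ i, 0 ≤ w i)
    (hf : ∀ i, 0 ≤ f i) {r : ℕ} (hr : 0 < r) :
    (∑ i ∈ s, w i * f i) ^ (2 * r) ≤
      (∑ i ∈ s, w i) ^ (2 * r - 2) * (∑ i ∈ s, w i ^ 2) * ∑ i ∈ s, f i ^ (2 * r) := by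
  have hN : 0 ≤ ∑ i ∈ s, w i := sum_nonneg fun i _ => hw i
  have hM : 0 ≤ ∑ i ∈ s, w i * f i ^ r :=
    sum_nonneg fun i _ => mul_nonneg (hw i) (pow_nonneg (hf i) r)
  have hr' : (1 : ℝ) ≤ r := by exact_mod_cast hr
  have h1 : (∑ i ∈ s, w i * f i) ^ r ≤
      (∑ i ∈ s, w i) ^ (r - 1) * ∑ i ∈ s, w i * f i ^ r := by
    have h := Real.inner_le_weight_mul_Lp_of_nonneg s hr' w f hw hf
    simp only [Real.rpow_natCast] at h
    refine (pow_le_pow_left₀ (sum_nonneg fun i _ => mul_nonneg (hw i) (hf i)) h r).trans_eq ?_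
    rw [mul_pow, Real.rpow_inv_natCast_pow hM hr.ne', ← Real.rpow_natCast (_ ^ _),
      ← Real.rpow_mul hN, ← Real.rpow_natCast _ (r - 1), Nat.cast_sub hr]
    congr 2
    field_simp
    simp
  calc (∑ i ∈ s, w i * f i) ^ (2 * r) = ((∑ i ∈ s, w i * f i) ^ r) ^ 2 := by
        rw [← pow_mul, mul_comm]
    _ ≤ ((∑ i ∈ s, w i) ^ (r - 1) * ∑ i ∈ s, w i * f i ^ r) ^ 2 :=
        pow_le_pow_left₀ (pow_nonneg (sum_nonneg fun i _ => mul_nonneg (hw i) (hf i)) r) h1 2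
    _ = (∑ i ∈ s, w i) ^ (2 * r - 2) * (∑ i ∈ s, w i * f i ^ r) ^ 2 := by
        rw [mul_pow, ← pow_mul]
        congr 2
        omega
    _ ≤ (∑ i ∈ s, w i) ^ (2 * r - 2) * ((∑ i ∈ s, w i ^ 2) * ∑ i ∈ s, (f i ^ r) ^ 2) :=
        mul_le_mul_of_nonneg_left (sum_mul_sq_le_sq_mul_sq s _ _) (pow_nonneg hN _)
    _ = _ := by
        simp only [← pow_mul, mul_comm r 2, mul_assoc]

variable {p : ℕ} {a₁ a₂ : ZMod p} {b₁ b₂ : ℕ}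

lemma card_progression_le [Fact p.Prime] (α : ZMod p) : (progression α a₁ a₂ b₁ b₂).card ≤ b₁ * b₂ :=
  card_image_le.trans (by simp)

/-- Averaged over the shifts by multiples of differences, a character sum over a progression is
controlled by complete moments weighted by the representations `y = a / u`. -/
theorem sum_norm_shift_pow_le [Fact p.Prime] {χ : MulChar (ZMod p) ℂ} (hχ : χ ≠ 1)
    {r T : ℕ} (hr : 0 < r) (hT : T ≤ p) (ha₁ : a₁ ≠ 0) (ha₂ : a₂ ≠ 0) (hb₁ : 1 ≤ b₁)
    (hb₂ : 1 ≤ b₂) (hp : 4 * (4 * 24 ^ 4) * (b₁ * b₂) ^ 2 ≤ p)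
    (hprop : ∀ x y : ℤ, |x| < b₁ → |y| < b₂ →
      a₁ * (x : ZMod p) + a₂ * (y : ZMod p) = 0 → x = 0 ∧ y = 0) (α : ZMod p) :
    (∑ a ∈ progression α a₁ a₂ b₁ b₂, ∑ u ∈ (progression 0 a₁ a₂ b₁ b₂).erase 0,
        ‖∑ t ∈ range T, χ (a + u * (t : ZMod p))‖) ^ (2 * r) ≤
      (((b₁ * b₂ : ℕ) : ℝ) ^ 2) ^ (2 * r - 2) *
        (2 * (100 * (4 * 24 ^ 4)) ^ 2 * ((b₁ * b₂ : ℕ) : ℝ) ^ 2 * (1 + Real.log p)) *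
        ((r : ℝ) ^ (2 * r) * (T : ℝ) ^ r * p + (T : ℝ) ^ (2 * r) * (2 * r * √p)) := by
  set B := progression α a₁ a₂ b₁ b₂
  set U := (progression 0 a₁ a₂ b₁ b₂).erase 0
  set ν : ZMod p → ℕ := fun y => ((B ×ˢ U).filter fun x => x.1 / x.2 = y).card with hν
  set G : ZMod p → ℝ := fun y => ‖∑ t : Fin T, χ (y + ((t : ℕ) : ZMod p))‖ with hG
  have hG0 : ∀ y, 0 ≤ G y := fun y => norm_nonneg _
  have hinj : Function.Injective fun t : Fin T => ((t : ℕ) : ZMod p) := by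
    intro t t' h
    have := (ZMod.natCast_eq_natCast_iff' _ _ _).1 h
    rw [Nat.mod_eq_of_lt (t.2.trans_le hT), Nat.mod_eq_of_lt (t'.2.trans_le hT)] at this
    exact Fin.ext this
  have hGsum := sum_norm_sum_mulChar_pow_le hχ hinj hr
  rw [Fintype.card_fin] at hGsum
  have hterm : ∀ x ∈ B ×ˢ U,
      ‖∑ t ∈ range T, χ (x.1 + x.2 * (t : ZMod p))‖ ≤ G (x.1 / x.2) := by
    intro x hx
    have hu : x.2 ≠ 0 := ne_of_mem_erase (mem_product.1 hx).2
    have : ∑ t ∈ range T, χ (x.1 + x.2 * (t : ZMod p)) =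
        χ x.2 * ∑ t : Fin T, χ (x.1 / x.2 + ((t : ℕ) : ZMod p)) := by
      rw [Finset.sum_range, mul_sum]
      refine sum_congr rfl fun t _ => ?_
      rw [← map_mul]
      congr 1
      field_simp
    rw [this, norm_mul]
    exact mul_le_of_le_one_left (norm_nonneg _) (DirichletCharacter.norm_le_one (χ := χ) _)
  have hle : ∑ a ∈ B, ∑ u ∈ U, ‖∑ t ∈ range T, χ (a + u * (t : ZMod p))‖ ≤
      ∑ y, (ν y : ℝ) * G y := by
    rw [← sum_product' B U fun a u => ‖∑ t ∈ range T, χ (a + u * (t : ZMod p))‖]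
    refine (sum_le_sum hterm).trans_eq ?_
    rw [← sum_fiberwise_of_maps_to (g := fun x : ZMod p × ZMod p => x.1 / x.2)
      (fun x _ => mem_univ _)]
    refine sum_congr rfl fun y _ => ?_
    rw [sum_congr rfl fun x hx => by rw [(mem_filter.1 hx).2], sum_const, nsmul_eq_mul]
  have hνsum : ∑ y, (ν y : ℝ) ≤ ((b₁ * b₂ : ℕ) : ℝ) ^ 2 := by
    have h : ∑ y, ν y = (B ×ˢ U).card :=
      (card_eq_sum_card_fiberwise fun x _ => mem_coe.2 (mem_univ _)).symm
    have h' : ∑ y, ν y ≤ (b₁ * b₂) ^ 2 := by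
      rw [h, card_product, sq]
      exact Nat.mul_le_mul (card_progression_le α)
        ((card_le_card (erase_subset _ _)).trans (card_progression_le 0))
    exact_mod_cast h'
  have hνsq : ∑ y, (ν y : ℝ) ^ 2 ≤
      2 * (100 * (4 * 24 ^ 4)) ^ 2 * ((b₁ * b₂ : ℕ) : ℝ) ^ 2 * (1 + Real.log p) := by
    have h := sum_sq_card_ratioLattice_le ha₁ ha₂ hb₁ hb₂ hp hprop
    have h' : ((∑ y, ν y ^ 2 : ℕ) : ℝ) ≤ _ := Nat.cast_le.2 (sum_sq_card_fiber_le α)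
    push_cast at h h' ⊢
    exact h'.trans h
  have hS : 0 ≤ ∑ a ∈ B, ∑ u ∈ U, ‖∑ t ∈ range T, χ (a + u * (t : ZMod p))‖ :=
    sum_nonneg fun _ _ => sum_nonneg fun _ _ => norm_nonneg _
  refine (pow_le_pow_left₀ hS hle _).trans <|
    (sum_mul_pow_two_mul_le univ (fun y => Nat.cast_nonneg (ν y)) hG0 hr).trans ?_
  have h0 : 0 ≤ ∑ y, (ν y : ℝ) := sum_nonneg fun _ _ => Nat.cast_nonneg _
  have h0' : 0 ≤ ∑ y, (ν y : ℝ) ^ 2 := sum_nonneg fun _ _ => sq_nonneg _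
  have h0'' : 0 ≤ ∑ y, G y ^ (2 * r) := sum_nonneg fun y _ => pow_nonneg (hG0 y) _
  exact mul_le_mul (mul_le_mul (pow_le_pow_left₀ h0 hνsum _) hνsq h0'
    (pow_nonneg (sq_nonneg _) _)) hGsum h0''
    (mul_nonneg (pow_nonneg (sq_nonneg _) _) (h0'.trans hνsq))

end Holder

section Packaging

/-- The moment bound, with parameters in the Burgess range, saves a power of `x`. -/
lemma le_mul_rpow_of_pow_le {ε K : ℝ} (hε : 0 < ε) (hK : 1 ≤ K) {r : ℕ} (hr : 0 < r)
    {x S D T : ℝ} (hx : 1 ≤ x) (hD : 0 < D) (hT : 0 ≤ T) (hxT : x ≤ (2 * T) ^ (2 * r))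
    (hDx : x ^ (1 / 4 + ε / 2) ≤ D)
    (h : S ^ (2 * r) ≤ (D ^ 2) ^ (2 * r - 2) * (K * D ^ 2 * (1 + Real.log x)) *
      ((r : ℝ) ^ (2 * r) * T ^ r * x + T ^ (2 * r) * (2 * r * √x))) :
    S ≤ D ^ 2 * T * (K * (1 + 2 / ε) * ((r : ℝ) ^ (2 * r) * 2 ^ r + 2 * r) *
      x ^ (-(ε / (4 * r)))) := by
  have hx0 : 0 < x := by linarith
  have hr1 : (1 : ℝ) ≤ r := by exact_mod_cast hr
  set M : ℝ := (r : ℝ) ^ (2 * r) * 2 ^ r + 2 * r with hM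
  have hM1 : 1 ≤ M := by
    have : 0 ≤ (r : ℝ) ^ (2 * r) * 2 ^ r := by positivity
    linarith
  set C : ℝ := K * (1 + 2 / ε) * M with hC
  have hε2 : 0 < 2 / ε := by positivity
  have hC1 : 1 ≤ C :=
    one_le_mul_of_one_le_of_one_le (one_le_mul_of_one_le_of_one_le hK (by linarith)) hM1
  have hsx : √x ≤ 2 ^ r * T ^ r := by
    rw [← mul_pow]
    refine Real.sqrt_le_iff.2 ⟨by positivity, ?_⟩
    rwa [← pow_mul, mul_comm r 2]
  have hmom : (r : ℝ) ^ (2 * r) * T ^ r * x + T ^ (2 * r) * (2 * r * √x) ≤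
      T ^ (2 * r) * √x * M := by
    have h1 : T ^ r * x ≤ 2 ^ r * T ^ (2 * r) * √x := by
      calc T ^ r * x = T ^ r * √x * √x := by rw [mul_assoc, Real.mul_self_sqrt hx0.le]
        _ ≤ T ^ r * (2 ^ r * T ^ r) * √x := by gcongr
        _ = 2 ^ r * T ^ (2 * r) * √x := by rw [two_mul, pow_add]; ring
    have h2 : (r : ℝ) ^ (2 * r) * (T ^ r * x) ≤
        (r : ℝ) ^ (2 * r) * (2 ^ r * T ^ (2 * r) * √x) := by gcongr
    rw [hM]
    linarith
  have hlog : 1 + Real.log x ≤ (1 + 2 / ε) * x ^ (ε / 2) := by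
    have h1 := Real.log_le_rpow_div hx0.le (half_pos hε)
    have h2 : 1 ≤ x ^ (ε / 2) := Real.one_le_rpow hx (half_pos hε).le
    have h3 : x ^ (ε / 2) / (ε / 2) = 2 / ε * x ^ (ε / 2) := by field_simp
    linarith
  have hlog0 : 0 ≤ Real.log x := Real.log_nonneg hx
  have hsD : √x ≤ D ^ 2 * x ^ (-ε) := by
    have h1 : (x ^ (1 / 4 + ε / 2)) ^ 2 ≤ D ^ 2 := by gcongr
    rw [← Real.rpow_natCast, ← Real.rpow_mul hx0.le] at h1
    calc √x = x ^ ((1 / 4 + ε / 2) * (2 : ℕ)) * x ^ (-ε) := by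
          rw [← Real.rpow_add hx0, Real.sqrt_eq_rpow]
          congr 1
          push_cast
          ring
      _ ≤ D ^ 2 * x ^ (-ε) := by gcongr
  refine le_of_pow_le_pow_left₀ (n := 2 * r) (by omega) (by positivity) (h.trans ?_)
  have hxr : (x ^ (-(ε / (4 * r)))) ^ (2 * r) = x ^ (-(ε / 2)) := by
    rw [← Real.rpow_natCast, ← Real.rpow_mul hx0.le]
    congr 1
    push_cast
    field_simp
    ring
  have hpow : (D ^ 2) ^ (2 * r) = (D ^ 2) ^ (2 * r - 2) * D ^ 2 * D ^ 2 := by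
    rw [mul_assoc, ← sq (D ^ 2), ← pow_add]
    congr 1
    omega
  calc (D ^ 2) ^ (2 * r - 2) * (K * D ^ 2 * (1 + Real.log x)) *
        ((r : ℝ) ^ (2 * r) * T ^ r * x + T ^ (2 * r) * (2 * r * √x))
      ≤ (D ^ 2) ^ (2 * r - 2) * (K * D ^ 2 * ((1 + 2 / ε) * x ^ (ε / 2))) *
        (T ^ (2 * r) * (D ^ 2 * x ^ (-ε)) * M) := by
        refine mul_le_mul (by gcongr) (hmom.trans (by gcongr)) ?_ (by positivity)
        positivity
    _ = (D ^ 2) ^ (2 * r) * T ^ (2 * r) * (C * (x ^ (ε / 2) * x ^ (-ε))) := by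
        rw [hpow, hC]
        ring
    _ = (D ^ 2) ^ (2 * r) * T ^ (2 * r) * (C * x ^ (-(ε / 2))) := by
        rw [← Real.rpow_add hx0]
        ring_nf
    _ ≤ (D ^ 2) ^ (2 * r) * T ^ (2 * r) * (C ^ (2 * r) * x ^ (-(ε / 2))) := by
        gcongr
        exact le_self_pow₀ hC1 (by omega)
    _ = (D ^ 2 * T * (C * x ^ (-(ε / (4 * r))))) ^ (2 * r) := by
        rw [mul_pow (D ^ 2 * T), mul_pow (D ^ 2) T, mul_pow C, hxr]

/-- A sub-box of prescribed size up to a factor `2`. -/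
lemma exists_box_between {X : ℝ} (hX : 1 ≤ X) {c₁ c₂ : ℕ} (h : X ≤ c₁ * c₂) :
    ∃ b₁ b₂ : ℕ, 1 ≤ b₁ ∧ 1 ≤ b₂ ∧ b₁ ≤ c₁ ∧ b₂ ≤ c₂ ∧ X ≤ b₁ * b₂ ∧ (b₁ * b₂ : ℝ) ≤ 2 * X := by
  have hc : (1 : ℝ) ≤ (c₁ * c₂ : ℕ) := by push_cast; exact hX.trans h
  have hc' : 0 < c₁ * c₂ := by exact_mod_cast hc
  have hc₁ : 0 < c₁ := Nat.pos_of_mul_pos_right hc'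
  have hc₂ : 0 < c₂ := Nat.pos_of_mul_pos_left hc'
  have hceil := Nat.ceil_lt_add_one (zero_le_one.trans hX)
  rcases le_total X c₁ with hXc | hXc
  · refine ⟨⌈X⌉₊, 1, Nat.one_le_ceil_iff.2 (by linarith), le_rfl, Nat.ceil_le.2 hXc, hc₂, ?_, ?_⟩
    · simpa using Nat.le_ceil X
    · push_cast
      linarith
  · have hpos : (0 : ℝ) < c₁ := by exact_mod_cast hc₁
    have hdiv : 1 ≤ X / c₁ := (one_le_div hpos).2 hXc
    have hceil' := Nat.ceil_lt_add_one (zero_le_one.trans hdiv)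
    refine ⟨c₁, ⌈X / c₁⌉₊, hc₁, Nat.one_le_ceil_iff.2 (by linarith), le_rfl,
      Nat.ceil_le.2 ((div_le_iff₀ hpos).2 (by linarith)), ?_, ?_⟩
    · rw [mul_comm]
      exact (div_le_iff₀ hpos).1 (Nat.le_ceil _)
    · calc (c₁ * (⌈X / c₁⌉₊ : ℕ) : ℝ) ≤ c₁ * (2 * (X / c₁)) := by
            gcongr
            linarith
        _ = 2 * X := by field_simp

end Packaging

section Shifts

variable {p : ℕ} [Fact p.Prime] {a₁ a₂ : ZMod p} {b₁ b₂ H₁ H₂ : ℕ}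

lemma sum_progression_le_of_forall {f : ZMod p → ℝ} (hf : ∀ a, 0 ≤ f a) {M : ℝ}
    (hb₁ : 1 ≤ b₁) (hb₂ : 1 ≤ b₂) (hM : ∀ β, ∑ a ∈ progression β a₁ a₂ b₁ b₂, f a ≤ M)
    (α : ZMod p) :
    ∑ a ∈ progression α a₁ a₂ H₁ H₂, f a ≤ ((H₁ / b₁ + 1) * (H₂ / b₂ + 1) : ℕ) * M := by
  set I := range (H₁ / b₁ + 1) ×ˢ range (H₂ / b₂ + 1) with hI
  set P : ℕ × ℕ → Finset (ZMod p) := fun k =>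
    progression (α + a₁ * ((b₁ * k.1 : ℕ) : ZMod p) + a₂ * ((b₂ * k.2 : ℕ) : ZMod p)) a₁ a₂ b₁ b₂
    with hP
  have hcover : ∀ a ∈ progression α a₁ a₂ H₁ H₂, f a ≤ ∑ k ∈ I, if a ∈ P k then f a else 0 := by
    intro a ha
    obtain ⟨m, ⟨hm₁, hm₂⟩, rfl⟩ := mem_progression.1 ha
    have hk : (m.1 / b₁, m.2 / b₂) ∈ I := by
      simp only [hI, mem_product, mem_range, Nat.lt_succ_iff]
      exact ⟨Nat.div_le_div_right hm₁.le, Nat.div_le_div_right hm₂.le⟩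
    have hmem : α + a₁ * (m.1 : ZMod p) + a₂ * (m.2 : ZMod p) ∈ P (m.1 / b₁, m.2 / b₂) := by
      refine mem_progression.2 ⟨(m.1 % b₁, m.2 % b₂), ⟨Nat.mod_lt _ hb₁, Nat.mod_lt _ hb₂⟩, ?_⟩
      have hdiv : ∀ m b : ℕ, ((b * (m / b) : ℕ) : ZMod p) + ((m % b : ℕ) : ZMod p) = m :=
        fun m b => by rw [← Nat.cast_add, Nat.div_add_mod]
      linear_combination a₁ * hdiv m.1 b₁ + a₂ * hdiv m.2 b₂
    refine le_trans (by rw [if_pos hmem]) (single_le_sum (f := fun k =>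
      if α + a₁ * (m.1 : ZMod p) + a₂ * (m.2 : ZMod p) ∈ P k then
        f (α + a₁ * (m.1 : ZMod p) + a₂ * (m.2 : ZMod p)) else 0) (fun k _ => ?_) hk)
    split_ifs
    exacts [hf _, le_rfl]
  calc ∑ a ∈ progression α a₁ a₂ H₁ H₂, f a
      ≤ ∑ k ∈ I, ∑ a ∈ progression α a₁ a₂ H₁ H₂, if a ∈ P k then f a else 0 :=
        (sum_le_sum hcover).trans_eq sum_comm
    _ ≤ ∑ k ∈ I, M := by
        refine sum_le_sum fun k _ => le_trans (b := ∑ a ∈ P k, f a) ?_ (hM _)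
        rw [← sum_filter]
        exact sum_le_sum_of_subset_of_nonneg (fun a ha => (mem_filter.1 ha).2) fun a _ _ => hf a
    _ = _ := by
        rw [sum_const, nsmul_eq_mul, hI, card_product, card_range, card_range]

lemma card_shift_sdiff_le (α : ZMod p) (k₁ k₂ : ℕ) :
    (((progression α a₁ a₂ H₁ H₂).map (addRightEmbedding
      (a₁ * (k₁ : ZMod p) + a₂ * (k₂ : ZMod p)))) \ progression α a₁ a₂ H₁ H₂).card ≤
      k₁ * H₂ + k₂ * H₁ := by
  have hsub : ((progression α a₁ a₂ H₁ H₂).map (addRightEmbedding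
      (a₁ * (k₁ : ZMod p) + a₂ * (k₂ : ZMod p)))) \ progression α a₁ a₂ H₁ H₂ ⊆
      ((Ico (H₁ - k₁) H₁ ×ˢ range H₂) ∪ (range H₁ ×ˢ Ico (H₂ - k₂) H₂)).image fun m =>
        α + a₁ * (m.1 : ZMod p) + a₂ * (m.2 : ZMod p) +
          (a₁ * (k₁ : ZMod p) + a₂ * (k₂ : ZMod p)) := by
    intro x hx
    obtain ⟨hx, hx'⟩ := mem_sdiff.1 hx
    obtain ⟨a, ha, rfl⟩ := mem_map.1 hx
    obtain ⟨m, ⟨hm₁, hm₂⟩, rfl⟩ := mem_progression.1 ha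
    refine mem_image.2 ⟨m, ?_, rfl⟩
    by_contra hm
    simp only [mem_union, mem_product, mem_Ico, mem_range] at hm
    refine hx' (mem_progression.2 ⟨(m.1 + k₁, m.2 + k₂), ⟨?_, ?_⟩, ?_⟩)
    · dsimp only
      omega
    · dsimp only
      omega
    · simp only [addRightEmbedding_apply]
      push_cast
      ring
  refine (card_le_card hsub).trans (card_image_le.trans ((card_union_le _ _).trans ?_))
  simp only [card_product, Nat.card_Ico, card_range]
  rw [mul_comm k₂]
  exact add_le_add (Nat.mul_le_mul_right _ (by omega)) (Nat.mul_le_mul_left _ (by omega))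

lemma norm_sum_sub_sum_shift_le {f : ZMod p → ℂ} (hf : ∀ a, ‖f a‖ ≤ 1) (α : ZMod p)
    (k₁ k₂ : ℕ) :
    ‖∑ a ∈ progression α a₁ a₂ H₁ H₂, f a - ∑ a ∈ progression α a₁ a₂ H₁ H₂,
      f (a + (a₁ * (k₁ : ZMod p) + a₂ * (k₂ : ZMod p)))‖ ≤ 2 * (k₁ * H₂ + k₂ * H₁ : ℕ) := by
  set A := progression α a₁ a₂ H₁ H₂
  set e := addRightEmbedding (a₁ * (k₁ : ZMod p) + a₂ * (k₂ : ZMod p))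
  have hbd : ∀ s : Finset (ZMod p), ‖∑ a ∈ s, f a‖ ≤ s.card := fun s =>
    (norm_sum_le_of_le s fun a _ => hf a).trans_eq (by simp)
  have hcard : ((A.map e) \ A).card ≤ k₁ * H₂ + k₂ * H₁ := card_shift_sdiff_le α k₁ k₂
  have hmap : ∑ a ∈ A, f (a + (a₁ * (k₁ : ZMod p) + a₂ * (k₂ : ZMod p))) = ∑ a ∈ A.map e, f a := by
    rw [sum_map]
    rfl
  rw [hmap, ← sum_sdiff_sub_sum_sdiff]
  have hcomm : (A \ A.map e).card = (A.map e \ A).card := card_sdiff_comm (card_map e).symm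
  calc ‖∑ a ∈ A \ A.map e, f a - ∑ a ∈ A.map e \ A, f a‖
      ≤ (A \ A.map e).card + (A.map e \ A).card :=
        (norm_sub_le _ _).trans (add_le_add (hbd _) (hbd _))
    _ = 2 * ((A.map e \ A).card : ℝ) := by rw [hcomm, two_mul]
    _ ≤ _ := by gcongr

lemma card_progression_of_forall
    (hprop : ∀ x y : ℤ, |x| < b₁ → |y| < b₂ →
      a₁ * (x : ZMod p) + a₂ * (y : ZMod p) = 0 → x = 0 ∧ y = 0) (α : ZMod p) :
    (progression α a₁ a₂ b₁ b₂).card = b₁ * b₂ := by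
  rw [progression, card_image_of_injOn, card_product, card_range, card_range]
  intro m hm m' hm' h
  simp only [coe_product, coe_range, Set.mem_prod, Set.mem_Iio] at hm hm'
  dsimp only at h
  have := hprop (m.1 - m'.1) (m.2 - m'.2) (by rw [abs_lt]; omega) (by rw [abs_lt]; omega)
    (by push_cast; linear_combination h)
  exact Prod.ext (by omega) (by omega)

/-- Shifting by products `u t` with `u` a small element of the progression and `t < T` reduces
the estimate of a character sum to averages over translates of a smaller progression. -/
theorem norm_sum_progression_le {f : ZMod p → ℂ} (hf : ∀ a, ‖f a‖ ≤ 1) {T : ℕ} {κ : ℝ}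
    (hT : 1 ≤ T) (hb₁ : 1 ≤ b₁) (hb₂ : 1 ≤ b₂) (hbH₁ : b₁ ≤ H₁) (hbH₂ : b₂ ≤ H₂)
    (hb : 2 ≤ b₁ * b₂) (hTH₁ : T ^ 2 * (b₁ - 1) ≤ H₁) (hTH₂ : T ^ 2 * (b₂ - 1) ≤ H₂)
    (hprop : ∀ x y : ℤ, |x| < b₁ → |y| < b₂ →
      a₁ * (x : ZMod p) + a₂ * (y : ZMod p) = 0 → x = 0 ∧ y = 0)
    (hκ : ∀ β, ∑ a ∈ progression β a₁ a₂ b₁ b₂, ∑ u ∈ (progression 0 a₁ a₂ b₁ b₂).erase 0,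
      ‖∑ t ∈ range T, f (a + u * (t : ZMod p))‖ ≤ ((b₁ * b₂ : ℕ) : ℝ) ^ 2 * T * κ)
    (α : ZMod p) :
    ‖∑ a ∈ progression α a₁ a₂ H₁ H₂, f a‖ ≤ (H₁ * H₂ : ℕ) * (8 * κ + 4 / T) := by
  set A := progression α a₁ a₂ H₁ H₂
  set U := (progression 0 a₁ a₂ b₁ b₂).erase 0 with hU
  set D := b₁ * b₂ with hD
  set N := H₁ * H₂ with hN
  have hT0 : (0 : ℝ) < T := by exact_mod_cast hT
  have hD0 : (0 : ℝ) < D := by exact_mod_cast (by omega : 0 < D)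
  have hκ0 : 0 ≤ κ := by
    have h := (sum_nonneg fun _ _ => sum_nonneg fun _ _ => norm_nonneg _).trans (hκ 0)
    exact nonneg_of_mul_nonneg_right h (by positivity)
  have hUcard : (D : ℝ) / 2 ≤ U.card := by
    have h0 : (0 : ZMod p) ∈ progression 0 a₁ a₂ b₁ b₂ :=
      mem_progression.2 ⟨(0, 0), ⟨hb₁, hb₂⟩, by simp⟩
    have h : U.card = D - 1 := by
      rw [hU, card_erase_of_mem h0, card_progression_of_forall hprop]
    have h' : D ≤ 2 * U.card := by omega
    have : (D : ℝ) ≤ 2 * U.card := by exact_mod_cast h'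
    linarith
  have hshift : ∀ u ∈ U, ∀ t ∈ range T,
      ‖∑ a ∈ A, f a - ∑ a ∈ A, f (a + u * (t : ZMod p))‖ ≤ 4 * N / T := by
    intro u hu t ht
    obtain ⟨m, ⟨hm₁, hm₂⟩, rfl⟩ := mem_progression.1 (mem_of_mem_erase hu)
    have ht := (mem_range.1 ht).le
    have h := norm_sum_sub_sum_shift_le hf α (a₁ := a₁) (a₂ := a₂) (H₁ := H₁) (H₂ := H₂)
      (m.1 * t) (m.2 * t)
    have heq : a₁ * ((m.1 * t : ℕ) : ZMod p) + a₂ * ((m.2 * t : ℕ) : ZMod p) =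
        (0 + a₁ * (m.1 : ZMod p) + a₂ * (m.2 : ZMod p)) * (t : ZMod p) := by
      push_cast
      ring
    rw [heq] at h
    refine h.trans ((le_div_iff₀ hT0).2 ?_)
    have hn : ∀ {m b H K : ℕ}, m < b → T ^ 2 * (b - 1) ≤ H → m * t * K * T ≤ H * K := by
      intro m b H K hm hH
      calc m * t * K * T ≤ (b - 1) * T * K * T := by gcongr; omega
        _ = T ^ 2 * (b - 1) * K := by ring
        _ ≤ H * K := by gcongr
    have h₁ := hn (K := H₂) hm₁ hTH₁
    have h₂ := hn (K := H₁) hm₂ hTH₂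
    have h₃ : 2 * (m.1 * t * H₂ + m.2 * t * H₁) * T ≤ 4 * N := by
      rw [hN]
      linarith
    exact_mod_cast h₃
  have hmain : (U.card : ℝ) * T * ‖∑ a ∈ A, f a‖ ≤
      U.card * T * (4 * N / T) + 4 * N / D * ((D : ℝ) ^ 2 * T * κ) := by
    have hdecomp : (U.card : ℂ) * T * ∑ a ∈ A, f a =
        ∑ u ∈ U, ∑ t ∈ range T, (∑ a ∈ A, f a - ∑ a ∈ A, f (a + u * (t : ZMod p))) +
        ∑ a ∈ A, ∑ u ∈ U, ∑ t ∈ range T, f (a + u * (t : ZMod p)) := by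
      have hswap : ∑ a ∈ A, ∑ u ∈ U, ∑ t ∈ range T, f (a + u * (t : ZMod p)) =
          ∑ u ∈ U, ∑ t ∈ range T, ∑ a ∈ A, f (a + u * (t : ZMod p)) := by
        rw [sum_comm]
        exact sum_congr rfl fun u _ => sum_comm
      rw [hswap]
      simp only [sum_sub_distrib, sum_const, card_range, nsmul_eq_mul]
      ring
    have hnorm : ‖(U.card : ℂ) * T * ∑ a ∈ A, f a‖ = (U.card : ℝ) * T * ‖∑ a ∈ A, f a‖ := by
      rw [norm_mul, norm_mul, Complex.norm_natCast, Complex.norm_natCast]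
    rw [← hnorm, hdecomp]
    refine (norm_add_le _ _).trans (add_le_add ?_ ?_)
    · refine (norm_sum_le_of_le U fun u hu => norm_sum_le_of_le _ fun t ht =>
        hshift u hu t ht).trans_eq ?_
      simp only [sum_const, card_range, nsmul_eq_mul]
      ring
    · have hcover := sum_progression_le_of_forall (H₁ := H₁) (H₂ := H₂)
        (fun a => sum_nonneg fun u _ => norm_nonneg _) hb₁ hb₂ hκ α
      refine (norm_sum_le_of_le A fun a _ => norm_sum_le U _).trans (hcover.trans ?_)
      refine mul_le_mul_of_nonneg_right ((le_div_iff₀ hD0).2 ?_) (by positivity)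
      have hn : ∀ {b H : ℕ}, b ≤ H → (H / b + 1) * b ≤ 2 * H := by
        intro b H h
        have := Nat.div_mul_le_self H b
        rw [add_mul]
        omega
      have h := Nat.mul_le_mul (hn hbH₁) (hn hbH₂)
      have h' : (H₁ / b₁ + 1) * (H₂ / b₂ + 1) * D ≤ 4 * N := by
        rw [hD, hN]
        linarith
      exact_mod_cast h'
  have hU0 : (0 : ℝ) < U.card := by linarith
  have hUT : 0 < (U.card : ℝ) * T := by positivity
  refine le_of_mul_le_mul_left (hmain.trans ?_) hUT
  have h1 : 4 * N / D * ((D : ℝ) ^ 2 * T * κ) = D / 2 * (T * (8 * N * κ)) := by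
    field_simp
    ring
  have h2 : (D : ℝ) / 2 * (T * (8 * N * κ)) ≤ U.card * (T * (8 * N * κ)) :=
    mul_le_mul_of_nonneg_right hUcard (by positivity)
  rw [h1]
  refine (add_le_add_right h2 _).trans_eq ?_
  field_simp
  ring

end Shifts

section Conclusion

lemma rpow_bounds_of_large {ε : ℝ} (hε : 0 < ε) (hε8 : ε ≤ 1 / 8) {x : ℝ}
    (hx : (4 * (4 * (4 * 24 ^ 4))) ^ 3 ≤ x) :
    2 ≤ x ^ (1 / 4 + ε / 2) ∧ 4 * (4 * 24 ^ 4) * (2 * x ^ (1 / 4 + ε / 2)) ^ 2 ≤ x := by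
  have hx16 : (2 : ℝ) ^ 4 ≤ x := le_trans (by norm_num) hx
  have hx1 : 1 ≤ x := le_trans (by norm_num) hx16
  have hx0 : 0 < x := by linarith
  constructor
  · calc (2 : ℝ) = ((2 : ℝ) ^ 4) ^ (1 / 4 : ℝ) := by
          rw [← Real.rpow_natCast, ← Real.rpow_mul (by norm_num)]
          norm_num
      _ ≤ x ^ (1 / 4 : ℝ) := by gcongr
      _ ≤ x ^ (1 / 4 + ε / 2) := by
          refine Real.rpow_le_rpow_of_exponent_le hx1 ?_
          linarith
  · have h1 : (4 * (4 * (4 * 24 ^ 4)) : ℝ) ≤ x ^ (1 / 3 : ℝ) := by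
      calc (4 * (4 * (4 * 24 ^ 4)) : ℝ)
          = ((4 * (4 * (4 * 24 ^ 4)) : ℝ) ^ 3) ^ (1 / 3 : ℝ) := by
            rw [← Real.rpow_natCast (4 * (4 * (4 * 24 ^ 4)) : ℝ) 3,
              ← Real.rpow_mul (by norm_num)]
            norm_num
        _ ≤ x ^ (1 / 3 : ℝ) := by gcongr
    have h2 : (x ^ (1 / 4 + ε / 2)) ^ 2 ≤ x ^ (2 / 3 : ℝ) := by
      rw [← Real.rpow_natCast, ← Real.rpow_mul hx0.le]
      refine Real.rpow_le_rpow_of_exponent_le hx1 ?_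
      push_cast
      linarith
    calc 4 * (4 * 24 ^ 4) * (2 * x ^ (1 / 4 + ε / 2)) ^ 2
        = 4 * (4 * (4 * 24 ^ 4)) * (x ^ (1 / 4 + ε / 2)) ^ 2 := by ring
      _ ≤ x ^ (1 / 3 : ℝ) * x ^ (2 / 3 : ℝ) := by gcongr
      _ = x := by
          rw [← Real.rpow_add hx0]
          norm_num

lemma exists_floor_root {r : ℕ} (hr : 0 < r) {x : ℝ} (hx : 1 ≤ x) :
    ∃ T : ℕ, 1 ≤ T ∧ (T : ℝ) ≤ x ^ (1 / (2 * r : ℝ)) ∧ x ^ (1 / (2 * r : ℝ)) ≤ 2 * T := by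
  have h1 : 1 ≤ x ^ (1 / (2 * r : ℝ)) := Real.one_le_rpow hx (by positivity)
  have hT : 1 ≤ ⌊x ^ (1 / (2 * r : ℝ))⌋₊ := Nat.one_le_floor_iff _ |>.2 h1
  refine ⟨_, hT, Nat.floor_le (by linarith), ?_⟩
  have := Nat.lt_floor_add_one (x ^ (1 / (2 * r : ℝ)))
  have : (1 : ℝ) ≤ (⌊x ^ (1 / (2 * r : ℝ))⌋₊ : ℝ) := by exact_mod_cast hT
  linarith

lemma exists_scaled_side {T H : ℕ} (hT : 1 ≤ T) :
    ∃ c : ℕ, c ≤ H ∧ (H : ℝ) ≤ (T : ℝ) ^ 2 * c ∧ ∀ b ≤ c, T ^ 2 * (b - 1) ≤ H := by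
  have hT0 : (0 : ℝ) < (T : ℝ) ^ 2 := by positivity
  refine ⟨⌈(H : ℝ) / (T : ℝ) ^ 2⌉₊, ?_, ?_, ?_⟩
  · refine Nat.ceil_le.2 (div_le_self (Nat.cast_nonneg _) ?_)
    exact one_le_pow₀ (by exact_mod_cast hT)
  · rw [mul_comm]
    exact (div_le_iff₀ hT0).1 (Nat.le_ceil _)
  · intro b hb
    rcases Nat.eq_zero_or_pos b with rfl | hb0
    · simp
    have h1 : (b : ℝ) < (H : ℝ) / (T : ℝ) ^ 2 + 1 :=
      lt_of_le_of_lt (by exact_mod_cast hb) (Nat.ceil_lt_add_one (by positivity))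
    have h2 : (T : ℝ) ^ 2 * ((b : ℝ) - 1) ≤ H := by
      rw [mul_comm]
      exact (le_div_iff₀ hT0).1 (by linarith)
    rw [← Nat.cast_one, ← Nat.cast_sub hb0] at h2
    exact_mod_cast h2

/-- A Burgess bound for proper two-dimensional progressions modulo a large prime. -/
theorem norm_sum_mulChar_progression_le {ε : ℝ} (hε : 0 < ε) (hε8 : ε ≤ 1 / 8) {r : ℕ}
    (hr : 4 / ε ≤ r) {p : ℕ} [Fact p.Prime] (hp : (4 * (4 * (4 * 24 ^ 4))) ^ 3 ≤ (p : ℝ))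
    {χ : MulChar (ZMod p) ℂ} (hχ : χ ≠ 1) {a₁ a₂ : ZMod p} (ha₁ : a₁ ≠ 0) (ha₂ : a₂ ≠ 0)
    {H₁ H₂ : ℕ} (hprop : ∀ x y : ℤ, |x| < H₁ → |y| < H₂ →
      a₁ * (x : ZMod p) + a₂ * (y : ZMod p) = 0 → x = 0 ∧ y = 0)
    (hH : (p : ℝ) ^ (1 / 4 + ε) ≤ (H₁ * H₂ : ℕ)) (α : ZMod p) :
    ‖∑ a ∈ progression α a₁ a₂ H₁ H₂, χ a‖ ≤
      (8 * (2 * (100 * (4 * 24 ^ 4)) ^ 2 * (1 + 2 / ε) * ((r : ℝ) ^ (2 * r) * 2 ^ r + 2 * r)) + 8) *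
        (p : ℝ) ^ (-(ε / (4 * r))) * (H₁ * H₂ : ℕ) := by
  have hr0 : 0 < r := by
    have : (0 : ℝ) < r := lt_of_lt_of_le (by positivity) hr
    exact_mod_cast this
  have hr0' : (0 : ℝ) < r := by exact_mod_cast hr0
  have hp1 : (1 : ℝ) ≤ p := le_trans (by norm_num) hp
  have hp0 : (0 : ℝ) < p := by linarith
  obtain ⟨hX2, hXp⟩ := rpow_bounds_of_large hε hε8 hp
  obtain ⟨T, hT, hTle, hTge⟩ := exists_floor_root hr0 hp1
  have hT0 : (0 : ℝ) < T := by exact_mod_cast hT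
  have hTp : T ≤ p := by
    have h : (T : ℝ) ≤ (p : ℝ) ^ (1 : ℝ) := hTle.trans <| by
      refine Real.rpow_le_rpow_of_exponent_le hp1 ?_
      rw [div_le_one (by positivity)]
      have : (1 : ℝ) ≤ r := by exact_mod_cast hr0
      linarith
    rw [Real.rpow_one] at h
    exact_mod_cast h
  have hpT : (p : ℝ) ≤ (2 * T) ^ (2 * r) := by
    calc (p : ℝ) = ((p : ℝ) ^ (1 / (2 * r : ℝ))) ^ (2 * r) := by
          rw [← Real.rpow_natCast, ← Real.rpow_mul hp0.le]
          push_cast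
          rw [one_div_mul_cancel (by positivity), Real.rpow_one]
      _ ≤ (2 * T) ^ (2 * r) := by gcongr
  obtain ⟨c₁, hc₁H, hc₁, hbc₁⟩ := exists_scaled_side (H := H₁) hT
  obtain ⟨c₂, hc₂H, hc₂, hbc₂⟩ := exists_scaled_side (H := H₂) hT
  have hT4 : (T : ℝ) ^ 4 ≤ (p : ℝ) ^ (ε / 2) := by
    calc (T : ℝ) ^ 4 ≤ ((p : ℝ) ^ (1 / (2 * r : ℝ))) ^ 4 := by gcongr
      _ = (p : ℝ) ^ (2 / (r : ℝ)) := by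
          rw [← Real.rpow_natCast, ← Real.rpow_mul hp0.le]
          congr 1
          push_cast
          field_simp
          norm_num
      _ ≤ (p : ℝ) ^ (ε / 2) := by
          refine Real.rpow_le_rpow_of_exponent_le hp1 ?_
          rw [div_le_iff₀ hε] at hr
          rw [div_le_iff₀ hr0']
          linarith
  have hcX : (p : ℝ) ^ (1 / 4 + ε / 2) ≤ c₁ * c₂ := by
    have hε2 : 0 < (p : ℝ) ^ (ε / 2) := by positivity
    refine le_of_mul_le_mul_right ?_ hε2
    calc (p : ℝ) ^ (1 / 4 + ε / 2) * (p : ℝ) ^ (ε / 2) = (p : ℝ) ^ (1 / 4 + ε) := by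
          rw [← Real.rpow_add hp0]
          ring_nf
      _ ≤ (H₁ : ℝ) * H₂ := by exact_mod_cast hH
      _ ≤ ((T : ℝ) ^ 2 * c₁) * ((T : ℝ) ^ 2 * c₂) := by gcongr
      _ = c₁ * c₂ * (T : ℝ) ^ 4 := by ring
      _ ≤ c₁ * c₂ * (p : ℝ) ^ (ε / 2) := by gcongr
  obtain ⟨b₁, b₂, hb₁, hb₂, hb₁c, hb₂c, hDX, hDX2⟩ := exists_box_between (by linarith) hcX
  have hD : (p : ℝ) ^ (1 / 4 + ε / 2) ≤ (b₁ * b₂ : ℕ) := by exact_mod_cast hDX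
  have hb : 2 ≤ b₁ * b₂ := by exact_mod_cast hX2.trans hD
  have hDp : 4 * (4 * 24 ^ 4) * (b₁ * b₂) ^ 2 ≤ p := by
    have : (4 * (4 * 24 ^ 4) * ((b₁ : ℝ) * b₂) ^ 2) ≤ p := le_trans (by gcongr) hXp
    exact_mod_cast this
  have hpropb : ∀ x y : ℤ, |x| < b₁ → |y| < b₂ →
      a₁ * (x : ZMod p) + a₂ * (y : ZMod p) = 0 → x = 0 ∧ y = 0 := fun x y hx hy =>
    hprop x y (hx.trans_le (by exact_mod_cast hb₁c.trans hc₁H))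
      (hy.trans_le (by exact_mod_cast hb₂c.trans hc₂H))
  have hκ := fun β => le_mul_rpow_of_pow_le hε (by norm_num) hr0 hp1
    (by exact_mod_cast (by omega : 0 < b₁ * b₂)) hT0.le hpT hD
    (sum_norm_shift_pow_le hχ hr0 hTp ha₁ ha₂ hb₁ hb₂ hDp hpropb β)
  refine (norm_sum_progression_le (f := χ) (DirichletCharacter.norm_le_one (χ := χ)) hT hb₁ hb₂
    (hb₁c.trans hc₁H) (hb₂c.trans hc₂H) hb (hbc₁ b₁ hb₁c) (hbc₂ b₂ hb₂c) hpropb hκ α).trans ?_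
  rw [mul_comm]
  refine mul_le_mul_of_nonneg_right ?_ (Nat.cast_nonneg _)
  have hTinv : 4 / (T : ℝ) ≤ 8 * (p : ℝ) ^ (-(ε / (4 * r))) := by
    calc 4 / (T : ℝ) = 8 / (2 * T) := by field_simp; norm_num
      _ ≤ 8 / (p : ℝ) ^ (1 / (2 * r : ℝ)) := by gcongr
      _ = 8 * (p : ℝ) ^ (-(1 / (2 * r : ℝ))) := by rw [Real.rpow_neg hp0.le, div_eq_mul_inv]
      _ ≤ 8 * (p : ℝ) ^ (-(ε / (4 * r))) := by
          gcongr
          · linarith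
          · norm_num
  linarith

lemma image_Icc_eq_progression {p : ℕ} [Fact p.Prime] (a₀ a₁ a₂ : ZMod p) (H₁ H₂ : ℕ) :
    ((Finset.Icc (1 : ℤ) H₁) ×ˢ (Finset.Icc (1 : ℤ) H₂)).image
      (fun x => a₀ + a₁ * (x.1 : ZMod p) + a₂ * (x.2 : ZMod p)) =
      progression (a₀ + a₁ + a₂) a₁ a₂ H₁ H₂ := by
  ext z
  rw [mem_progression, mem_image]
  constructor
  · rintro ⟨⟨x, y⟩, hxy, rfl⟩
    simp only [mem_product, mem_Icc] at hxy
    refine ⟨((x - 1).toNat, (y - 1).toNat), ⟨by dsimp only; omega, by dsimp only; omega⟩, ?_⟩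
    have h : ∀ w : ℤ, 1 ≤ w → (((w - 1).toNat : ℕ) : ZMod p) = w - 1 := fun w hw => by
      rw [← Int.cast_natCast, Int.toNat_of_nonneg (by omega)]
      push_cast
      rfl
    dsimp only
    rw [h x hxy.1.1, h y hxy.2.1]
    ring
  · rintro ⟨m, hm, rfl⟩
    refine ⟨((m.1 : ℤ) + 1, (m.2 : ℤ) + 1), ?_, ?_⟩
    · simp only [mem_product, mem_Icc]
      omega
    · push_cast
      ring

lemma eq_zero_of_card_image {p : ℕ} {a₀ a₁ a₂ : ZMod p} {H₁ H₂ : ℕ}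
    (hcard : (((Finset.Icc (1 : ℤ) H₁) ×ˢ (Finset.Icc (1 : ℤ) H₂)).image
      (fun x => a₀ + a₁ * (x.1 : ZMod p) + a₂ * (x.2 : ZMod p))).card = H₁ * H₂)
    (x y : ℤ) (hx : |x| < H₁) (hy : |y| < H₂)
    (h : a₁ * (x : ZMod p) + a₂ * (y : ZMod p) = 0) : x = 0 ∧ y = 0 := by
  have hinj := card_image_iff.1 (hcard.trans (by simp : H₁ * H₂ =
    ((Finset.Icc (1 : ℤ) H₁) ×ˢ (Finset.Icc (1 : ℤ) H₂)).card))
  rw [abs_lt] at hx hy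
  have hm : ∀ w : ℤ, max w 0 = w + max (-w) 0 := fun w => by omega
  have := @hinj (1 + max x 0, 1 + max y 0) (mem_coe.2 (by
      simp only [mem_product, mem_Icc]; omega)) (1 + max (-x) 0, 1 + max (-y) 0) (mem_coe.2 (by
      simp only [mem_product, mem_Icc]; omega)) (by
      dsimp only
      rw [hm x, hm y]
      push_cast
      linear_combination h)
  simp only [Prod.mk.injEq] at this
  omega

end Conclusion

/-- **Burgess-type estimate over proper rank-2 GAPs.**
For every ε > 0 there exist δ > 0 and C > 0 such that: for every prime p, every
nontrivial Dirichlet character χ mod p, and every proper rank-2 GAP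
A = {a₀ + a₁x₁ + a₂x₂ : 1 ≤ xᵢ ≤ Hᵢ} ⊆ F_p with |A| ≥ p^(1/4+ε), one has
|∑_{n ∈ A} χ(n)| ≤ C · p^(−δ) · |A|. -/
theorem stmt0 :
    ∀ ε : ℝ, 0 < ε → ∃ δ C : ℝ, 0 < δ ∧ 0 < C ∧
      ∀ (p : ℕ), p.Prime →
      ∀ (χ : DirichletCharacter ℂ p), χ ≠ 1 →
      ∀ (H₁ H₂ : ℕ), 0 < H₁ → 0 < H₂ →
      ∀ (a₀ a₁ a₂ : ZMod p), a₁ ≠ 0 → a₂ ≠ 0 →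
      ∀ (A : Finset (ZMod p)),
        A = ((Finset.Icc (1 : ℤ) H₁) ×ˢ (Finset.Icc (1 : ℤ) H₂)).image
              (fun x => a₀ + a₁ * (x.1 : ZMod p) + a₂ * (x.2 : ZMod p)) →
        A.card = H₁ * H₂ →
        (A.card : ℝ) ≥ (p : ℝ) ^ ((1 / 4 : ℝ) + ε) →
        ‖∑ n ∈ A, χ n‖ ≤ C * (p : ℝ) ^ (-δ) * A.card := by
  intro ε₀ hε₀
  obtain ⟨ε, hε, hε8, hεε₀⟩ : ∃ ε : ℝ, 0 < ε ∧ ε ≤ 1 / 8 ∧ ε ≤ ε₀ :=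
    ⟨min ε₀ (1 / 8), by positivity, min_le_right _ _, min_le_left _ _⟩
  obtain ⟨r, hr⟩ := exists_nat_ge (4 / ε)
  have hr0 : (0 : ℝ) < r := lt_of_lt_of_le (by positivity) hr
  have hδ1 : ε / (4 * r) ≤ 1 := by
    rw [div_le_iff₀ hε] at hr
    rw [div_le_one (by positivity)]
    nlinarith
  set P₀ : ℝ := (4 * (4 * (4 * 24 ^ 4))) ^ 3 with hP₀
  set C₀ : ℝ := 8 * (2 * (100 * (4 * 24 ^ 4)) ^ 2 * (1 + 2 / ε) *
    ((r : ℝ) ^ (2 * r) * 2 ^ r + 2 * r)) + 8 with hC₀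
  have hC₀pos : 0 < C₀ := by positivity
  have hP₀pos : 0 < P₀ := by positivity
  refine ⟨ε / (4 * r), max P₀ C₀, by positivity, lt_max_of_lt_left hP₀pos, ?_⟩
  intro p hp χ hχ H₁ H₂ _ _ a₀ a₁ a₂ ha₁ ha₂ A hA hcard hAp
  have := Fact.mk hp
  have hp1 : (1 : ℝ) ≤ p := by exact_mod_cast hp.one_lt.le
  have hp0 : (0 : ℝ) < p := by linarith
  rcases lt_or_ge (p : ℝ) P₀ with hpP | hpP
  · have htriv : ‖∑ n ∈ A, χ n‖ ≤ A.card :=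
      (norm_sum_le_of_le A fun n _ => DirichletCharacter.norm_le_one (χ := χ) n).trans_eq (by simp)
    refine htriv.trans (le_mul_of_one_le_left (Nat.cast_nonneg _) ?_)
    calc (1 : ℝ) = p * (p : ℝ) ^ (-1 : ℝ) := by
          rw [Real.rpow_neg_one, mul_inv_cancel₀ hp0.ne']
      _ ≤ max P₀ C₀ * (p : ℝ) ^ (-(ε / (4 * r))) := by
          gcongr
          exact hpP.le.trans (le_max_left _ _)
  · rw [hcard] at hAp ⊢
    have hH : (p : ℝ) ^ (1 / 4 + ε) ≤ (H₁ * H₂ : ℕ) :=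
      (Real.rpow_le_rpow_of_exponent_le hp1 (by linarith)).trans hAp
    rw [hA] at hcard
    have hmain := norm_sum_mulChar_progression_le hε hε8 hr hpP hχ ha₁ ha₂
      (eq_zero_of_card_image hcard) hH (a₀ + a₁ + a₂)
    rw [← image_Icc_eq_progression, ← hA] at hmain
    refine hmain.trans ?_
    gcongr
    exact le_max_right _ _
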